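/- Let (Ω, F, P) be a probability space and Y = (Y_t)_{t≥0} a jointly measurable real-valued stochastic process such that there is an even function r : ℝ → ℝ with r(0) = 1 and, for every finite collection t₁, …, t_k ≥ 0 and reals c₁, …, c_k, the random variable Σᵢ cᵢ·Y_{tᵢ} is centered Gaussian with variance Σᵢ Σⱼ cᵢ·cⱼ·r(tᵢ − tⱼ). Assume r ∈ L¹(ℝ). Let α₊, α₋ > 0 with α₊ ≠ α₋, let X_t = α₊·Y_t·1_{Y_t>0} + α₋·Y_t·1_{Y_t<0}, let μ̂_i(T) = (1/T)·∫₀^T X_u^i du for i = 1, 2, and define α̂₊(T) = √(π/2)·μ̂₁(T) + (1/2)·√|4μ̂₂(T) − 2π·μ̂₁(T)²| and α̂₋(T) = −√(π/2)·μ̂₁(T) + (1/2)·√|4μ̂₂(T) − 2π·μ̂₁(T)²|. Then there exists a symmetric positive semidefinite 2×2 real matrix Σ_A such that the ℝ²-valued random vectors √T·(α̂₊(T) − α₊, α̂₋(T) − α₋) converge in distribution, as T → ∞, to a centered bivariate Gaussian vector with covariance matrix Σ_A. -/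

import Mathlib

open MeasureTheory ProbabilityTheory Real Filter Set

/-- A jointly measurable process on `[0, ∞)` that is stationary, centred and Gaussian, with
integrable covariance function `r` and unit variance. -/
structure IsStationaryGaussian {Ω : Type*} [MeasurableSpace Ω] (P : Measure Ω)
    (Y : ℝ → Ω → ℝ) (r : ℝ → ℝ) : Prop where
  measurable_uncurry : Measurable (Function.uncurry Y)
  even : ∀ t, r (-t) = r t
  zero : r 0 = 1
  map_sum : ∀ (k : ℕ) (t c : Fin k → ℝ), (∀ i, 0 ≤ t i) →
      P.map (fun ω => ∑ i, c i * Y (t i) ω)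
        = gaussianReal 0 (Real.toNNReal (∑ i, ∑ j, c i * c j * r (t i - t j)))
  integrable : Integrable r

namespace IsStationaryGaussian

variable {Ω : Type*} [MeasurableSpace Ω] {P : Measure Ω}
  {Y : ℝ → Ω → ℝ} {r : ℝ → ℝ}

lemma measurable (h : IsStationaryGaussian P Y r) (t : ℝ) : Measurable (Y t) :=
  h.measurable_uncurry.comp measurable_prodMk_left

lemma measurable_comp (h : IsStationaryGaussian P Y r) {α : Type*} [MeasurableSpace α]
    {f : α → ℝ} {g : α → Ω} (hf : Measurable f) (hg : Measurable g) :
    Measurable (fun a => Y (f a) (g a)) :=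
  h.measurable_uncurry.comp (hf.prodMk hg)

lemma map_eq (h : IsStationaryGaussian P Y r) {t : ℝ} (ht : 0 ≤ t) :
    P.map (Y t) = gaussianReal 0 1 := by
  have := h.map_sum 1 (fun _ => t) (fun _ => 1) (fun _ => ht)
  simpa [h.zero] using this

lemma integral_comp (h : IsStationaryGaussian P Y r) {t : ℝ} (ht : 0 ≤ t)
    {E : Type*} [NormedAddCommGroup E] [NormedSpace ℝ E] {f : ℝ → E}
    (hf : AEStronglyMeasurable f (gaussianReal 0 1)) :
    ∫ ω, f (Y t ω) ∂P = ∫ x, f x ∂(gaussianReal 0 1) := by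
  rw [← h.map_eq ht, integral_map (h.measurable t).aemeasurable (by rwa [h.map_eq ht])]

lemma integrable_comp (h : IsStationaryGaussian P Y r) {t : ℝ} (ht : 0 ≤ t)
    {E : Type*} [NormedAddCommGroup E] {f : ℝ → E}
    (hf : Integrable f (gaussianReal 0 1)) : Integrable (fun ω => f (Y t ω)) P := by
  rw [← h.map_eq ht] at hf
  exact hf.comp_measurable (h.measurable t)

lemma memLp_two (h : IsStationaryGaussian P Y r) {t : ℝ} (ht : 0 ≤ t) : MemLp (Y t) 2 P := by
  have := memLp_id_gaussianReal (μ := 0) (v := 1) 2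
  rw [← h.map_eq ht, memLp_map_measure_iff (by fun_prop) (h.measurable t).aemeasurable] at this
  exact this

lemma integral_sq_gaussianReal (v : NNReal) : ∫ x, x ^ 2 ∂(gaussianReal 0 v) = v := by
  have := variance_id_gaussianReal (μ := 0) (v := v)
  rw [variance_of_integral_eq_zero (by fun_prop) (by simp)] at this
  simpa using this

lemma integral_sum_sq' (h : IsStationaryGaussian P Y r) {k : ℕ} (t c : Fin k → ℝ)
    (ht : ∀ i, 0 ≤ t i) :
    ∫ ω, (∑ i, c i * Y (t i) ω) ^ 2 ∂P
      = Real.toNNReal (∑ i, ∑ j, c i * c j * r (t i - t j)) := by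
  have hm : Measurable (fun ω => ∑ i, c i * Y (t i) ω) :=
    Finset.measurable_sum _ fun i _ => (h.measurable (t i)).const_mul _
  rw [← integral_sq_gaussianReal, ← h.map_sum k t c ht, integral_map hm.aemeasurable]
  fun_prop

lemma integral_mul (h : IsStationaryGaussian P Y r) {s t : ℝ} (hs : 0 ≤ s) (ht : 0 ≤ t) :
    ∫ ω, Y s ω * Y t ω ∂P = r (s - t) := by
  have hts : r (t - s) = r (s - t) := by rw [← h.even]; congr 1; ring
  have h1 := h.integral_sum_sq' ![s, t] ![1, 1] (by intro i; fin_cases i <;> simpa)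
  have h2 := h.integral_sum_sq' ![s, t] ![1, -1] (by intro i; fin_cases i <;> simpa)
  simp [Fin.sum_univ_two, h.zero, hts] at h1 h2
  have i1 : Integrable (fun ω => Y s ω ^ 2) P := (h.memLp_two hs).integrable_sq
  have i2 : Integrable (fun ω => Y t ω ^ 2) P := (h.memLp_two ht).integrable_sq
  have i3 : Integrable (fun ω => Y s ω * Y t ω) P := (h.memLp_two hs).integrable_mul (h.memLp_two ht)
  have i12 : Integrable (fun ω => Y s ω ^ 2 + Y t ω ^ 2) P := i1.add i2
  have hv : ∀ {u}, 0 ≤ u → ∫ ω, Y u ω ^ 2 ∂P = 1 := fun hu => by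
    rw [h.integral_comp (f := fun x => x ^ 2) hu (by fun_prop), integral_sq_gaussianReal]; simp
  have e1 : ∫ ω, (Y s ω + Y t ω) ^ 2 ∂P = 2 + 2 * ∫ ω, Y s ω * Y t ω ∂P := by
    rw [show (fun ω => (Y s ω + Y t ω) ^ 2)
      = fun ω => (Y s ω ^ 2 + Y t ω ^ 2) + 2 * (Y s ω * Y t ω) by ext; ring,
      integral_add i12 (i3.const_mul 2), integral_add i1 i2, integral_const_mul, hv hs, hv ht]
    ring
  have e2 : ∫ ω, (Y s ω + - Y t ω) ^ 2 ∂P = 2 - 2 * ∫ ω, Y s ω * Y t ω ∂P := by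
    rw [show (fun ω => (Y s ω + - Y t ω) ^ 2)
      = fun ω => (Y s ω ^ 2 + Y t ω ^ 2) - 2 * (Y s ω * Y t ω) by ext; ring,
      integral_sub i12 (i3.const_mul 2), integral_add i1 i2, integral_const_mul, hv hs, hv ht]
    ring
  rw [e1] at h1
  rw [e2] at h2
  rcases max_cases (1 + r (s - t) + (r (s - t) + 1)) 0 with ⟨a, b⟩ | ⟨a, b⟩ <;>
  rcases max_cases (1 + -r (s - t) + (-r (s - t) + 1)) 0 with ⟨a', b'⟩ | ⟨a', b'⟩ <;>
  rw [a] at h1 <;> rw [a'] at h2 <;> linarith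

lemma integral_sum_sq (h : IsStationaryGaussian P Y r) {k : ℕ} (t c : Fin k → ℝ)
    (ht : ∀ i, 0 ≤ t i) :
    ∫ ω, (∑ i, c i * Y (t i) ω) ^ 2 ∂P = ∑ i, ∑ j, c i * c j * r (t i - t j) := by
  have i3 : ∀ i j, Integrable (fun ω => c i * c j * (Y (t i) ω * Y (t j) ω)) P := fun i j =>
    ((h.memLp_two (ht i)).integrable_mul (h.memLp_two (ht j))).const_mul _
  have : (fun ω => (∑ i, c i * Y (t i) ω) ^ 2)
      = fun ω => ∑ i, ∑ j, c i * c j * (Y (t i) ω * Y (t j) ω) := by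
    ext ω
    rw [sq, Finset.sum_mul_sum]
    exact Finset.sum_congr rfl fun i _ => Finset.sum_congr rfl fun j _ => by ring
  rw [this, integral_finsetSum _ fun i _ => integrable_finsetSum _ fun j _ => i3 i j]
  refine Finset.sum_congr rfl fun i _ => ?_
  rw [integral_finsetSum _ fun j _ => i3 i j]
  exact Finset.sum_congr rfl fun j _ => by rw [integral_const_mul, h.integral_mul (ht i) (ht j)]

lemma sum_nonneg (h : IsStationaryGaussian P Y r) {k : ℕ} (t c : Fin k → ℝ)
    (ht : ∀ i, 0 ≤ t i) : 0 ≤ ∑ i, ∑ j, c i * c j * r (t i - t j) := by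
  rw [← h.integral_sum_sq t c ht]
  exact integral_nonneg fun ω => sq_nonneg _

/-- The characteristic function of the finite-dimensional distributions. -/
lemma integral_cexp_sum (h : IsStationaryGaussian P Y r) {k : ℕ} (t c : Fin k → ℝ)
    (ht : ∀ i, 0 ≤ t i) :
    ∫ ω, Complex.exp (((∑ i, c i * Y (t i) ω : ℝ) : ℂ) * Complex.I) ∂P
      = Complex.exp (-((∑ i, ∑ j, c i * c j * r (t i - t j) : ℝ) : ℂ) / 2) := by
  have hm : Measurable (fun ω => ∑ i, c i * Y (t i) ω) :=
    Finset.measurable_sum _ fun i _ => (h.measurable (t i)).const_mul _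
  have := charFun_gaussianReal (μ := 0)
    (v := Real.toNNReal (∑ i, ∑ j, c i * c j * r (t i - t j))) 1
  rw [← h.map_sum k t c ht, charFun_apply_real, integral_map hm.aemeasurable (by fun_prop)] at this
  simp only [Complex.ofReal_one, one_mul, mul_zero, zero_mul, Complex.ofReal_zero] at this
  rw [this]
  congr 1
  rw [Real.coe_toNNReal _ (h.sum_nonneg t c ht)]
  ring

lemma abs_le_one (h : IsStationaryGaussian P Y r) (x : ℝ) : |r x| ≤ 1 := by
  have h0 : 0 ≤ max x 0 := le_max_right _ _
  have h1 : 0 ≤ max (-x) 0 := le_max_right _ _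
  have e : max x 0 - max (-x) 0 = x := by
    rcases le_total x 0 with hx | hx <;> simp [hx]
  have e' : max (-x) 0 - max x 0 = -x := by linarith
  have a := h.sum_nonneg ![max x 0, max (-x) 0] ![1, 1] (by intro i; fin_cases i <;> simp)
  have b := h.sum_nonneg ![max x 0, max (-x) 0] ![1, -1] (by intro i; fin_cases i <;> simp)
  simp [Fin.sum_univ_two, h.zero, e, e', h.even, -neg_add_rev] at a b
  rw [abs_le]; constructor <;> linarith

lemma measurable_cov [IsProbabilityMeasure P] (h : IsStationaryGaussian P Y r) : Measurable r := by
  have e : r = fun x => ∫ ω, Y (max x 0) ω * Y (max (-x) 0) ω ∂P := by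
    ext x
    rw [h.integral_mul (le_max_right _ _) (le_max_right _ _)]
    congr 1
    rcases le_total x 0 with hx | hx <;> simp [hx]
  rw [e]
  have : Measurable (fun p : ℝ × Ω => Y (max p.1 0) p.2 * Y (max (-p.1) 0) p.2) :=
    (h.measurable_comp (by fun_prop) measurable_snd).mul
      (h.measurable_comp (by fun_prop) measurable_snd)
  exact this.stronglyMeasurable.integral_prod_right.measurable

end IsStationaryGaussian

lemma integral_gaussianReal_zero_one {E : Type*} [NormedAddCommGroup E] [NormedSpace ℝ E]
    (f : ℝ → E) :
    ∫ x, f x ∂(gaussianReal 0 1) = (√(2 * π))⁻¹ • ∫ x, rexp (-x ^ 2 / 2) • f x := by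
  rw [integral_gaussianReal_eq_integral_smul one_ne_zero, ← integral_smul]
  refine integral_congr_ae (Eventually.of_forall fun x => ?_)
  simp [gaussianPDFReal, smul_smul]

lemma integrable_gaussian_weight :
    Integrable (fun x : ℝ => (1 + x ^ 2) * rexp (-x ^ 2 / 2)) := by
  have h1 := integrable_exp_neg_mul_sq (b := 1 / 2) (by norm_num)
  have h2 := integrable_rpow_mul_exp_neg_mul_sq (b := 1 / 2) (by norm_num) (s := 2) (by norm_num)
  refine (h1.add h2).congr (Eventually.of_forall fun x => ?_)
  simp only [Pi.add_apply, rpow_two]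
  rw [show -(1 / 2) * x ^ 2 = -x ^ 2 / 2 by ring]
  ring

/-- The solution of the Stein equation `x k - k' = g` for a centred `g`. -/
noncomputable def steinSolution (g : ℝ → ℝ) (x : ℝ) : ℝ :=
  rexp (x ^ 2 / 2) * ∫ y in Ioi x, g y * rexp (-y ^ 2 / 2)

/-- A centred function of at most quadratic growth, differentiable away from the origin with
derivative `g'`. -/
structure IsAdmissible (g g' : ℝ → ℝ) : Prop where
  continuous : Continuous g
  hasDerivAt : ∀ x ≠ 0, HasDerivAt g (g' x) x
  measurable_deriv : Measurable g'
  bound : ∃ C, 0 ≤ C ∧ ∀ x, |g x| ≤ C * (1 + x ^ 2) ∧ |g' x| ≤ C * (1 + x ^ 2)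
  integral_eq_zero : ∫ x, g x ∂(gaussianReal 0 1) = 0

namespace IsAdmissible

variable {g g' : ℝ → ℝ}

lemma integrable_mul_exp (h : IsAdmissible g g') :
    Integrable (fun x => g x * rexp (-x ^ 2 / 2)) := by
  obtain ⟨C, hC, hb⟩ := h.bound
  refine (integrable_gaussian_weight.const_mul C).mono'
    (h.continuous.mul (by fun_prop)).aestronglyMeasurable (Eventually.of_forall fun x => ?_)
  rw [norm_mul, norm_eq_abs, norm_eq_abs, abs_exp, ← mul_assoc]
  exact mul_le_mul_of_nonneg_right (hb x).1 (exp_pos _).le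

lemma integral_mul_exp (h : IsAdmissible g g') : ∫ x, g x * rexp (-x ^ 2 / 2) = 0 := by
  have := h.integral_eq_zero
  rw [integral_gaussianReal_zero_one, smul_eq_mul, mul_eq_zero] at this
  rcases this with h0 | h0
  · exact absurd h0 (by positivity)
  · simpa [mul_comm] using h0

lemma steinSolution_bound (h : IsAdmissible g g') :
    ∃ C, 0 ≤ C ∧ ∀ x, |steinSolution g x| ≤ C * (1 + x ^ 2) := by
  obtain ⟨C, hC, hb⟩ := h.bound
  set I := ∫ y : ℝ, (1 + y ^ 2) * rexp (-y ^ 2 / 2)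
  have hI : 0 ≤ I := integral_nonneg fun y => by positivity
  have key : ∀ (x : ℝ) (s : Set ℝ), MeasurableSet s → (∀ y ∈ s, 0 ≤ x * (y - x)) →
      |rexp (x ^ 2 / 2) * ∫ y in s, g y * rexp (-y ^ 2 / 2)| ≤ 2 * C * I * (1 + x ^ 2) := by
    intro x s hs hxy
    rw [abs_mul, abs_exp]
    have hW : Integrable (fun y : ℝ => (1 + (y - x) ^ 2) * rexp (-(y - x) ^ 2 / 2)) :=
      integrable_gaussian_weight.comp_sub_right x
    have h1 : |∫ y in s, g y * rexp (-y ^ 2 / 2)|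
        ≤ ∫ y in s, 2 * C * (1 + x ^ 2) * rexp (-x ^ 2 / 2)
            * ((1 + (y - x) ^ 2) * rexp (-(y - x) ^ 2 / 2)) := by
      rw [← norm_eq_abs]
      refine norm_integral_le_of_norm_le (hW.const_mul _).integrableOn ?_
      filter_upwards [ae_restrict_mem hs] with y hy
      rw [norm_mul, norm_eq_abs, norm_eq_abs, abs_exp]
      have e1 : rexp (-y ^ 2 / 2) ≤ rexp (-x ^ 2 / 2) * rexp (-(y - x) ^ 2 / 2) := by
        rw [← exp_add]
        apply exp_le_exp.2
        nlinarith [hxy y hy]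
      have e2 : 1 + y ^ 2 ≤ 2 * (1 + x ^ 2) * (1 + (y - x) ^ 2) := by
        nlinarith [sq_nonneg (x * (y - x)), sq_nonneg (x - (y - x))]
      calc |g y| * rexp (-y ^ 2 / 2)
          ≤ (C * (2 * (1 + x ^ 2) * (1 + (y - x) ^ 2)))
              * (rexp (-x ^ 2 / 2) * rexp (-(y - x) ^ 2 / 2)) := by
            refine mul_le_mul ((hb y).1.trans (mul_le_mul_of_nonneg_left e2 hC)) e1
              (exp_pos _).le (by positivity)
        _ = _ := by ring
    have h2 : ∫ y in s, 2 * C * (1 + x ^ 2) * rexp (-x ^ 2 / 2)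
            * ((1 + (y - x) ^ 2) * rexp (-(y - x) ^ 2 / 2))
        ≤ 2 * C * (1 + x ^ 2) * rexp (-x ^ 2 / 2) * I := by
      rw [integral_const_mul]
      refine mul_le_mul_of_nonneg_left ?_ (by positivity)
      refine (setIntegral_le_integral hW (Eventually.of_forall fun y => by positivity)).trans_eq ?_
      exact integral_sub_right_eq_self (fun y : ℝ => (1 + y ^ 2) * rexp (-y ^ 2 / 2)) x
    calc rexp (x ^ 2 / 2) * |∫ y in s, g y * rexp (-y ^ 2 / 2)|
        ≤ rexp (x ^ 2 / 2) * (2 * C * (1 + x ^ 2) * rexp (-x ^ 2 / 2) * I) :=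
          mul_le_mul_of_nonneg_left (h1.trans h2) (exp_pos _).le
      _ = (rexp (x ^ 2 / 2) * rexp (-x ^ 2 / 2)) * (2 * C * I * (1 + x ^ 2)) := by ring
      _ = _ := by rw [← exp_add, show x ^ 2 / 2 + -x ^ 2 / 2 = 0 by ring]; simp
  refine ⟨2 * C * I, by positivity, fun x => ?_⟩
  rcases le_total 0 x with hx | hx
  · refine key x (Ioi x) measurableSet_Ioi fun y hy => mul_nonneg hx (sub_nonneg.2 (le_of_lt hy))
  · have := key x (Iic x) measurableSet_Iic fun y hy =>
      mul_nonneg_of_nonpos_of_nonpos hx (sub_nonpos.2 hy)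
    have e : ∫ y in Ioi x, g y * rexp (-y ^ 2 / 2) = - ∫ y in Iic x, g y * rexp (-y ^ 2 / 2) := by
      have := intervalIntegral.integral_Iic_add_Ioi (b := x) h.integrable_mul_exp.integrableOn
        h.integrable_mul_exp.integrableOn
      rw [h.integral_mul_exp] at this
      linarith
    rw [steinSolution, e, mul_neg, abs_neg]
    exact this

lemma hasDerivAt_tail (h : IsAdmissible g g') (x : ℝ) :
    HasDerivAt (fun x => ∫ y in Ioi x, g y * rexp (-y ^ 2 / 2)) (-(g x * rexp (-x ^ 2 / 2))) x := by
  have hc : Continuous (fun y => g y * rexp (-y ^ 2 / 2)) := h.continuous.mul (by fun_prop)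
  have e : (fun x => ∫ y in Ioi x, g y * rexp (-y ^ 2 / 2))
      = fun x => (∫ y in Ioi 0, g y * rexp (-y ^ 2 / 2))
        - ∫ y in (0 : ℝ)..x, g y * rexp (-y ^ 2 / 2) := by
    ext x
    have := intervalIntegral.integral_Ioi_sub_Ioi' (a := 0) (b := x)
      h.integrable_mul_exp.integrableOn h.integrable_mul_exp.integrableOn
    linarith
  rw [e, show -(g x * rexp (-x ^ 2 / 2)) = 0 - g x * rexp (-x ^ 2 / 2) by ring]
  exact (hasDerivAt_const _ _).sub (hc.integral_hasStrictDerivAt 0 x).hasDerivAt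

lemma continuous_steinSolution (h : IsAdmissible g g') : Continuous (steinSolution g) :=
  (by fun_prop : Continuous fun x : ℝ => rexp (x ^ 2 / 2)).mul
    (continuous_iff_continuousAt.2 fun x => (h.hasDerivAt_tail x).continuousAt)

/-- Gaussian integration by parts. -/
lemma integral_mul_eq_integral_steinSolution_mul (h : IsAdmissible g g') {f f' : ℝ → ℂ}
    (hf : Continuous f) {M : ℝ} (hM : ∀ x, ‖f x‖ ≤ M) {s : Set ℝ} (hs : s.Countable)
    (hd : ∀ x ∉ s, HasDerivAt f (f' x) x)
    (hint : Integrable (fun x => (steinSolution g x : ℂ) * f' x) (gaussianReal 0 1)) :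
    ∫ x, (g x : ℂ) * f x ∂(gaussianReal 0 1)
      = ∫ x, (steinSolution g x : ℂ) * f' x ∂(gaussianReal 0 1) := by
  set K := fun x => ∫ y in Ioi x, g y * rexp (-y ^ 2 / 2) with hK
  have hKk : ∀ x, K x = rexp (-x ^ 2 / 2) * steinSolution g x := by
    intro x
    rw [steinSolution, ← mul_assoc, ← exp_add, show -x ^ 2 / 2 + x ^ 2 / 2 = 0 by ring]
    simp [hK]
  obtain ⟨C, hC, hk⟩ := h.steinSolution_bound
  have hM0 : 0 ≤ M := (norm_nonneg _).trans (hM 0)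
  have i1 : Integrable (fun x => ((g x * rexp (-x ^ 2 / 2) : ℝ) : ℂ) * f x) := by
    refine (h.integrable_mul_exp.ofReal (𝕜 := ℂ)).mul_bdd (c := M) hf.aestronglyMeasurable
      (Eventually.of_forall hM)
  have i2 : Integrable (fun x => (K x : ℂ) * f' x) := by
    rw [gaussianReal_of_var_ne_zero _ one_ne_zero,
      integrable_withDensity_iff_integrable_smul' (by fun_prop)
      (Eventually.of_forall fun x => by simp [gaussianPDF])] at hint
    refine (hint.const_mul (√(2 * π) : ℂ)).congr (Eventually.of_forall fun x => ?_)
    have hp : (√(2 * π) : ℂ) ≠ 0 := by exact_mod_cast (by positivity : √(2 * π) ≠ 0)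
    simp only [toReal_gaussianPDF, gaussianPDFReal, hKk, Complex.real_smul]
    push_cast
    simp only [sub_zero, mul_one]
    field_simp
  have hder : ∀ x ∉ s, HasDerivAt (fun x => (K x : ℂ) * f x)
      (((-(g x * rexp (-x ^ 2 / 2)) : ℝ) : ℂ) * f x + (K x : ℂ) * f' x) x := fun x hx =>
    (h.hasDerivAt_tail x).ofReal_comp.mul (hd x hx)
  have hKc : Continuous K := continuous_iff_continuousAt.2 fun x => (h.hasDerivAt_tail x).continuousAt
  have hcont : Continuous (fun x => (K x : ℂ) * f x) := by fun_prop
  have i3 : Integrable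
      (fun x => ((-(g x * rexp (-x ^ 2 / 2)) : ℝ) : ℂ) * f x + (K x : ℂ) * f' x) := by
    refine (i1.neg.add i2).congr (Eventually.of_forall fun x => ?_)
    simp
  have hlim := intervalIntegral_tendsto_integral i3 (tendsto_neg_atTop_atBot (G := ℝ)) tendsto_id
  have hFTC : ∀ R : ℝ, ∫ x in (-R)..R, ((-(g x * rexp (-x ^ 2 / 2)) : ℝ) : ℂ) * f x + (K x : ℂ) * f' x
      = (K R : ℂ) * f R - (K (-R) : ℂ) * f (-R) := fun R =>
    integral_eq_of_hasDerivAt_off_countable _ _ hs hcont.continuousOn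
      (fun x hx => hder x hx.2) i3.intervalIntegrable
  have hw : Tendsto (fun R : ℝ => C * ((1 + R ^ 2) * rexp (-R ^ 2 / 2)) * M) atTop (nhds 0) := by
    have hu : Tendsto (fun R : ℝ => R ^ 2 / 2) atTop atTop :=
      (tendsto_pow_atTop two_ne_zero).atTop_div_const two_pos
    have h0 := (tendsto_pow_mul_exp_neg_atTop_nhds_zero 0).comp hu
    have h1 := (tendsto_pow_mul_exp_neg_atTop_nhds_zero 1).comp hu
    have := ((h0.add (h1.const_mul 2)).const_mul C).mul_const M
    simp only [mul_zero, add_zero, zero_mul] at this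
    refine this.congr fun R => ?_
    simp only [Function.comp, neg_div]
    ring
  have hKb : ∀ R, ‖(K R : ℂ) * f R‖ ≤ C * ((1 + R ^ 2) * rexp (-R ^ 2 / 2)) * M := by
    intro R
    rw [norm_mul, Complex.norm_real, norm_eq_abs, hKk, abs_mul, abs_exp]
    refine mul_le_mul ?_ (hM R) (norm_nonneg _) (by positivity)
    calc _ ≤ rexp (-R ^ 2 / 2) * (C * (1 + R ^ 2)) := mul_le_mul_of_nonneg_left (hk R) (exp_pos _).le
      _ = _ := by ring
  have hlim0 : Tendsto (fun R : ℝ => (K R : ℂ) * f R - (K (-R) : ℂ) * f (-R)) atTop (nhds 0) := by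
    rw [← sub_zero (0 : ℂ)]
    refine (squeeze_zero_norm hKb hw).sub (squeeze_zero_norm (fun R => ?_) hw)
    have := hKb (-R)
    simpa using this
  have hz := tendsto_nhds_unique (hlim.congr fun R => hFTC R) hlim0
  have hz' : ∫ x, ((g x * rexp (-x ^ 2 / 2) : ℝ) : ℂ) * f x = ∫ x, (K x : ℂ) * f' x := by
    have e : ∀ x, ((-(g x * rexp (-x ^ 2 / 2)) : ℝ) : ℂ) * f x + (K x : ℂ) * f' x
      = (K x : ℂ) * f' x - ((g x * rexp (-x ^ 2 / 2) : ℝ) : ℂ) * f x := fun x => by push_cast; ring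
    simp_rw [e] at hz
    rw [integral_sub i2 i1] at hz
    exact (sub_eq_zero.1 hz).symm
  rw [integral_gaussianReal_zero_one, integral_gaussianReal_zero_one]
  congr 1
  convert hz' using 2
  · ext x; simp only [Complex.real_smul]; push_cast; ring
  · ext x; simp only [Complex.real_smul, hKk]; push_cast; ring

end IsAdmissible

lemma ext_of_integral_cexp_sum {k : ℕ} {μ ν : Measure (Fin k → ℝ)} [IsFiniteMeasure μ]
    [IsFiniteMeasure ν]
    (h : ∀ c : Fin k → ℝ, ∫ x, Complex.exp (((∑ i, c i * x i : ℝ) : ℂ) * Complex.I) ∂μ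
      = ∫ x, Complex.exp (((∑ i, c i * x i : ℝ) : ℂ) * Complex.I) ∂ν) : μ = ν := by
  refine Measure.ext_of_charFunDual (funext fun L => ?_)
  have hL : ∀ x, L x = ∑ i, L (Pi.single i 1) * x i := by
    intro x
    conv_lhs => rw [← Finset.univ_sum_single x, map_sum]
    refine Finset.sum_congr rfl fun i _ => ?_
    rw [show Pi.single i (x i) = x i • (Pi.single i 1 : Fin k → ℝ) by
      ext j; by_cases hj : j = i
      · subst hj; simp
      · simp [hj], map_smul, smul_eq_mul, mul_comm]
  rw [charFunDual_apply, charFunDual_apply]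
  simpa only [← hL] using h fun i => L (Pi.single i 1)

lemma measurable_cexp_sum {k : ℕ} (c : Fin k → ℝ) :
    Measurable fun x : Fin k → ℝ => Complex.exp (((∑ i, c i * x i : ℝ) : ℂ) * Complex.I) := by
  have : Measurable fun x : Fin k → ℝ => ∑ i, c i * x i :=
    Finset.measurable_sum _ fun i _ => (measurable_pi_apply i).const_mul _
  fun_prop

lemma memLp_gaussianReal_of_bound {A : ℝ → ℝ} (hA : Measurable A) {C : ℝ}
    (hb : ∀ x, |A x| ≤ C * (1 + x ^ 2)) : MemLp A 4 (gaussianReal 0 1) := by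
  have h8 : MemLp (fun x : ℝ => x) 8 (gaussianReal 0 1) := memLp_id_gaussianReal 8
  have : ENNReal.HolderTriple 8 8 4 := ⟨by
    rw [← two_mul, show (8 : ENNReal) = 2 * 4 by norm_num,
      ENNReal.mul_inv (by simp) (by simp), ← mul_assoc, ENNReal.mul_inv_cancel (by simp) (by simp),
      one_mul]⟩
  have h4 : MemLp (fun x : ℝ => x * x) 4 (gaussianReal 0 1) := h8.mul h8
  have := ((memLp_const (1 : ℝ)).add h4).const_mul C
  refine this.mono' hA.aestronglyMeasurable (Eventually.of_forall fun x => ?_)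
  rw [norm_eq_abs]
  refine (hb x).trans_eq ?_
  simp [sq]

namespace IsStationaryGaussian

variable {Ω : Type*} [MeasurableSpace Ω] {P : Measure Ω} [IsProbabilityMeasure P]
  {Y : ℝ → Ω → ℝ} {r : ℝ → ℝ}

lemma memLp_comp (h : IsStationaryGaussian P Y r) {t : ℝ} (ht : 0 ≤ t) {A : ℝ → ℝ} {p : ENNReal}
    (hA : MemLp A p (gaussianReal 0 1)) : MemLp (fun ω => A (Y t ω)) p P := by
  rw [← h.map_eq ht] at hA
  exact hA.comp_of_map (h.measurable t).aemeasurable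

lemma memLp_mul (h : IsStationaryGaussian P Y r) {s t : ℝ} (hs : 0 ≤ s) (ht : 0 ≤ t)
    {A B : ℝ → ℝ} (hA : MemLp A 4 (gaussianReal 0 1)) (hB : MemLp B 4 (gaussianReal 0 1)) :
    MemLp (fun ω => A (Y s ω) * B (Y t ω)) 2 P := by
  have : ENNReal.HolderTriple 4 4 2 := ⟨by
    rw [← two_mul, show (4 : ENNReal) = 2 * 2 by norm_num,
      ENNReal.mul_inv (by simp) (by simp), ← mul_assoc, ENNReal.mul_inv_cancel (by simp) (by simp),
      one_mul]⟩
  exact (h.memLp_comp ht hB).mul (h.memLp_comp hs hA)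

lemma integrable_mul_comp (h : IsStationaryGaussian P Y r) {s t : ℝ} (hs : 0 ≤ s) (ht : 0 ≤ t)
    {A B : ℝ → ℝ} (hA : MemLp A 4 (gaussianReal 0 1)) (hB : MemLp B 4 (gaussianReal 0 1)) :
    Integrable (fun ω => A (Y s ω) * B (Y t ω)) P :=
  (h.memLp_mul hs ht hA hB).integrable (by norm_num)

lemma integral_mul_sq_le (h : IsStationaryGaussian P Y r) {s t : ℝ} (hs : 0 ≤ s) (ht : 0 ≤ t)
    {A B : ℝ → ℝ} (hA : MemLp A 4 (gaussianReal 0 1)) (hB : MemLp B 4 (gaussianReal 0 1)) :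
    ∫ ω, (A (Y s ω) * B (Y t ω)) ^ 2 ∂P
      ≤ (∫ x, A x ^ 4 ∂(gaussianReal 0 1)) + ∫ x, B x ^ 4 ∂(gaussianReal 0 1) := by
  have i4 : ∀ {A : ℝ → ℝ}, MemLp A 4 (gaussianReal 0 1) →
      Integrable (fun x => A x ^ 4) (gaussianReal 0 1) := fun hA => by
    refine (hA.integrable_norm_pow (p := 4) (by norm_num)).congr (Eventually.of_forall fun x => ?_)
    exact Even.pow_abs (by decide) _
  rw [← h.integral_comp hs (i4 hA).1, ← h.integral_comp ht (i4 hB).1,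
    ← integral_add (h.integrable_comp hs (i4 hA)) (h.integrable_comp ht (i4 hB))]
  refine integral_mono (h.memLp_mul hs ht hA hB).integrable_sq
    ((h.integrable_comp hs (i4 hA)).add (h.integrable_comp ht (i4 hB))) fun ω => ?_
  nlinarith [sq_nonneg (A (Y s ω) ^ 2 - B (Y t ω) ^ 2), sq_nonneg (A (Y s ω) ^ 2),
    sq_nonneg (B (Y t ω) ^ 2)]

/-- Regression of the process on its value at one time. -/
lemma map_eq_map_regression (h : IsStationaryGaussian P Y r) {k : ℕ} (t : Fin k → ℝ)
    (ht : ∀ i, 0 ≤ t i) {v : ℝ} (hv : 0 ≤ v) :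
    P.map (fun ω i => Y (t i) ω)
      = (P.prod (gaussianReal 0 1)).map
          (fun p i => r (t i - v) * p.2 + (Y (t i) p.1 - r (t i - v) * Y v p.1)) := by
  have m1 : Measurable (fun ω i => Y (t i) ω) := measurable_pi_lambda _ fun i => h.measurable _
  have m2 : Measurable (fun (p : Ω × ℝ) i =>
      r (t i - v) * p.2 + (Y (t i) p.1 - r (t i - v) * Y v p.1)) :=
    measurable_pi_lambda _ fun i => (measurable_snd.const_mul _).add
      (((h.measurable _).comp measurable_fst).sub (((h.measurable _).comp measurable_fst).const_mul _))
  have := Measure.isProbabilityMeasure_map (μ := P) m1.aemeasurable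
  have := Measure.isProbabilityMeasure_map (μ := P.prod (gaussianReal 0 1)) m2.aemeasurable
  refine ext_of_integral_cexp_sum fun c => ?_
  have cm := measurable_cexp_sum c
  rw [integral_map m1.aemeasurable cm.aestronglyMeasurable,
    integral_map m2.aemeasurable cm.aestronglyMeasurable,
    h.integral_cexp_sum t c ht]
  set a := ∑ i, c i * r (t i - v) with ha
  have e1 : ∀ p : Ω × ℝ,
      Complex.exp (((∑ i, c i * (r (t i - v) * p.2 + (Y (t i) p.1 - r (t i - v) * Y v p.1)) : ℝ) : ℂ)
        * Complex.I)
      = Complex.exp (((∑ i, (Fin.cons (-a) c : Fin (k + 1) → ℝ) i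
            * Y ((Fin.cons v t : Fin (k + 1) → ℝ) i) p.1 : ℝ) : ℂ) * Complex.I)
        * Complex.exp ((a : ℂ) * (p.2 : ℂ) * Complex.I) := by
    intro p
    rw [← Complex.exp_add, ← add_mul, ← Complex.ofReal_mul, ← Complex.ofReal_add]
    congr 3
    simp only [Fin.sum_univ_succ, Fin.cons_zero, Fin.cons_succ]
    rw [ha, ← Finset.sum_neg_distrib, Finset.sum_mul, Finset.sum_mul, ← Finset.sum_add_distrib,
      ← Finset.sum_add_distrib]
    exact Finset.sum_congr rfl fun i _ => by ring
  simp_rw [e1]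
  rw [integral_prod_mul (μ := P) (ν := gaussianReal 0 1)
      (fun ω => Complex.exp (((∑ i, (Fin.cons (-a) c : Fin (k + 1) → ℝ) i
            * Y ((Fin.cons v t : Fin (k + 1) → ℝ) i) ω : ℝ) : ℂ) * Complex.I))
      (fun ξ => Complex.exp ((a : ℂ) * (ξ : ℂ) * Complex.I)), h.integral_cexp_sum _ _ (fun i => by
    refine Fin.cases ?_ (fun j => ?_) i
    · simpa using hv
    · simpa using ht j), ← charFun_apply_real, charFun_gaussianReal, ← Complex.exp_add]
  congr 1
  have e2 : ∑ i, ∑ j, (Fin.cons (-a) c : Fin (k + 1) → ℝ) i * (Fin.cons (-a) c : Fin (k + 1) → ℝ) j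
      * r ((Fin.cons v t : Fin (k + 1) → ℝ) i - (Fin.cons v t : Fin (k + 1) → ℝ) j)
      = (∑ i, ∑ j, c i * c j * r (t i - t j)) - a ^ 2 := by
    simp only [Fin.sum_univ_succ, Fin.cons_zero, Fin.cons_succ, sub_self, h.zero]
    have f1 : ∑ x, -a * c x * r (v - t x) = - a * a := by
      rw [ha, Finset.mul_sum]
      refine Finset.sum_congr rfl fun i _ => ?_
      rw [← h.even (v - t i), neg_sub]; ring
    have f2 : ∑ x, (c x * -a * r (t x - v) + ∑ j, c x * c j * r (t x - t j))
        = - a * a + ∑ i, ∑ j, c i * c j * r (t i - t j) := by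
      rw [Finset.sum_add_distrib]
      congr 1
      rw [ha, Finset.mul_sum]
      exact Finset.sum_congr rfl fun i _ => by ring
    rw [f1, f2]; ring
  rw [e2]
  push_cast
  simp
  ring

/-- Gaussian integration by parts for the exponential of a finite sum. -/
lemma integral_mul_cexp_sum (h : IsStationaryGaussian P Y r) {g g' : ℝ → ℝ}
    (hg : IsAdmissible g g') {N : ℕ} (u : Fin N → ℝ) (hu : ∀ i, 0 ≤ u i) {v : ℝ} (hv : 0 ≤ v)
    (a : ℝ) :
    ∫ ω, (g (Y v ω) : ℂ) * Complex.exp (((a * ∑ j, g (Y (u j) ω) : ℝ) : ℂ) * Complex.I) ∂P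
      = ∑ j, (a : ℂ) * Complex.I * ∫ ω, ((r (u j - v) * (steinSolution g (Y v ω) * g' (Y (u j) ω)) : ℝ) : ℂ)
          * Complex.exp (((a * ∑ j, g (Y (u j) ω) : ℝ) : ℂ) * Complex.I) ∂P := by
  obtain ⟨C, hC, hb⟩ := hg.bound
  obtain ⟨D, hD, hk⟩ := hg.steinSolution_bound
  have gm := hg.continuous.measurable
  have km := hg.continuous_steinSolution.measurable
  have g'm := hg.measurable_deriv
  have g4 := memLp_gaussianReal_of_bound gm fun x => (hb x).1
  have g'4 := memLp_gaussianReal_of_bound g'm fun x => (hb x).2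
  have k4 := memLp_gaussianReal_of_bound km hk
  have hne : ∀ x : ℝ, ‖Complex.exp ((x : ℂ) * Complex.I)‖ = 1 := Complex.norm_exp_ofReal_mul_I
  -- the functionals on the finite-dimensional space
  let t : Fin (N + 1) → ℝ := Fin.cons v u
  have ht : ∀ i, 0 ≤ t i := Fin.cases (by simpa [t] using hv) (fun j => by simpa [t] using hu j)
  let E : (Fin (N + 1) → ℝ) → ℂ := fun x =>
    Complex.exp (((a * ∑ j : Fin N, g (x j.succ) : ℝ) : ℂ) * Complex.I)
  let F : (Fin (N + 1) → ℝ) → ℂ := fun x => (g (x 0) : ℂ) * E x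
  let G : Fin N → (Fin (N + 1) → ℝ) → ℂ := fun j x =>
    (a : ℂ) * Complex.I * (((r (u j - v) * (steinSolution g (x 0) * g' (x j.succ)) : ℝ) : ℂ) * E x)
  have hE : ∀ x, ‖E x‖ = 1 := fun x => hne _
  have Em : Measurable E := by
    have : Measurable fun x : Fin (N + 1) → ℝ => a * ∑ j : Fin N, g (x j.succ) :=
      (Finset.measurable_sum _ fun j _ => gm.comp (measurable_pi_apply _)).const_mul _
    fun_prop
  have Fm : Measurable F := by fun_prop
  have Gm : ∀ j, Measurable (G j) := fun j => by fun_prop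
  let ψ : Ω × ℝ → Fin (N + 1) → ℝ := fun p i =>
    r (t i - v) * p.2 + (Y (t i) p.1 - r (t i - v) * Y v p.1)
  have m1 : Measurable (fun ω i => Y (t i) ω) := measurable_pi_lambda _ fun i => h.measurable _
  have m2 : Measurable ψ :=
    measurable_pi_lambda _ fun i => (measurable_snd.const_mul _).add
      (((h.measurable _).comp measurable_fst).sub (((h.measurable _).comp measurable_fst).const_mul _))
  have hlaw := h.map_eq_map_regression t ht hv
  have tr : ∀ {H : (Fin (N + 1) → ℝ) → ℂ}, Measurable H →
      Integrable (fun ω => H (fun i => Y (t i) ω)) P →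
      Integrable (fun p => H (ψ p)) (P.prod (gaussianReal 0 1)) ∧
      ∫ ω, H (fun i => Y (t i) ω) ∂P = ∫ ω, ∫ ξ, H (ψ (ω, ξ)) ∂(gaussianReal 0 1) ∂P := by
    intro H Hm Hi
    have h1 := (integrable_map_measure Hm.aestronglyMeasurable m1.aemeasurable).2 Hi
    rw [hlaw] at h1
    have h2 := (integrable_map_measure Hm.aestronglyMeasurable m2.aemeasurable).1 h1
    refine ⟨h2, ?_⟩
    rw [← integral_prod (fun p => H (ψ p)) h2, ← integral_map m1.aemeasurable Hm.aestronglyMeasurable, hlaw,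
      integral_map m2.aemeasurable Hm.aestronglyMeasurable]
  have iF : Integrable (fun ω => F (fun i => Y (t i) ω)) P := by
    refine (((h.memLp_comp hv g4).integrable (by norm_num)).norm).mono'
      (Fm.comp m1).aestronglyMeasurable (Eventually.of_forall fun ω => ?_)
    simp only [F, norm_mul, hE, mul_one, t, Fin.cons_zero, Complex.norm_real]
    exact le_rfl
  have iG : ∀ j, Integrable (fun ω => G j (fun i => Y (t i) ω)) P := by
    intro j
    refine ((((h.integrable_mul_comp hv (hu j) k4 g'4).norm).const_mul |r (u j - v)|).const_mul |a|).mono'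
      ((Gm j).comp m1).aestronglyMeasurable (Eventually.of_forall fun ω => ?_)
    simp only [G, norm_mul, hE, mul_one, t, Fin.cons_zero, Fin.cons_succ, Complex.norm_real,
      Complex.norm_I, norm_eq_abs]
    exact le_rfl
  have key : ∀ ω, (∀ j, Integrable (fun ξ => G j (ψ (ω, ξ))) (gaussianReal 0 1)) →
      ∫ ξ, F (ψ (ω, ξ)) ∂(gaussianReal 0 1) = ∫ ξ, ∑ j, G j (ψ (ω, ξ)) ∂(gaussianReal 0 1) := by
    intro ω hω
    have e0 : ∀ ξ, ψ (ω, ξ) 0 = ξ := fun ξ => by simp [ψ, t, h.zero]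
    have ej : ∀ ξ (j : Fin N), ψ (ω, ξ) j.succ
      = r (u j - v) * ξ + (Y (u j) ω - r (u j - v) * Y v ω) := fun ξ j => by simp [ψ, t]
    let f : ℝ → ℂ := fun ξ => E (ψ (ω, ξ))
    let f' : ℝ → ℂ := fun ξ => E (ψ (ω, ξ))
      * (((a * ∑ j, g' (ψ (ω, ξ) j.succ) * r (u j - v) : ℝ) : ℂ) * Complex.I)
    have hs : (⋃ j, {ξ | r (u j - v) ≠ 0 ∧ ψ (ω, ξ) j.succ = 0}).Countable := by
      refine countable_iUnion fun j => Set.Subsingleton.countable fun x hx y hy => ?_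
      have hx' := hx.2; have hy' := hy.2
      rw [ej] at hx' hy'
      exact mul_left_cancel₀ hx.1 (by linarith)
    have fc : Continuous f := by
      have hgc := hg.continuous
      have : Continuous fun ξ => a * ∑ j : Fin N, g (ψ (ω, ξ) j.succ) := by
        simp_rw [ej]; fun_prop
      exact Complex.continuous_exp.comp ((Complex.continuous_ofReal.comp this).mul continuous_const)
    have hd : ∀ ξ ∉ (⋃ j, {ξ | r (u j - v) ≠ 0 ∧ ψ (ω, ξ) j.succ = 0}), HasDerivAt f (f' ξ) ξ := by
      intro ξ hξ
      simp only [mem_iUnion, mem_ofPred_eq, not_exists, not_and] at hξ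
      have hj : ∀ j : Fin N, HasDerivAt (fun ξ => g (ψ (ω, ξ) j.succ))
          (g' (ψ (ω, ξ) j.succ) * r (u j - v)) ξ := by
        intro j
        simp_rw [ej]
        by_cases hr : r (u j - v) = 0
        · simp only [hr, zero_mul, mul_zero]
          exact hasDerivAt_const _ _
        · have := hξ j hr
          rw [ej] at this
          refine (hg.hasDerivAt _ this).comp ξ ?_
          simpa using ((hasDerivAt_id ξ).const_mul (r (u j - v))).add_const
            (Y (u j) ω - r (u j - v) * Y v ω)
      exact (((HasDerivAt.fun_sum fun j _ => hj j).const_mul a).ofReal_comp.mul_const Complex.I).cexp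
    have eG : ∀ ξ, ∑ j, G j (ψ (ω, ξ)) = (steinSolution g ξ : ℂ) * f' ξ := by
      intro ξ
      simp only [G, f', e0]
      push_cast
      simp only [Finset.mul_sum, Finset.sum_mul]
      exact Finset.sum_congr rfl fun j _ => by ring
    have hint : Integrable (fun ξ => (steinSolution g ξ : ℂ) * f' ξ) (gaussianReal 0 1) := by
      refine (integrable_finsetSum Finset.univ fun j _ => hω j).congr
        (Eventually.of_forall fun ξ => eG ξ)
    simp_rw [eG]
    rw [← hg.integral_mul_eq_integral_steinSolution_mul fc (M := 1) (fun x => (hne _).le) hs hd hint]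
    simp [F, f, e0]
  have hae : ∀ᵐ ω ∂P, ∀ j, Integrable (fun ξ => G j (ψ (ω, ξ))) (gaussianReal 0 1) :=
    ae_all_iff.2 fun j => (tr (Gm j) (iG j)).1.prod_right_ae
  calc _ = ∫ ω, F (fun i => Y (t i) ω) ∂P := by simp [F, E, t]
    _ = ∫ ω, ∫ ξ, F (ψ (ω, ξ)) ∂(gaussianReal 0 1) ∂P := (tr Fm iF).2
    _ = ∫ ω, ∫ ξ, ∑ j, G j (ψ (ω, ξ)) ∂(gaussianReal 0 1) ∂P :=
      integral_congr_ae (hae.mono fun ω hω => key ω hω)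
    _ = ∫ ω, ∑ j, G j (fun i => Y (t i) ω) ∂P :=
      ((tr (H := fun x => ∑ j, G j x) (Finset.measurable_sum _ fun j _ => Gm j)
        (integrable_finsetSum _ fun j _ => iG j)).2).symm
    _ = ∑ j, ∫ ω, G j (fun i => Y (t i) ω) ∂P := integral_finsetSum _ fun j _ => iG j
    _ = _ := by
      refine Finset.sum_congr rfl fun j _ => ?_
      simp only [G, E, t, Fin.cons_zero, Fin.cons_succ]
      rw [integral_const_mul]

end IsStationaryGaussian

lemma integrable_prod_of_integral_sq_le {Ω α : Type*} [MeasurableSpace Ω] [MeasurableSpace α]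
    {P : Measure Ω} [IsProbabilityMeasure P] {ν : Measure α} [IsFiniteMeasure ν] {F : Ω × α → ℝ}
    (hF : Measurable F) {M : ℝ}
    (h : ∀ᵐ u ∂ν, MemLp (fun ω => F (ω, u)) 2 P ∧ ∫ ω, F (ω, u) ^ 2 ∂P ≤ M) :
    Integrable F (P.prod ν) := by
  refine (integrable_prod_iff' hF.aestronglyMeasurable).2
    ⟨h.mono fun u hu => hu.1.integrable (by norm_num), ?_⟩
  refine (integrable_const (1 + M)).mono'
    (hF.norm.stronglyMeasurable.integral_prod_left (μ := P)).aestronglyMeasurable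
    (h.mono fun u hu => ?_)
  rw [norm_of_nonneg (integral_nonneg fun ω => norm_nonneg _)]
  calc ∫ ω, ‖F (ω, u)‖ ∂P ≤ ∫ ω, 1 + F (ω, u) ^ 2 ∂P := by
        refine integral_mono (hu.1.integrable (by norm_num)).norm
          ((integrable_const 1).add hu.1.integrable_sq) fun ω => ?_
        rw [norm_eq_abs]
        nlinarith [sq_abs (F (ω, u)), sq_nonneg (|F (ω, u)| - 1)]
    _ ≤ 1 + M := by
        rw [integral_add (integrable_const 1) hu.1.integrable_sq]
        simpa using hu.2

/-- A Monte Carlo approximation of an integral against a probability measure. -/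
lemma ae_tendsto_average_infinitePi {ν : Measure ℝ} [IsProbabilityMeasure ν] {f : ℝ → ℝ}
    (hf : Measurable f) (hi : Integrable f ν) :
    ∀ᵐ q ∂(Measure.infinitePi fun _ : ℕ => ν),
      Tendsto (fun n : ℕ => (n : ℝ)⁻¹ * ∑ i : Fin n, f (q i)) atTop (nhds (∫ u, f u ∂ν)) := by
  have hmap : ∀ i : ℕ, (Measure.infinitePi fun _ : ℕ => ν).map (fun q => q i) = ν := fun i =>
    Measure.infinitePi_map_eval _ i
  have hm : ∀ i : ℕ, Measurable fun q : ℕ → ℝ => q i := fun i => measurable_pi_apply i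
  have h0 : Integrable (fun q : ℕ → ℝ => f (q 0)) (Measure.infinitePi fun _ : ℕ => ν) := by
    have : Integrable f ((Measure.infinitePi fun _ : ℕ => ν).map (fun q => q 0)) := by rwa [hmap]
    exact this.comp_measurable (hm 0)
  have := strong_law_ae (μ := Measure.infinitePi fun _ : ℕ => ν)
    (fun (i : ℕ) (q : ℕ → ℝ) => f (q i)) h0
    (fun i j hij => (iIndepFun_infinitePi (P := fun _ : ℕ => ν) (X := fun _ => f)
      (fun _ => hf)).indepFun hij)
    (fun i => (IdentDistrib.mk (hm i).aemeasurable (hm 0).aemeasurable (by rw [hmap, hmap])).comp hf)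
  have e : ∫ q, f (q 0) ∂(Measure.infinitePi fun _ : ℕ => ν) = ∫ u, f u ∂ν := by
    rw [← integral_map (f := f) (hm 0).aemeasurable hf.aestronglyMeasurable, hmap]
  rw [e] at this
  refine this.mono fun q hq => hq.congr fun n => ?_
  rw [smul_eq_mul, Finset.sum_range]

namespace IsStationaryGaussian

variable {Ω : Type*} [MeasurableSpace Ω] {P : Measure Ω} [IsProbabilityMeasure P]
  {Y : ℝ → Ω → ℝ} {r : ℝ → ℝ}

lemma integral_comp_mul_sq_le (h : IsStationaryGaussian P Y r) {g g' : ℝ → ℝ}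
    (hg : IsAdmissible g g') : ∃ M, 0 ≤ M ∧ ∀ u v, 0 ≤ u → 0 ≤ v →
      MemLp (fun ω => steinSolution g (Y v ω) * g' (Y u ω)) 2 P ∧
      ∫ ω, (steinSolution g (Y v ω) * g' (Y u ω)) ^ 2 ∂P ≤ M := by
  obtain ⟨C, hC, hb⟩ := hg.bound
  obtain ⟨D, hD, hk⟩ := hg.steinSolution_bound
  have g'4 := memLp_gaussianReal_of_bound hg.measurable_deriv fun x => (hb x).2
  have k4 := memLp_gaussianReal_of_bound hg.continuous_steinSolution.measurable hk
  exact ⟨_, add_nonneg (integral_nonneg fun x => by positivity)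
    (integral_nonneg fun x => by positivity), fun u v hu hv =>
    ⟨h.memLp_mul hv hu k4 g'4, h.integral_mul_sq_le hv hu k4 g'4⟩⟩

lemma integrable_comp_prod (h : IsStationaryGaussian P Y r) {g g' : ℝ → ℝ}
    (hg : IsAdmissible g g') {ν : Measure ℝ} [IsFiniteMeasure ν] (hν : ∀ᵐ u ∂ν, 0 ≤ u) :
    Integrable (fun p : Ω × ℝ => g (Y p.2 p.1)) (P.prod ν) := by
  obtain ⟨C, hC, hb⟩ := hg.bound
  have g4 := memLp_gaussianReal_of_bound hg.continuous.measurable fun x => (hb x).1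
  have g2 := g4.mono_exponent (show (2 : ENNReal) ≤ 4 by norm_num)
  refine integrable_prod_of_integral_sq_le
    (hg.continuous.measurable.comp (h.measurable_comp measurable_snd measurable_fst))
    (M := ∫ x, g x ^ 2 ∂(gaussianReal 0 1)) (hν.mono fun u hu => ⟨h.memLp_comp hu g2, ?_⟩)
  rw [h.integral_comp (f := fun x => g x ^ 2) hu g2.integrable_sq.1]

set_option maxHeartbeats 800000 in
/-- Gaussian integration by parts for the exponential of an integral functional. -/
lemma integral_mul_cexp_integral (h : IsStationaryGaussian P Y r) {g g' : ℝ → ℝ}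
    (hg : IsAdmissible g g') {ν : Measure ℝ} [IsProbabilityMeasure ν] (hν : ∀ᵐ u ∂ν, 0 ≤ u)
    {v : ℝ} (hv : 0 ≤ v) (c : ℝ) :
    ∫ ω, (g (Y v ω) : ℂ) * Complex.exp (((c * ∫ u, g (Y u ω) ∂ν : ℝ) : ℂ) * Complex.I) ∂P
      = c * Complex.I * ∫ u, ∫ ω, ((r (u - v) * (steinSolution g (Y v ω) * g' (Y u ω)) : ℝ) : ℂ)
          * Complex.exp (((c * ∫ u, g (Y u ω) ∂ν : ℝ) : ℂ) * Complex.I) ∂P ∂ν := by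
  obtain ⟨M, hM, hb⟩ := h.integral_comp_mul_sq_le hg
  have gm := hg.continuous.measurable
  have km := hg.continuous_steinSolution.measurable
  have g'm := hg.measurable_deriv
  have hne : ∀ x : ℝ, ‖Complex.exp ((x : ℂ) * Complex.I)‖ = 1 := Complex.norm_exp_ofReal_mul_I
  obtain ⟨Q, hQ⟩ : ∃ Q, Q = Measure.infinitePi fun _ : ℕ => ν := ⟨_, rfl⟩
  have hQp : IsProbabilityMeasure Q := by rw [hQ]; infer_instance
  have hmap : ∀ i : ℕ, Q.map (fun q => q i) = ν := fun i => by
    rw [hQ]; exact Measure.infinitePi_map_eval _ i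
  have hm : ∀ i : ℕ, Measurable fun q : ℕ → ℝ => q i := fun i => measurable_pi_apply i
  have hq0 : ∀ᵐ q ∂Q, ∀ j, 0 ≤ q j := ae_all_iff.2 fun j => by
    have : ∀ᵐ u ∂(Q.map fun q => q j), 0 ≤ u := by rwa [hmap]
    exact ae_of_ae_map (hm j).aemeasurable this
  let S : Ω → ℝ := fun ω => ∫ u, g (Y u ω) ∂ν
  let A : ℝ → Ω → ℝ := fun u ω => r (u - v) * (steinSolution g (Y v ω) * g' (Y u ω))
  let E : Ω → ℂ := fun ω => Complex.exp (((c * S ω : ℝ) : ℂ) * Complex.I)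
  let SN : ℕ → Ω × (ℕ → ℝ) → ℝ := fun N p => (N : ℝ)⁻¹ * ∑ j : Fin N, g (Y (p.2 j) p.1)
  let EN : ℕ → Ω × (ℕ → ℝ) → ℂ := fun N p => Complex.exp (((c * SN N p : ℝ) : ℂ) * Complex.I)
  have gYm : Measurable (fun p : Ω × ℝ => g (Y p.2 p.1)) :=
    gm.comp (h.measurable_comp measurable_snd measurable_fst)
  have Sm : Measurable S := (gYm.stronglyMeasurable.integral_prod_right (ν := ν)).measurable
  have Am : Measurable (fun p : Ω × ℝ => A p.2 p.1) :=
    (h.measurable_cov.comp (measurable_snd.sub_const v)).mul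
      ((km.comp ((h.measurable v).comp measurable_fst)).mul
        (g'm.comp (h.measurable_comp measurable_snd measurable_fst)))
  have Em : Measurable E := by fun_prop
  have SNm : ∀ N, Measurable (SN N) := fun N =>
    (Finset.measurable_sum _ fun j _ => gm.comp (h.measurable_comp
      ((hm _).comp measurable_snd) measurable_fst)).const_mul _
  have ENm : ∀ N, Measurable (EN N) := fun N => by have := SNm N; fun_prop
  have hEn : ∀ ω, ‖E ω‖ = 1 := fun ω => hne _
  have hENn : ∀ N p, ‖EN N p‖ = 1 := fun N p => hne _
  have hA : ∀ u, 0 ≤ u → MemLp (A u) 2 P ∧ ∫ ω, A u ω ^ 2 ∂P ≤ M := fun u hu => by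
    refine ⟨(hb u v hu hv).1.const_mul _, ?_⟩
    simp only [A, mul_pow (r _)]
    rw [integral_const_mul]
    have h1 : r (u - v) ^ 2 ≤ 1 := (sq_le_one_iff_abs_le_one _).2 (h.abs_le_one _)
    exact (mul_le_of_le_one_left (integral_nonneg fun ω => sq_nonneg _) h1).trans (hb u v hu hv).2
  have Ajm : ∀ j : ℕ, Measurable (fun p : Ω × (ℕ → ℝ) => A (p.2 j) p.1) := fun j =>
    Am.comp (measurable_fst.prodMk ((hm j).comp measurable_snd))
  have iA : Integrable (fun p : Ω × ℝ => A p.2 p.1) (P.prod ν) :=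
    integrable_prod_of_integral_sq_le Am (hν.mono hA)
  have iAj : ∀ j : ℕ, Integrable (fun p : Ω × (ℕ → ℝ) => A (p.2 j) p.1) (P.prod Q) := fun j =>
    integrable_prod_of_integral_sq_le (Ajm j) (hq0.mono fun q hq => hA _ (hq j))
  have ig : Integrable (fun ω => g (Y v ω)) P := by
    obtain ⟨C, hC, hb⟩ := hg.bound
    exact (h.memLp_comp hv (memLp_gaussianReal_of_bound gm fun x => (hb x).1)).integrable
      (by norm_num)
  -- almost sure convergence of the Monte Carlo sums
  have hconv : ∀ᵐ p ∂(P.prod Q), Tendsto (fun N => SN N p) atTop (nhds (S p.1)) := by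
    refine (Measure.ae_prod_iff_ae_ae (measurableSet_tendsto_fun SNm (Sm.comp measurable_fst))).2 ?_
    refine (h.integrable_comp_prod hg hν).prod_right_ae.mono fun ω hω => ?_
    have hω' : Measurable fun u => g (Y u ω) :=
      gm.comp (h.measurable_comp measurable_id measurable_const)
    rw [hQ]
    exact ae_tendsto_average_infinitePi (f := fun u => g (Y u ω)) hω' hω
  have hE : ∀ᵐ p ∂(P.prod Q), Tendsto (fun N => EN N p) atTop (nhds (E p.1)) :=
    hconv.mono fun p hp => by
      have hc : Continuous fun s : ℝ => Complex.exp (((c * s : ℝ) : ℂ) * Complex.I) := by fun_prop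
      exact (hc.tendsto _).comp hp
  set R := ∫ u, ∫ ω, (A u ω : ℂ) * E ω ∂P ∂ν with hR
  have L1 : Tendsto (fun N => ∫ p, (g (Y v p.1) : ℂ) * EN N p ∂(P.prod Q)) atTop
      (nhds (∫ ω, (g (Y v ω) : ℂ) * E ω ∂P)) := by
    have e : ∫ ω, (g (Y v ω) : ℂ) * E ω ∂P = ∫ p, (g (Y v p.1) : ℂ) * E p.1 ∂(P.prod Q) := by
      rw [integral_fun_fst (fun ω => (g (Y v ω) : ℂ) * E ω)]
      simp
    rw [e]
    refine tendsto_integral_of_dominated_convergence (fun p => ‖g (Y v p.1)‖)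
      (fun N => ?_) (ig.norm.comp_fst Q) (fun N => Eventually.of_forall fun p => ?_)
      (hE.mono fun p hp => hp.const_mul _)
    · exact ((Complex.measurable_ofReal.comp (gm.comp ((h.measurable v).comp measurable_fst))).mul
        (ENm N)).aestronglyMeasurable
    · rw [norm_mul, hENn, mul_one, Complex.norm_real]
  have L2 : ∀ N, 0 < N → ∫ p, (g (Y v p.1) : ℂ) * EN N p ∂(P.prod Q)
      = c * Complex.I * ((N : ℂ)⁻¹ * ∑ j : Fin N, ∫ p, (A (p.2 j) p.1 : ℂ) * EN N p ∂(P.prod Q)) := by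
    intro N hN
    have iAE : ∀ j : Fin N, Integrable (fun p : Ω × (ℕ → ℝ) => (A (p.2 j) p.1 : ℂ) * EN N p)
        (P.prod Q) := fun j => by
      refine (iAj j).norm.mono' ((Complex.measurable_ofReal.comp (Ajm j)).mul
        (ENm N)).aestronglyMeasurable (Eventually.of_forall fun p => ?_)
      rw [norm_mul, hENn, mul_one, Complex.norm_real]
    have igE : Integrable (fun p : Ω × (ℕ → ℝ) => (g (Y v p.1) : ℂ) * EN N p) (P.prod Q) := by
      refine (ig.norm.comp_fst Q).mono' ((Complex.measurable_ofReal.comp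
        (gm.comp ((h.measurable v).comp measurable_fst))).mul
        (ENm N)).aestronglyMeasurable (Eventually.of_forall fun p => ?_)
      rw [norm_mul, hENn, mul_one, Complex.norm_real]
    simp_rw [integral_prod_symm _ (iAE _)]
    rw [integral_prod_symm _ igE, ← integral_finsetSum _ fun j _ => (iAE j).integral_prod_right,
      ← integral_const_mul, ← integral_const_mul]
    refine integral_congr_ae (hq0.mono fun q hq => ?_)
    have := h.integral_mul_cexp_sum hg (fun j : Fin N => q j) (fun j => hq j) hv (c * (N : ℝ)⁻¹)
    simp only [EN, SN, ← mul_assoc c]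
    rw [this, Finset.mul_sum, Finset.mul_sum]
    refine Finset.sum_congr rfl fun j _ => ?_
    push_cast
    simp only [A]
    push_cast
    ring
  have L3 : ∀ j : ℕ, ∫ p, (A (p.2 j) p.1 : ℂ) * E p.1 ∂(P.prod Q) = R := by
    intro j
    have iAE : Integrable (fun p : Ω × (ℕ → ℝ) => (A (p.2 j) p.1 : ℂ) * E p.1) (P.prod Q) := by
      refine (iAj j).norm.mono' ((Complex.measurable_ofReal.comp (Ajm j)).mul
        (Em.comp measurable_fst)).aestronglyMeasurable (Eventually.of_forall fun p => ?_)
      rw [norm_mul, hEn, mul_one, Complex.norm_real]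
    rw [integral_prod_symm _ iAE, hR]
    have hsm : StronglyMeasurable fun u => ∫ ω, (A u ω : ℂ) * E ω ∂P :=
      StronglyMeasurable.integral_prod_left (μ := P) (f := fun ω u => (A u ω : ℂ) * E ω)
        ((Complex.measurable_ofReal.comp Am).mul (Em.comp measurable_fst)).stronglyMeasurable
    conv_rhs => rw [← hmap j]
    rw [integral_map (hm j).aemeasurable hsm.aestronglyMeasurable]
  have L4 : Tendsto (fun N => ∫ p, ‖EN N p - E p.1‖ ^ 2 ∂(P.prod Q)) atTop (nhds 0) := by
    have : Tendsto (fun N => ∫ p, ‖EN N p - E p.1‖ ^ 2 ∂(P.prod Q)) atTop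
        (nhds (∫ p, (0 : ℝ) ∂(P.prod Q))) := by
      refine tendsto_integral_of_dominated_convergence (fun _ => 4)
        (fun N => ?_) (integrable_const _) (fun N => Eventually.of_forall fun p => ?_)
        (hE.mono fun p hp => ?_)
      · exact (((ENm N).sub (Em.comp measurable_fst)).norm.pow_const 2).aestronglyMeasurable
      · have := norm_sub_le (EN N p) (E p.1)
        rw [hENn, hEn] at this
        rw [norm_of_nonneg (by positivity)]
        nlinarith [norm_nonneg (EN N p - E p.1)]
      · have := ((hp.sub_const (E p.1)).norm).pow 2
        simpa using this
    simpa using this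
  have L5 : ∀ ε > 0, ∀ N, ∀ j : ℕ, ‖∫ p, (A (p.2 j) p.1 : ℂ) * EN N p ∂(P.prod Q) - R‖
      ≤ ε * M + ε⁻¹ * ∫ p, ‖EN N p - E p.1‖ ^ 2 ∂(P.prod Q) := by
    intro ε hε N j
    have iAE : Integrable (fun p : Ω × (ℕ → ℝ) => (A (p.2 j) p.1 : ℂ) * E p.1) (P.prod Q) := by
      refine (iAj j).norm.mono' ((Complex.measurable_ofReal.comp (Ajm j)).mul
        (Em.comp measurable_fst)).aestronglyMeasurable (Eventually.of_forall fun p => ?_)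
      rw [norm_mul, hEn, mul_one, Complex.norm_real]
    have iAEN : Integrable (fun p : Ω × (ℕ → ℝ) => (A (p.2 j) p.1 : ℂ) * EN N p) (P.prod Q) := by
      refine (iAj j).norm.mono' ((Complex.measurable_ofReal.comp (Ajm j)).mul
        (ENm N)).aestronglyMeasurable (Eventually.of_forall fun p => ?_)
      rw [norm_mul, hENn, mul_one, Complex.norm_real]
    have iD : Integrable (fun p => ‖EN N p - E p.1‖ ^ 2) (P.prod Q) := by
      refine (integrable_const (4 : ℝ)).mono'
        (((ENm N).sub (Em.comp measurable_fst)).norm.pow_const 2).aestronglyMeasurable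
        (Eventually.of_forall fun p => ?_)
      have := norm_sub_le (EN N p) (E p.1)
      rw [hENn, hEn] at this
      rw [norm_of_nonneg (by positivity)]
      nlinarith [norm_nonneg (EN N p - E p.1)]
    have iA2 : Integrable (fun p : Ω × (ℕ → ℝ) => A (p.2 j) p.1 ^ 2) (P.prod Q) := by
      refine (integrable_prod_iff' ((Ajm j).pow_const 2).aestronglyMeasurable).2
        ⟨hq0.mono fun q hq => (hA _ (hq j)).1.integrable_sq, ?_⟩
      refine (integrable_const M).mono' (((Ajm j).pow_const
        2).norm.stronglyMeasurable.integral_prod_left (μ := P)).aestronglyMeasurable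
        (hq0.mono fun q hq => ?_)
      rw [norm_of_nonneg (integral_nonneg fun ω => norm_nonneg _)]
      simpa using (hA _ (hq j)).2
    have hA2 : ∫ p : Ω × (ℕ → ℝ), A (p.2 j) p.1 ^ 2 ∂(P.prod Q) ≤ M := by
      rw [integral_prod_symm _ iA2]
      calc _ ≤ ∫ q, M ∂Q := integral_mono_ae iA2.integral_prod_right (integrable_const _)
            (hq0.mono fun q hq => (hA _ (hq j)).2)
        _ = M := by simp
    rw [← L3 j, ← integral_sub iAEN iAE]
    calc _ ≤ ∫ p : Ω × (ℕ → ℝ), ε * A (p.2 j) p.1 ^ 2 + ε⁻¹ * ‖EN N p - E p.1‖ ^ 2 ∂(P.prod Q) := by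
          refine norm_integral_le_of_norm_le ((iA2.const_mul ε).add (iD.const_mul ε⁻¹))
            (Eventually.of_forall fun p => ?_)
          rw [← mul_sub, norm_mul, Complex.norm_real, norm_eq_abs]
          have h1 := two_mul_le_add_sq (√ε * |A (p.2 j) p.1|) ((√ε)⁻¹ * ‖EN N p - E p.1‖)
          have h2 : √ε * (√ε)⁻¹ = 1 := mul_inv_cancel₀ (by positivity)
          rw [mul_pow, mul_pow, inv_pow, sq_sqrt hε.le, sq_abs] at h1
          have h3 : 2 * (√ε * |A (p.2 j) p.1|) * ((√ε)⁻¹ * ‖EN N p - E p.1‖)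
            = 2 * (|A (p.2 j) p.1| * ‖EN N p - E p.1‖) * (√ε * (√ε)⁻¹) := by ring
          rw [h3, h2] at h1
          nlinarith [mul_nonneg (abs_nonneg (A (p.2 j) p.1)) (norm_nonneg (EN N p - E p.1))]
      _ ≤ _ := by
          rw [integral_add (iA2.const_mul ε) (iD.const_mul ε⁻¹), integral_const_mul,
            integral_const_mul]
          gcongr
  have L6 : ∀ ε > 0, ‖(∫ ω, (g (Y v ω) : ℂ) * E ω ∂P) - c * Complex.I * R‖ ≤ |c| * (ε * M) := by
    intro ε hε
    have t1 := ((L1.sub_const (c * Complex.I * R)).norm)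
    have t2 : Tendsto (fun N => |c| * (ε * M + ε⁻¹ * ∫ p, ‖EN N p - E p.1‖ ^ 2 ∂(P.prod Q))) atTop
        (nhds (|c| * (ε * M + ε⁻¹ * 0))) := ((L4.const_mul _).const_add _).const_mul _
    rw [mul_zero, add_zero] at t2
    refine le_of_tendsto_of_tendsto t1 t2 ((eventually_gt_atTop 0).mono fun N hN => ?_)
    have hN' : (N : ℂ) ≠ 0 := by exact_mod_cast hN.ne'
    have e : R = (N : ℂ)⁻¹ * ∑ j : Fin N, R := by
      simp [hN']
    simp only
    rw [L2 N hN, ← mul_sub, norm_mul, norm_mul, Complex.norm_I, mul_one, Complex.norm_real,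
      norm_eq_abs]
    refine mul_le_mul_of_nonneg_left ?_ (abs_nonneg c)
    conv_lhs => rw [e]
    rw [← mul_sub, ← Finset.sum_sub_distrib, norm_mul]
    refine (mul_le_mul_of_nonneg_left (norm_sum_le_of_le (Finset.univ : Finset (Fin N)) fun j _ => L5 ε hε N j)
      (norm_nonneg _)).trans_eq ?_
    have hN2 : (N : ℝ) ≠ 0 := by exact_mod_cast hN.ne'
    simp only [Finset.sum_const, Finset.card_univ, Fintype.card_fin, nsmul_eq_mul, norm_inv,
      Complex.norm_natCast]
    rw [inv_mul_cancel_left₀ hN2]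
  have t : Tendsto (fun ε : ℝ => |c| * (ε * M)) (nhdsWithin 0 (Ioi 0)) (nhds (|c| * (0 * M))) :=
    (((continuous_id.mul continuous_const).const_mul |c|).tendsto 0).mono_left nhdsWithin_le_nhds
  rw [zero_mul, mul_zero] at t
  have := ge_of_tendsto t (eventually_nhdsWithin_of_forall fun ε hε => L6 ε hε)
  exact sub_eq_zero.1 (norm_le_zero_iff.1 this)

end IsStationaryGaussian

/-- Lévy's continuity theorem in coordinates. -/
lemma tendsto_integral_of_tendsto_integral_cexp_sum {k : ℕ} {μ : ℕ → Measure (Fin k → ℝ)}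
    [∀ n, IsProbabilityMeasure (μ n)] {μ₀ : Measure (Fin k → ℝ)} [IsProbabilityMeasure μ₀]
    (h : ∀ c : Fin k → ℝ, Tendsto
      (fun n => ∫ x, Complex.exp (((∑ i, c i * x i : ℝ) : ℂ) * Complex.I) ∂(μ n)) atTop
      (nhds (∫ x, Complex.exp (((∑ i, c i * x i : ℝ) : ℂ) * Complex.I) ∂μ₀)))
    {f : (Fin k → ℝ) → ℝ} (hf : Continuous f) {M : ℝ} (hM : ∀ x, |f x| ≤ M) :
    Tendsto (fun n => ∫ x, f x ∂(μ n)) atTop (nhds (∫ x, f x ∂μ₀)) := by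
  let e : (Fin k → ℝ) → EuclideanSpace ℝ (Fin k) := WithLp.toLp 2
  have em : Measurable e := by fun_prop
  let ν : ℕ → ProbabilityMeasure (EuclideanSpace ℝ (Fin k)) := fun n =>
    ⟨(μ n).map e, Measure.isProbabilityMeasure_map em.aemeasurable⟩
  let ν₀ : ProbabilityMeasure (EuclideanSpace ℝ (Fin k)) :=
    ⟨μ₀.map e, Measure.isProbabilityMeasure_map em.aemeasurable⟩
  have hc : ∀ (ρ : Measure (Fin k → ℝ)) (c : EuclideanSpace ℝ (Fin k)), charFun (ρ.map e) c
      = ∫ x, Complex.exp (((∑ i, c i * x i : ℝ) : ℂ) * Complex.I) ∂ρ := by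
    intro ρ c
    rw [charFun_apply, integral_map em.aemeasurable (by fun_prop)]
    simp [e, PiLp.inner_apply]
  have ht : Tendsto ν atTop (nhds ν₀) := by
    refine ProbabilityMeasure.tendsto_of_tendsto_charFun fun c => ?_
    simp only [ν, ν₀, ProbabilityMeasure.coe_mk]
    simpa only [hc] using h fun i => c i
  have hf' : Continuous fun x : EuclideanSpace ℝ (Fin k) => f (fun i => x i) := by fun_prop
  let F : BoundedContinuousFunction (EuclideanSpace ℝ (Fin k)) ℝ :=
    BoundedContinuousFunction.ofNormedAddCommGroup (fun x => f (fun i => x i)) hf' M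
      (fun x => hM _)
  have := ProbabilityMeasure.tendsto_iff_forall_integral_tendsto.1 ht F
  have hi : ∀ ρ : Measure (Fin k → ℝ), ∫ x, F x ∂(ρ.map e) = ∫ x, f x ∂ρ := fun ρ => by
    rw [integral_map em.aemeasurable F.continuous.aestronglyMeasurable]
    rfl
  simpa only [ν, ν₀, ProbabilityMeasure.coe_mk, hi] using this

lemma abs_integral_mul_le_sqrt {α : Type*} [MeasurableSpace α] {μ : Measure α} {f g : α → ℝ}
    (hf : MemLp f 2 μ) (hg : MemLp g 2 μ) :
    |∫ x, f x * g x ∂μ| ≤ √(∫ x, f x ^ 2 ∂μ) * √(∫ x, g x ^ 2 ∂μ) := by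
  have := integral_mul_norm_le_Lp_mul_Lq (μ := μ) (f := f) (g := g) (p := 2) (q := 2)
    (by rw [Real.holderConjugate_iff]; norm_num) (by simpa using hf) (by simpa using hg)
  simp only [norm_eq_abs, rpow_two, sq_abs, ← sqrt_eq_rpow] at this
  refine (abs_integral_le_integral_abs).trans ?_
  simpa only [abs_mul] using this

namespace IsStationaryGaussian

variable {Ω : Type*} [MeasurableSpace Ω] {P : Measure Ω} [IsProbabilityMeasure P]
  {Y : ℝ → Ω → ℝ} {r : ℝ → ℝ}

lemma map_pair_eq (h : IsStationaryGaussian P Y r) {s t s' t' : ℝ} (hs : 0 ≤ s) (ht : 0 ≤ t)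
    (hs' : 0 ≤ s') (ht' : 0 ≤ t') (hst : t - s = t' - s') :
    P.map (fun ω => (Y s ω, Y t ω)) = P.map (fun ω => (Y s' ω, Y t' ω)) := by
  have hm : ∀ a b : ℝ, Measurable fun ω => (fun i => Y (![a, b] i) ω : Fin 2 → ℝ) := fun a b =>
    measurable_pi_lambda _ fun i => h.measurable _
  have key : P.map (fun ω => (fun i => Y (![s, t] i) ω : Fin 2 → ℝ))
      = P.map (fun ω => (fun i => Y (![s', t'] i) ω : Fin 2 → ℝ)) := by
    have := Measure.isProbabilityMeasure_map (μ := P) (hm s t).aemeasurable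
    have := Measure.isProbabilityMeasure_map (μ := P) (hm s' t').aemeasurable
    refine ext_of_integral_cexp_sum fun c => ?_
    rw [integral_map (hm _ _).aemeasurable (measurable_cexp_sum c).aestronglyMeasurable,
      integral_map (hm _ _).aemeasurable (measurable_cexp_sum c).aestronglyMeasurable,
      h.integral_cexp_sum _ c (by intro i; fin_cases i <;> simpa),
      h.integral_cexp_sum _ c (by intro i; fin_cases i <;> simpa)]
    simp [Fin.sum_univ_two, hst, show s - t = s' - t' by linarith]
  have m2 : Measurable fun x : Fin 2 → ℝ => (x 0, x 1) := by fun_prop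
  have := congrArg (fun ρ => Measure.map (fun x : Fin 2 → ℝ => (x 0, x 1)) ρ) key
  rw [Measure.map_map m2 (hm _ _), Measure.map_map m2 (hm _ _)] at this
  exact this

lemma measurable_pair (h : IsStationaryGaussian P Y r) (s t : ℝ) :
    Measurable fun ω => (Y s ω, Y t ω) := (h.measurable s).prodMk (h.measurable t)

lemma tendsto_integral_pair_bounded (h : IsStationaryGaussian P Y r) {a b : ℝ} (ha : 0 ≤ a)
    (hb : 0 ≤ b) {s t s' t' : ℕ → ℝ} (hs : ∀ n, 0 ≤ s n) (ht : ∀ n, 0 ≤ t n) (hs' : ∀ n, 0 ≤ s' n)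
    (ht' : ∀ n, 0 ≤ t' n) (hst : ∀ n, t n - s n = b - a) (hst' : ∀ n, t' n - s' n = b - a)
    (h1 : Tendsto (fun n => r (s n - s' n)) atTop (nhds 0))
    (h2 : Tendsto (fun n => r (s n - t' n)) atTop (nhds 0))
    (h3 : Tendsto (fun n => r (t n - s' n)) atTop (nhds 0))
    {f : ℝ × ℝ → ℝ} (hf : Continuous f) {M : ℝ} (hM : ∀ x, |f x| ≤ M) :
    Tendsto (fun n => ∫ ω, f (Y (s n) ω, Y (t n) ω) * f (Y (s' n) ω, Y (t' n) ω) ∂P) atTop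
      (nhds ((∫ ω, f (Y a ω, Y b ω) ∂P) ^ 2)) := by
  let V : ℕ → Ω → Fin 4 → ℝ := fun n ω i => Y (![s n, t n, s' n, t' n] i) ω
  let W : Ω × Ω → Fin 4 → ℝ := fun p => ![Y a p.1, Y b p.1, Y a p.2, Y b p.2]
  have Vm : ∀ n, Measurable (V n) := fun n => measurable_pi_lambda _ fun i => h.measurable _
  have Wm : Measurable W := by
    have := h.measurable
    refine measurable_pi_lambda _ fun i => ?_
    fin_cases i
    exacts [(this a).comp measurable_fst, (this b).comp measurable_fst,
      (this a).comp measurable_snd, (this b).comp measurable_snd]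
  have i1 : ∀ n, IsProbabilityMeasure (P.map (V n)) := fun n =>
    Measure.isProbabilityMeasure_map (Vm n).aemeasurable
  have i2 : IsProbabilityMeasure ((P.prod P).map W) :=
    Measure.isProbabilityMeasure_map Wm.aemeasurable
  let F : (Fin 4 → ℝ) → ℝ := fun x => f (x 0, x 1) * f (x 2, x 3)
  have hM0 : 0 ≤ M := (abs_nonneg _).trans (hM (0, 0))
  have Fc : Continuous F := by fun_prop
  have := tendsto_integral_of_tendsto_integral_cexp_sum (μ := fun n => P.map (V n))
    (μ₀ := (P.prod P).map W) (f := F) (M := M * M) ?_ Fc (fun x => by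
      rw [abs_mul]; exact mul_le_mul (hM _) (hM _) (abs_nonneg _) hM0)
  · simp_rw [integral_map (Vm _).aemeasurable Fc.aestronglyMeasurable] at this
    rw [integral_map Wm.aemeasurable Fc.aestronglyMeasurable] at this
    have e := integral_prod_mul (μ := P) (ν := P) (fun ω => f (Y a ω, Y b ω))
      (fun ω => f (Y a ω, Y b ω))
    rw [← sq] at e
    rw [← e]
    exact this
  · intro c
    have cm := (measurable_cexp_sum c).aestronglyMeasurable (μ := (P.prod P).map W)
    have e0 : ∀ n, ∫ x, Complex.exp (((∑ i, c i * x i : ℝ) : ℂ) * Complex.I) ∂(P.map (V n))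
        = ∫ ω, Complex.exp (((∑ i, c i * Y (![s n, t n, s' n, t' n] i) ω : ℝ) : ℂ) * Complex.I) ∂P :=
      fun n => integral_map (Vm n).aemeasurable (measurable_cexp_sum c).aestronglyMeasurable
    simp only [e0]
    rw [integral_map Wm.aemeasurable cm]
    have e : ∀ p : Ω × Ω, Complex.exp (((∑ i, c i * W p i : ℝ) : ℂ) * Complex.I)
        = Complex.exp (((∑ i, ![c 0, c 1] i * Y (![a, b] i) p.1 : ℝ) : ℂ) * Complex.I)
          * Complex.exp (((∑ i, ![c 2, c 3] i * Y (![a, b] i) p.2 : ℝ) : ℂ) * Complex.I) := by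
      intro p
      rw [← Complex.exp_add, ← add_mul, ← Complex.ofReal_add]
      congr 3
      simp [Fin.sum_univ_four, Fin.sum_univ_two, W]
      ring
    simp_rw [e]
    rw [integral_prod_mul (μ := P) (ν := P)
      (fun ω => Complex.exp (((∑ i, ![c 0, c 1] i * Y (![a, b] i) ω : ℝ) : ℂ) * Complex.I))
      (fun ω => Complex.exp (((∑ i, ![c 2, c 3] i * Y (![a, b] i) ω : ℝ) : ℂ) * Complex.I)),
      h.integral_cexp_sum _ _ (by intro i; fin_cases i <;> simpa),
      h.integral_cexp_sum _ _ (by intro i; fin_cases i <;> simpa), ← Complex.exp_add]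
    simp_rw [fun n => h.integral_cexp_sum ![s n, t n, s' n, t' n] c (by
      intro i; fin_cases i
      exacts [hs n, ht n, hs' n, ht' n])]
    have hrab : r (b - a) = r (a - b) := by rw [← h.even, neg_sub]
    have hlim : Tendsto (fun n => (c 0 ^ 2 + c 1 ^ 2 + 2 * c 0 * c 1 * r (a - b) + c 2 ^ 2 + c 3 ^ 2
        + 2 * c 2 * c 3 * r (a - b)) + 2 * (c 0 * c 2 + c 1 * c 3) * r (s n - s' n)
        + 2 * (c 0 * c 3) * r (s n - t' n) + 2 * (c 1 * c 2) * r (t n - s' n)) atTop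
        (nhds ((c 0 ^ 2 + c 1 ^ 2 + 2 * c 0 * c 1 * r (a - b) + c 2 ^ 2 + c 3 ^ 2
        + 2 * c 2 * c 3 * r (a - b)) + 2 * (c 0 * c 2 + c 1 * c 3) * 0
        + 2 * (c 0 * c 3) * 0 + 2 * (c 1 * c 2) * 0)) :=
      (((h1.const_mul _).const_add _).add (h2.const_mul _)).add (h3.const_mul _)
    have hc : Continuous fun q : ℝ => Complex.exp (-(q : ℂ) / 2) := by fun_prop
    have := (hc.tendsto _).comp hlim
    refine Tendsto.congr (fun n => ?_) (this.trans_eq ?_)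
    · have q1 : r (s n - t n) = r (a - b) := by congr 1; linarith [hst n]
      have q2 : r (t n - s n) = r (a - b) := by rw [hst n, hrab]
      have q3 : r (s' n - t' n) = r (a - b) := by congr 1; linarith [hst' n]
      have q4 : r (t' n - s' n) = r (a - b) := by rw [hst' n, hrab]
      have q5 : r (s' n - s n) = r (s n - s' n) := by rw [← h.even, neg_sub]
      have q6 : r (t' n - s n) = r (s n - t' n) := by rw [← h.even, neg_sub]
      have q7 : r (s' n - t n) = r (t n - s' n) := by rw [← h.even, neg_sub]
      have q8 : r (t n - t' n) = r (s n - s' n) := by congr 1; linarith [hst' n, hst n]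
      have q9 : r (t' n - t n) = r (s n - s' n) := by
        rw [← h.even]; congr 1; linarith [hst' n, hst n]
      simp only [Function.comp]
      congr 3
      simp [Fin.sum_univ_four, h.zero, q1, q2, q3, q4, q5, q6, q7, q8, q9]
      ring
    · congr 1
      rw [← add_div, ← neg_add, ← Complex.ofReal_add]
      congr 4
      simp [Fin.sum_univ_two, h.zero, hrab]
      ring

lemma tendsto_integral_pair (h : IsStationaryGaussian P Y r) {a b : ℝ} (ha : 0 ≤ a)
    (hb : 0 ≤ b) {s t s' t' : ℕ → ℝ} (hs : ∀ n, 0 ≤ s n) (ht : ∀ n, 0 ≤ t n) (hs' : ∀ n, 0 ≤ s' n)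
    (ht' : ∀ n, 0 ≤ t' n) (hst : ∀ n, t n - s n = b - a) (hst' : ∀ n, t' n - s' n = b - a)
    (h1 : Tendsto (fun n => r (s n - s' n)) atTop (nhds 0))
    (h2 : Tendsto (fun n => r (s n - t' n)) atTop (nhds 0))
    (h3 : Tendsto (fun n => r (t n - s' n)) atTop (nhds 0))
    {f : ℝ × ℝ → ℝ} (hf : MemLp f 2 (P.map fun ω => (Y a ω, Y b ω))) (hfm : Measurable f) :
    Tendsto (fun n => ∫ ω, f (Y (s n) ω, Y (t n) ω) * f (Y (s' n) ω, Y (t' n) ω) ∂P) atTop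
      (nhds ((∫ ω, f (Y a ω, Y b ω) ∂P) ^ 2)) := by
  set lam := P.map fun ω => (Y a ω, Y b ω) with hlam
  have hpair := h.measurable_pair
  have hlamP : IsProbabilityMeasure lam := Measure.isProbabilityMeasure_map (hpair a b).aemeasurable
  set K := √(∫ x, f x ^ 2 ∂lam) with hK
  have hK0 : 0 ≤ K := sqrt_nonneg _
  -- transfer to the common law of the pairs
  have tr : ∀ {p q : ℝ}, 0 ≤ p → 0 ≤ q → q - p = b - a → ∀ {F : ℝ × ℝ → ℝ}, Measurable F →
      MemLp F 2 lam → MemLp (fun ω => F (Y p ω, Y q ω)) 2 P ∧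
        ∫ ω, F (Y p ω, Y q ω) ^ 2 ∂P = ∫ x, F x ^ 2 ∂lam := by
    intro p q hp hq hpq F Fm hF
    have e : P.map (fun ω => (Y p ω, Y q ω)) = lam := h.map_pair_eq hp hq ha hb hpq
    refine ⟨?_, ?_⟩
    · rw [← e] at hF
      exact hF.comp_of_map (hpair p q).aemeasurable
    · rw [← e, integral_map (hpair p q).aemeasurable (Fm.pow_const 2).aestronglyMeasurable]
  rw [Metric.tendsto_atTop]
  intro ε hε
  obtain ⟨η, hη0, hη1, hηε⟩ : ∃ η : ℝ, 0 < η ∧ η ≤ 1 ∧ η * (2 * (2 * K + 1)) ≤ ε / 2 := by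
    refine ⟨min 1 (ε / 2 / (2 * (2 * K + 1))), by positivity, min_le_left _ _, ?_⟩
    rw [← le_div_iff₀ (by positivity)]
    exact min_le_right _ _
  obtain ⟨ψ, hψ, hψL⟩ := hf.exists_boundedContinuous_eLpNorm_sub_le (by simp)
    (ε := ENNReal.ofReal η) (by simpa using hη0)
  set d : ℝ × ℝ → ℝ := fun x => f x - ψ x with hd
  have dm : Measurable d := hfm.sub ψ.continuous.measurable
  have dL : MemLp d 2 lam := hf.sub hψL
  have dη : √(∫ x, d x ^ 2 ∂lam) ≤ η := by
    have := dL.eLpNorm_eq_integral_rpow_norm (by norm_num) (by norm_num)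
    have h2 : eLpNorm d 2 lam ≤ ENNReal.ofReal η := hψ
    rw [this] at h2
    have h3 := (ENNReal.ofReal_le_ofReal_iff hη0.le).1 h2
    rw [sqrt_eq_rpow]
    simpa using h3
  have dη0 : 0 ≤ √(∫ x, d x ^ 2 ∂lam) := sqrt_nonneg _
  have hmean : |∫ ω, d (Y a ω, Y b ω) ∂P| ≤ η := by
    have t1 := tr ha hb rfl dm dL
    have := abs_integral_mul_le_sqrt t1.1 (memLp_const (1 : ℝ))
    rw [t1.2] at this
    simp only [mul_one, one_pow, integral_const, probReal_univ, smul_eq_mul, sqrt_one] at this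
    exact this.trans dη
  have hmeanf : |∫ ω, f (Y a ω, Y b ω) ∂P| ≤ K := by
    have t1 := tr ha hb rfl hfm hf
    have := abs_integral_mul_le_sqrt t1.1 (memLp_const (1 : ℝ))
    rw [t1.2] at this
    simpa only [mul_one, one_pow, integral_const, probReal_univ, smul_eq_mul, sqrt_one] using this
  have hsq : |(∫ ω, f (Y a ω, Y b ω) ∂P) ^ 2 - (∫ ω, ψ (Y a ω, Y b ω) ∂P) ^ 2|
      ≤ η * (2 * K + 1) := by
    have i1 := (tr ha hb rfl hfm hf).1.integrable (by norm_num)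
    have i2 := (tr ha hb rfl ψ.continuous.measurable hψL).1.integrable (by norm_num)
    have e : ∫ ω, ψ (Y a ω, Y b ω) ∂P
        = (∫ ω, f (Y a ω, Y b ω) ∂P) - ∫ ω, d (Y a ω, Y b ω) ∂P := by
      simp only [hd]
      rw [integral_sub i1 i2]; ring
    rw [e, show ∀ x y : ℝ, x ^ 2 - (x - y) ^ 2 = y * (2 * x - y) by intros; ring, abs_mul]
    refine mul_le_mul hmean ?_ (abs_nonneg _) hη0.le
    refine (abs_sub _ _).trans ?_
    rw [abs_mul, abs_two]
    linarith
  have hcross : ∀ n, |(∫ ω, f (Y (s n) ω, Y (t n) ω) * f (Y (s' n) ω, Y (t' n) ω) ∂P)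
      - ∫ ω, ψ (Y (s n) ω, Y (t n) ω) * ψ (Y (s' n) ω, Y (t' n) ω) ∂P| ≤ η * (2 * K + 1) := by
    intro n
    have f1 := tr (hs n) (ht n) (hst n) hfm hf
    have f2 := tr (hs' n) (ht' n) (hst' n) hfm hf
    have d1 := tr (hs n) (ht n) (hst n) dm dL
    have d2 := tr (hs' n) (ht' n) (hst' n) dm dL
    have c1 := abs_integral_mul_le_sqrt d1.1 f2.1
    have c2 := abs_integral_mul_le_sqrt f1.1 d2.1
    have c3 := abs_integral_mul_le_sqrt d1.1 d2.1
    rw [d1.2, f2.2] at c1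
    rw [f1.2, d2.2] at c2
    rw [d1.2, d2.2] at c3
    have j1 : Integrable (fun ω => d (Y (s n) ω, Y (t n) ω) * f (Y (s' n) ω, Y (t' n) ω)) P :=
      d1.1.integrable_mul f2.1
    have j2 : Integrable (fun ω => f (Y (s n) ω, Y (t n) ω) * d (Y (s' n) ω, Y (t' n) ω)) P :=
      f1.1.integrable_mul d2.1
    have j3 : Integrable (fun ω => d (Y (s n) ω, Y (t n) ω) * d (Y (s' n) ω, Y (t' n) ω)) P :=
      d1.1.integrable_mul d2.1
    have jf : Integrable (fun ω => f (Y (s n) ω, Y (t n) ω) * f (Y (s' n) ω, Y (t' n) ω)) P :=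
      f1.1.integrable_mul f2.1
    have j4 : Integrable (fun ω => f (Y (s n) ω, Y (t n) ω) * f (Y (s' n) ω, Y (t' n) ω)
        - d (Y (s n) ω, Y (t n) ω) * f (Y (s' n) ω, Y (t' n) ω)) P := jf.sub j1
    have j5 : Integrable (fun ω => f (Y (s n) ω, Y (t n) ω) * f (Y (s' n) ω, Y (t' n) ω)
        - d (Y (s n) ω, Y (t n) ω) * f (Y (s' n) ω, Y (t' n) ω)
        - f (Y (s n) ω, Y (t n) ω) * d (Y (s' n) ω, Y (t' n) ω)) P := j4.sub j2
    have e : ∫ ω, ψ (Y (s n) ω, Y (t n) ω) * ψ (Y (s' n) ω, Y (t' n) ω) ∂P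
        = (∫ ω, f (Y (s n) ω, Y (t n) ω) * f (Y (s' n) ω, Y (t' n) ω) ∂P)
        - (∫ ω, d (Y (s n) ω, Y (t n) ω) * f (Y (s' n) ω, Y (t' n) ω) ∂P)
        - (∫ ω, f (Y (s n) ω, Y (t n) ω) * d (Y (s' n) ω, Y (t' n) ω) ∂P)
        + ∫ ω, d (Y (s n) ω, Y (t n) ω) * d (Y (s' n) ω, Y (t' n) ω) ∂P := by
      rw [← integral_sub jf j1, ← integral_sub j4 j2, ← integral_add j5 j3]
      refine integral_congr_ae (Eventually.of_forall fun ω => ?_)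
      simp [hd]
      ring
    have b1 : √(∫ x, d x ^ 2 ∂lam) * K ≤ η * K := by gcongr
    have b2 : K * √(∫ x, d x ^ 2 ∂lam) ≤ K * η := by gcongr
    have b3 : √(∫ x, d x ^ 2 ∂lam) * √(∫ x, d x ^ 2 ∂lam) ≤ η * 1 := by
      gcongr; exact dη.trans hη1
    rw [e, abs_le]
    rw [abs_le] at c1 c2 c3
    constructor <;> linarith [c1.1, c1.2, c2.1, c2.2, c3.1, c3.2]
  have hlim := h.tendsto_integral_pair_bounded ha hb hs ht hs' ht' hst hst' h1 h2 h3
    ψ.continuous (M := ‖ψ‖) (fun x => ψ.norm_coe_le_norm x)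
  obtain ⟨N, hN⟩ := Metric.tendsto_atTop.1 hlim (ε / 2) (by positivity)
  refine ⟨N, fun n hn => ?_⟩
  have h4 := hN n hn
  have h5 := hcross n
  rw [Real.dist_eq] at h4 ⊢
  rw [abs_lt] at h4 ⊢
  rw [abs_le] at hsq h5
  constructor <;> linarith [h4.1, h4.2, h5.1, h5.2, hsq.1, hsq.2]

/-- Functionals of pairs of values of the process decorrelate when the cross-covariances
are small. -/
lemma exists_abs_integral_pair_sub_le (h : IsStationaryGaussian P Y r) {a b : ℝ} (ha : 0 ≤ a)
    (hb : 0 ≤ b) {f : ℝ × ℝ → ℝ} (hf : MemLp f 2 (P.map fun ω => (Y a ω, Y b ω)))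
    (hfm : Measurable f) {ε : ℝ} (hε : 0 < ε) :
    ∃ δ > 0, ∀ s t s' t' : ℝ, 0 ≤ s → 0 ≤ t → 0 ≤ s' → 0 ≤ t' → t - s = b - a → t' - s' = b - a →
      |r (s - s')| < δ → |r (s - t')| < δ → |r (t - s')| < δ →
      |(∫ ω, f (Y s ω, Y t ω) * f (Y s' ω, Y t' ω) ∂P) - (∫ ω, f (Y a ω, Y b ω) ∂P) ^ 2| ≤ ε := by
  by_contra! H
  choose s t s' t' hs ht hs' ht' hst hst' h1 h2 h3 hbad using
    fun n : ℕ => H (1 / ((n : ℝ) + 1)) Nat.one_div_pos_of_nat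
  have hz : ∀ {q : ℕ → ℝ}, (∀ n, |q n| < 1 / ((n : ℝ) + 1)) → Tendsto q atTop (nhds 0) :=
    fun hq => squeeze_zero_norm (fun n => (hq n).le) tendsto_one_div_add_atTop_nhds_zero_nat
  have := h.tendsto_integral_pair ha hb hs ht hs' ht' hst hst' (hz h1) (hz h2) (hz h3) hf hfm
  obtain ⟨N, hN⟩ := Metric.tendsto_atTop.1 this ε hε
  have := hN N le_rfl
  rw [Real.dist_eq] at this
  exact lt_asymm this (hbad N)

end IsStationaryGaussian

section SecondMoment

variable {Ω α : Type*} [MeasurableSpace Ω] [MeasurableSpace α] {P : Measure Ω}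
  [IsProbabilityMeasure P] {ν : Measure α} [IsFiniteMeasure ν] {F : Ω × α → ℝ} {M : ℝ}

lemma integral_abs_mul_le_of_integral_sq_le {f g : Ω → ℝ} (hf : MemLp f 2 P) (hg : MemLp g 2 P)
    (hfM : ∫ ω, f ω ^ 2 ∂P ≤ M) (hgM : ∫ ω, g ω ^ 2 ∂P ≤ M) : ∫ ω, |f ω * g ω| ∂P ≤ M := by
  have : ∫ ω, |f ω * g ω| ∂P ≤ ∫ ω, 2⁻¹ * (f ω ^ 2 + g ω ^ 2) ∂P := by
    refine integral_mono (hf.integrable_mul hg).norm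
      ((hf.integrable_sq.add hg.integrable_sq).const_mul _) fun ω => ?_
    simp only [abs_mul]
    nlinarith [sq_nonneg (|f ω| - |g ω|), sq_abs (f ω), sq_abs (g ω)]
  refine this.trans ?_
  rw [integral_const_mul, integral_add hf.integrable_sq hg.integrable_sq]
  linarith

/-- A second moment bound for a mixture tested against a bounded function. -/
lemma norm_integral_mul_sq_le (hF : Measurable F)
    (h : ∀ᵐ u ∂ν, MemLp (fun ω => F (ω, u)) 2 P ∧ ∫ ω, F (ω, u) ^ 2 ∂P ≤ M)
    {φ : Ω → ℂ} (hφ : Measurable φ) (hφ1 : ∀ ω, ‖φ ω‖ ≤ 1) :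
    ‖∫ v, ∫ ω, (F (ω, v) : ℂ) * φ ω ∂P ∂ν‖ ^ 2
      ≤ ∫ p, ∫ ω, F (ω, p.1) * F (ω, p.2) ∂P ∂(ν.prod ν) := by
  have i1 := integrable_prod_of_integral_sq_le hF h
  have i1φ : Integrable (fun p : Ω × α => (F p : ℂ) * φ p.1) (P.prod ν) := by
    refine i1.norm.mono' ((Complex.measurable_ofReal.comp hF).mul
      (hφ.comp measurable_fst)).aestronglyMeasurable (Eventually.of_forall fun p => ?_)
    rw [norm_mul, Complex.norm_real]
    exact mul_le_of_le_one_right (norm_nonneg _) (hφ1 _)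
  have h1 : ∀ᵐ p ∂(ν.prod ν), MemLp (fun ω => F (ω, p.1)) 2 P ∧ ∫ ω, F (ω, p.1) ^ 2 ∂P ≤ M :=
    Measure.quasiMeasurePreserving_fst.ae h
  have h2 : ∀ᵐ p ∂(ν.prod ν), MemLp (fun ω => F (ω, p.2)) 2 P ∧ ∫ ω, F (ω, p.2) ^ 2 ∂P ≤ M :=
    Measure.quasiMeasurePreserving_snd.ae h
  have m2 : Measurable fun q : Ω × α × α => F (q.1, q.2.1) * F (q.1, q.2.2) := by fun_prop
  have i2 : Integrable (fun q : Ω × α × α => F (q.1, q.2.1) * F (q.1, q.2.2))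
      (P.prod (ν.prod ν)) := by
    refine (integrable_prod_iff' m2.aestronglyMeasurable).2 ⟨?_, ?_⟩
    · filter_upwards [h1, h2] with p hp1 hp2 using hp1.1.integrable_mul hp2.1
    · refine (integrable_const M).mono'
        (m2.norm.stronglyMeasurable.integral_prod_left (μ := P)).aestronglyMeasurable ?_
      filter_upwards [h1, h2] with p hp1 hp2
      rw [norm_of_nonneg (integral_nonneg fun ω => norm_nonneg _)]
      exact integral_abs_mul_le_of_integral_sq_le hp1.1 hp2.1 hp1.2 hp2.2
  set H : Ω → ℝ := fun ω => ∫ v, F (ω, v) ∂ν with hH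
  have Hm : Measurable H := (hF.stronglyMeasurable.integral_prod_right' (ν := ν)).measurable
  have hH2 : ∀ ω, H ω ^ 2 = ∫ p, F (ω, p.1) * F (ω, p.2) ∂(ν.prod ν) := fun ω => by
    rw [integral_prod_mul (μ := ν) (ν := ν) (fun v => F (ω, v)) (fun v => F (ω, v)), sq]
  have iH2 : Integrable (fun ω => H ω ^ 2) P := by
    simp_rw [hH2]
    exact i2.integral_prod_left
  have HL : MemLp H 2 P := (memLp_two_iff_integrable_sq Hm.aestronglyMeasurable).2 iH2
  have e2 : ∫ p, ∫ ω, F (ω, p.1) * F (ω, p.2) ∂P ∂(ν.prod ν) = ∫ ω, H ω ^ 2 ∂P := by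
    simp_rw [hH2]
    rw [← integral_prod_symm _ i2, integral_prod _ i2]
  have e1 : ∫ v, ∫ ω, (F (ω, v) : ℂ) * φ ω ∂P ∂ν = ∫ ω, (H ω : ℂ) * φ ω ∂P := by
    rw [← integral_prod_symm _ i1φ, integral_prod _ i1φ]
    refine integral_congr_ae (Eventually.of_forall fun ω => ?_)
    simp only [hH]
    rw [integral_mul_const, integral_complex_ofReal]
  have h3 : ‖∫ ω, (H ω : ℂ) * φ ω ∂P‖ ≤ ∫ ω, |H ω| * 1 ∂P := by
    refine norm_integral_le_of_norm_le ((HL.integrable (by norm_num)).norm.mul_const 1)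
      (Eventually.of_forall fun ω => ?_)
    rw [norm_mul, Complex.norm_real]
    exact mul_le_mul_of_nonneg_left (hφ1 _) (norm_nonneg _)
  have HLa : MemLp (fun ω => |H ω|) 2 P := HL.abs
  have h4 := abs_integral_mul_le_sqrt HLa (memLp_const (1 : ℝ))
  simp only [sq_abs, one_pow, integral_const, probReal_univ, smul_eq_mul, mul_one, sqrt_one] at h4
  simp only [mul_one] at h3
  rw [e1, e2, ← sq_sqrt (integral_nonneg fun ω => sq_nonneg (H ω))]
  exact pow_le_pow_left₀ (norm_nonneg _) (h3.trans ((le_abs_self _).trans h4)) 2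

end SecondMoment

/-- The times `v ∈ (0, T]` for which `v + x ∈ (0, T]`. -/
def overlap (T x : ℝ) : Set ℝ := Ioc 0 T ∩ (fun v => v + x) ⁻¹' Ioc 0 T

lemma measurableSet_overlap (T x : ℝ) : MeasurableSet (overlap T x) :=
  measurableSet_Ioc.inter (measurableSet_Ioc.preimage (measurable_id.add_const x))

lemma volume_overlap_le {T : ℝ} (hT : 0 ≤ T) (x : ℝ) : volume.real (overlap T x) ≤ T := by
  have := measureReal_mono (μ := volume) (s₁ := overlap T x) (s₂ := Ioc 0 T) inter_subset_left
    (by simp)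
  simpa [hT] using this

lemma sub_abs_le_volume_overlap (T x : ℝ) : T - |x| ≤ volume.real (overlap T x) := by
  have h1 : Ioc (max 0 (-x)) (min T (T - x)) ⊆ overlap T x := by
    intro v hv
    simp only [mem_Ioc, max_lt_iff, le_min_iff] at hv
    exact ⟨⟨hv.1.1, hv.2.1⟩, by simp only [mem_preimage, mem_Ioc]; constructor <;> linarith⟩
  have h2 : volume (overlap T x) ≠ ⊤ :=
    (measure_mono inter_subset_left).trans_lt (by simp : volume (Ioc 0 T) < ⊤) |>.ne
  refine le_trans ?_ (measureReal_mono h1 h2)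
  rw [measureReal_def, volume_Ioc, ENNReal.toReal_ofReal']
  refine le_max_of_le_left ?_
  rcases abs_cases x with ⟨h, _⟩ | ⟨h, _⟩ <;> rcases min_cases T (T - x) with ⟨h', _⟩ | ⟨h', _⟩ <;>
    rcases max_cases 0 (-x) with ⟨h'', _⟩ | ⟨h'', _⟩ <;> linarith

lemma tendsto_volume_overlap_div (x : ℝ) :
    Tendsto (fun T => volume.real (overlap T x) / T) atTop (nhds 1) := by
  have h1 : Tendsto (fun T : ℝ => 1 - |x| / T) atTop (nhds (1 - 0)) :=
    (tendsto_const_nhds.div_atTop tendsto_id).const_sub 1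
  rw [sub_zero] at h1
  refine tendsto_of_tendsto_of_tendsto_of_le_of_le' h1 tendsto_const_nhds
    ((eventually_gt_atTop 0).mono fun T hT => ?_) ((eventually_gt_atTop 0).mono fun T hT => ?_)
  · rw [le_div_iff₀ hT, sub_mul, div_mul_cancel₀ _ hT.ne', one_mul]
    exact sub_abs_le_volume_overlap T x
  · exact div_le_one_of_le₀ (volume_overlap_le hT.le x) hT.le

namespace IsStationaryGaussian

variable {Ω : Type*} [MeasurableSpace Ω] {P : Measure Ω} [IsProbabilityMeasure P]
  {Y : ℝ → Ω → ℝ} {r : ℝ → ℝ}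

lemma integrable_abs_cov_prod (h : IsStationaryGaussian P Y r) {ν : Measure ℝ} [IsFiniteMeasure ν]
    (a : ℝ) : Integrable (fun p : ℝ × ℝ => |r (p.1 - p.2 + a)|) (ν.prod ν) := by
  have hr := h.measurable_cov
  refine (integrable_const (1 : ℝ)).mono' (Measurable.aestronglyMeasurable (by fun_prop))
    (Eventually.of_forall fun p => ?_)
  rw [norm_eq_abs, abs_abs]
  exact h.abs_le_one _

lemma integral_abs_cov_prod_le (h : IsStationaryGaussian P Y r) {A : Set ℝ} {T : ℝ}
    (hA : volume A ≠ ⊤) (hAT : volume.real A ≤ T) (a : ℝ) :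
    ∫ p : ℝ × ℝ, |r (p.1 - p.2 + a)| ∂((volume.restrict A).prod (volume.restrict A))
      ≤ T * ∫ x, |r x| := by
  have : IsFiniteMeasure (volume.restrict A) := isFiniteMeasure_restrict.2 hA
  rw [integral_prod _ (h.integrable_abs_cov_prod a)]
  have h1 : ∀ v : ℝ, ∫ w in A, |r (v - w + a)| ≤ ∫ x, |r x| := fun v => by
    have e : (fun w => |r (v - w + a)|) = fun w => |r ((v + a) - w)| := by
      funext w; congr 2; ring
    rw [e, ← integral_sub_left_eq_self (fun x => |r x|) volume (v + a)]
    exact setIntegral_le_integral (h.integrable.abs.comp_sub_left _)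
      (Eventually.of_forall fun _ => abs_nonneg _)
  calc ∫ v in A, ∫ w in A, |r (v - w + a)| ≤ ∫ v in A, ∫ x, |r x| :=
        integral_mono_of_nonneg (Eventually.of_forall fun v => integral_nonneg fun w => abs_nonneg _)
          (integrable_const _) (Eventually.of_forall h1)
    _ = volume.real A * ∫ x, |r x| := by simp
    _ ≤ _ := mul_le_mul_of_nonneg_right hAT (integral_nonneg fun _ => abs_nonneg _)

/-- A weak law of large numbers for functionals of pairs of values at a fixed lag, uniform over
bounded multipliers. -/
lemma exists_norm_integral_overlap_le (h : IsStationaryGaussian P Y r) {f : ℝ × ℝ → ℝ}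
    (hfm : Measurable f) {M : ℝ} (hM : ∀ s t, 0 ≤ s → 0 ≤ t →
      MemLp (fun ω => f (Y s ω, Y t ω)) 2 P ∧ ∫ ω, f (Y s ω, Y t ω) ^ 2 ∂P ≤ M)
    (x : ℝ) {ε : ℝ} (hε : 0 < ε) :
    ∃ T₀ : ℝ, 0 < T₀ ∧ ∀ T, T₀ ≤ T → ∀ φ : Ω → ℂ, Measurable φ → (∀ ω, ‖φ ω‖ ≤ 1) →
      ‖∫ v in overlap T x, ∫ ω, ((f (Y v ω, Y (v + x) ω)
        - ∫ ω', f (Y (max (-x) 0) ω', Y (max x 0) ω') ∂P : ℝ) : ℂ) * φ ω ∂P‖ ≤ ε * T := by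
  set a := max (-x) 0 with ha'
  set b := max x 0 with hb'
  have ha : 0 ≤ a := le_max_right _ _
  have hb : 0 ≤ b := le_max_right _ _
  have hba : b - a = x := by
    rcases le_total 0 x with hx | hx
    · rw [ha', hb', max_eq_left hx, max_eq_right (by linarith)]; ring
    · rw [ha', hb', max_eq_right hx, max_eq_left (by linarith)]; ring
  set ρ := ∫ ω', f (Y a ω', Y b ω') ∂P with hρ
  have hpair := h.measurable_pair
  have hfL : MemLp f 2 (P.map fun ω => (Y a ω, Y b ω)) :=
    (memLp_map_measure_iff hfm.aestronglyMeasurable (hpair a b).aemeasurable).2 (hM a b ha hb).1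
  obtain ⟨δ, hδ, H⟩ := h.exists_abs_integral_pair_sub_le ha hb hfL hfm
    (ε := ε ^ 2 / 2) (by positivity)
  have hmean : ∀ s t, 0 ≤ s → 0 ≤ t → t - s = x → ∫ ω, f (Y s ω, Y t ω) ∂P = ρ := by
    intro s t hs ht hst
    rw [hρ, ← integral_map (f := f) (hpair s t).aemeasurable hfm.aestronglyMeasurable,
      ← integral_map (f := f) (hpair a b).aemeasurable hfm.aestronglyMeasurable,
      h.map_pair_eq hs ht ha hb (hst.trans hba.symm)]
  have hM0 : 0 ≤ M := (integral_nonneg fun _ => sq_nonneg _).trans (hM 0 0 le_rfl le_rfl).2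
  set M₁ := M + ρ ^ 2 with hM1
  have hM10 : 0 ≤ M₁ := by positivity
  set L := ∫ x, |r x| with hL
  have hL0 : 0 ≤ L := integral_nonneg fun _ => abs_nonneg _
  refine ⟨6 * M₁ * L / (δ * ε ^ 2) + 1, by positivity, fun T hT φ hφ hφ1 => ?_⟩
  have hT0 : 0 < T := lt_of_lt_of_le (by positivity) hT
  set ν := volume.restrict (overlap T x) with hν
  have hvol : volume (overlap T x) ≠ ⊤ :=
    (measure_mono inter_subset_left).trans_lt (by simp : volume (Ioc 0 T) < ⊤) |>.ne
  have hνf : IsFiniteMeasure ν := isFiniteMeasure_restrict.2 hvol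
  have hν0 : ∀ᵐ v ∂ν, 0 ≤ v ∧ 0 ≤ v + x :=
    (ae_restrict_mem (measurableSet_overlap T x)).mono fun v hv => ⟨hv.1.1.le, hv.2.1.le⟩
  set F : Ω × ℝ → ℝ := fun p => f (Y p.2 p.1, Y (p.2 + x) p.1) - ρ with hF
  have Fm : Measurable F := (hfm.comp ((h.measurable_comp measurable_snd measurable_fst).prodMk
    (h.measurable_comp (measurable_snd.add_const x) measurable_fst))).sub_const ρ
  have key := norm_integral_mul_sq_le (P := P) (ν := ν) (F := F) (M := M) Fm (by
    filter_upwards [hν0] with v hv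
    have h1 := hM v (v + x) hv.1 hv.2
    refine ⟨h1.1.sub (memLp_const ρ), ?_⟩
    have e : ∫ ω, F (ω, v) ^ 2 ∂P = (∫ ω, f (Y v ω, Y (v + x) ω) ^ 2 ∂P) - ρ ^ 2 := by
      have i1 := h1.1.integrable_sq
      have i2 := (h1.1.integrable (by norm_num)).const_mul (2 * ρ)
      have i3 : Integrable (fun ω => f (Y v ω, Y (v + x) ω) ^ 2
        - 2 * ρ * f (Y v ω, Y (v + x) ω)) P := i1.sub i2
      calc ∫ ω, F (ω, v) ^ 2 ∂P = ∫ ω, (f (Y v ω, Y (v + x) ω) ^ 2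
            - 2 * ρ * f (Y v ω, Y (v + x) ω) + ρ ^ 2) ∂P := by
              refine integral_congr_ae (Eventually.of_forall fun ω => ?_)
              simp only [hF]; ring
        _ = _ := by
          rw [integral_add i3 (integrable_const _), integral_sub i1 i2, integral_const_mul,
            hmean v (v + x) hv.1 hv.2 (by ring)]
          simp; ring
    rw [e]
    linarith [h1.2, sq_nonneg ρ]) hφ hφ1
  have hbd : ∀ᵐ p ∂(ν.prod ν), ‖∫ ω, F (ω, p.1) * F (ω, p.2) ∂P‖ ≤ ε ^ 2 / 2
      + M₁ / δ * (|r (p.1 - p.2 + 0)| + |r (p.1 - p.2 + -x)| + |r (p.1 - p.2 + x)|) := by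
    filter_upwards [Measure.quasiMeasurePreserving_fst.ae hν0,
      Measure.quasiMeasurePreserving_snd.ae hν0] with p hp1 hp2
    have h1 := hM p.1 (p.1 + x) hp1.1 hp1.2
    have h2 := hM p.2 (p.2 + x) hp2.1 hp2.2
    have i1 := h1.1.integrable (by norm_num)
    have i2 := h2.1.integrable (by norm_num)
    have i12 : Integrable (fun ω => f (Y p.1 ω, Y (p.1 + x) ω) * f (Y p.2 ω, Y (p.2 + x) ω)) P :=
      h1.1.integrable_mul h2.1
    have i3 : Integrable (fun ω => f (Y p.1 ω, Y (p.1 + x) ω) * f (Y p.2 ω, Y (p.2 + x) ω)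
      - ρ * f (Y p.1 ω, Y (p.1 + x) ω)) P := i12.sub (i1.const_mul ρ)
    have i4 : Integrable (fun ω => f (Y p.1 ω, Y (p.1 + x) ω) * f (Y p.2 ω, Y (p.2 + x) ω)
      - ρ * f (Y p.1 ω, Y (p.1 + x) ω) - ρ * f (Y p.2 ω, Y (p.2 + x) ω)) P :=
      i3.sub (i2.const_mul ρ)
    have e : ∫ ω, F (ω, p.1) * F (ω, p.2) ∂P
        = (∫ ω, f (Y p.1 ω, Y (p.1 + x) ω) * f (Y p.2 ω, Y (p.2 + x) ω) ∂P) - ρ ^ 2 := by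
      calc ∫ ω, F (ω, p.1) * F (ω, p.2) ∂P
          = ∫ ω, (f (Y p.1 ω, Y (p.1 + x) ω) * f (Y p.2 ω, Y (p.2 + x) ω)
            - ρ * f (Y p.1 ω, Y (p.1 + x) ω) - ρ * f (Y p.2 ω, Y (p.2 + x) ω) + ρ ^ 2) ∂P := by
              refine integral_congr_ae (Eventually.of_forall fun ω => ?_)
              simp only [hF]; ring
        _ = _ := by
          rw [integral_add i4 (integrable_const _), integral_sub i3 (i2.const_mul ρ),
            integral_sub i12 (i1.const_mul ρ), integral_const_mul, integral_const_mul,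
            hmean p.1 (p.1 + x) hp1.1 hp1.2 (by ring), hmean p.2 (p.2 + x) hp2.1 hp2.2 (by ring)]
          simp; ring
    rw [e, norm_eq_abs, add_zero]
    have hr1 := abs_nonneg (r (p.1 - p.2))
    have hr2 := abs_nonneg (r (p.1 - p.2 + -x))
    have hr3 := abs_nonneg (r (p.1 - p.2 + x))
    by_cases hc : |r (p.1 - p.2)| < δ ∧ |r (p.1 - p.2 + -x)| < δ ∧ |r (p.1 - p.2 + x)| < δ
    · have := H p.1 (p.1 + x) p.2 (p.2 + x) hp1.1 hp1.2 hp2.1 hp2.2 (by rw [hba]; ring)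
        (by rw [hba]; ring) hc.1
        (by rw [show p.1 - (p.2 + x) = p.1 - p.2 + -x by ring]; exact hc.2.1)
        (by rw [show p.1 + x - p.2 = p.1 - p.2 + x by ring]; exact hc.2.2)
      exact this.trans (le_add_of_nonneg_right (by positivity))
    · have h3 := integral_abs_mul_le_of_integral_sq_le h1.1 h2.1 h1.2 h2.2
      have h4 : |(∫ ω, f (Y p.1 ω, Y (p.1 + x) ω) * f (Y p.2 ω, Y (p.2 + x) ω) ∂P) - ρ ^ 2|
          ≤ M₁ := by
        refine (abs_sub _ _).trans (add_le_add ((abs_integral_le_integral_abs).trans h3) ?_)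
        rw [abs_of_nonneg (sq_nonneg ρ)]
      have h5 : δ ≤ |r (p.1 - p.2)| + |r (p.1 - p.2 + -x)| + |r (p.1 - p.2 + x)| := by
        by_contra! hlt
        exact hc ⟨by linarith, by linarith, by linarith⟩
      calc _ ≤ M₁ := h4
        _ = M₁ / δ * δ := by field_simp
        _ ≤ M₁ / δ * (|r (p.1 - p.2)| + |r (p.1 - p.2 + -x)| + |r (p.1 - p.2 + x)|) := by gcongr
        _ ≤ _ := le_add_of_nonneg_left (by positivity)
  have j := fun c => h.integrable_abs_cov_prod (ν := ν) c
  have hint := norm_integral_le_of_norm_le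
    ((integrable_const (ε ^ 2 / 2)).add ((((j 0).add (j (-x))).add (j x)).const_mul (M₁ / δ))) hbd
  have hT' := volume_overlap_le hT0.le x
  have j1 := h.integral_abs_cov_prod_le hvol hT'
  have e : ∫ p : ℝ × ℝ, (ε ^ 2 / 2 + M₁ / δ * (|r (p.1 - p.2 + 0)| + |r (p.1 - p.2 + -x)|
      + |r (p.1 - p.2 + x)|)) ∂(ν.prod ν) ≤ ε ^ 2 / 2 * T ^ 2 + M₁ / δ * (T * L + T * L + T * L) := by
    have k1 : Integrable (fun p : ℝ × ℝ => |r (p.1 - p.2 + 0)| + |r (p.1 - p.2 + -x)|) (ν.prod ν) :=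
      (j 0).add (j (-x))
    have k2 : Integrable (fun p : ℝ × ℝ => |r (p.1 - p.2 + 0)| + |r (p.1 - p.2 + -x)|
      + |r (p.1 - p.2 + x)|) (ν.prod ν) := k1.add (j x)
    rw [integral_add (integrable_const _) (k2.const_mul _), integral_const_mul,
      integral_add k1 (j x), integral_add (j 0) (j (-x)), integral_const]
    refine add_le_add ?_ (mul_le_mul_of_nonneg_left
      (add_le_add (add_le_add (j1 0) (j1 (-x))) (j1 x)) (by positivity))
    have : (ν.prod ν).real univ = volume.real (overlap T x) ^ 2 := by
      rw [← univ_prod_univ, measureReal_prod_prod, sq]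
      simp [hν, measureReal_restrict_apply]
    rw [this, smul_eq_mul, mul_comm]
    gcongr
  have hfin : ε ^ 2 / 2 * T ^ 2 + M₁ / δ * (T * L + T * L + T * L) ≤ (ε * T) ^ 2 := by
    have h6 : 6 * M₁ * L / (δ * ε ^ 2) ≤ T := by linarith
    rw [div_le_iff₀ (by positivity)] at h6
    have : M₁ / δ * (T * L + T * L + T * L) = 6 * M₁ * L * (T / (2 * δ)) := by field_simp; ring
    have h7 : 6 * M₁ * L * (T / (2 * δ)) ≤ T * (δ * ε ^ 2) * (T / (2 * δ)) := by gcongr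
    have h8 : T * (δ * ε ^ 2) * (T / (2 * δ)) = ε ^ 2 / 2 * T ^ 2 := by field_simp
    rw [this, mul_pow]
    linarith
  exact (sq_le_sq₀ (norm_nonneg _) (by positivity)).1 (key.trans ((le_abs_self _).trans (hint.trans (e.trans hfin))))

end IsStationaryGaussian

/-- Change of variables to lag coordinates. -/
lemma integral_integral_lag {r : ℝ → ℝ} (hr : Integrable r) (hrm : Measurable r) {B : ℝ → ℝ → ℂ}
    (hB : Measurable (Function.uncurry B)) {C : ℝ}
    (hC : ∀ v u, 0 ≤ v → 0 ≤ u → ‖B v u‖ ≤ C) (T : ℝ) :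
    ∫ v in Ioc 0 T, ∫ u in Ioc 0 T, (r (u - v) : ℂ) * B v u
      = ∫ x, (r x : ℂ) * ∫ v in overlap T x, B v (v + x) := by
  have h1 : ∀ v, ∫ u in Ioc 0 T, (r (u - v) : ℂ) * B v u
      = ∫ x, (Ioc 0 T).indicator (fun u => (r (u - v) : ℂ) * B v u) (x + v) := fun v => by
    rw [integral_add_right_eq_self (fun x => (Ioc 0 T).indicator
      (fun u => (r (u - v) : ℂ) * B v u) x) v, integral_indicator measurableSet_Ioc]
  have h2 : ∀ v x, (Ioc 0 T).indicator (fun u => (r (u - v) : ℂ) * B v u) (x + v)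
      = ((fun v => v + x) ⁻¹' Ioc 0 T).indicator (fun v => (r x : ℂ) * B v (v + x)) v := by
    intro v x
    by_cases hv : x + v ∈ Ioc 0 T
    · rw [indicator_of_mem hv, indicator_of_mem (by rwa [mem_preimage, add_comm])]
      rw [add_sub_cancel_right, add_comm x v]
    · rw [indicator_of_notMem hv, indicator_of_notMem (by rwa [mem_preimage, add_comm])]
  simp_rw [h1, h2]
  rw [integral_integral_swap]
  · refine integral_congr_ae (Eventually.of_forall fun x => ?_)
    simp only
    rw [setIntegral_indicator ((measurable_add_const x) measurableSet_Ioc),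
      integral_const_mul]
    rfl
  · have hm : Measurable (fun p : ℝ × ℝ => (r p.2 : ℂ) * B p.1 (p.1 + p.2)) := by
      have : Measurable fun p : ℝ × ℝ => B p.1 (p.1 + p.2) :=
        hB.comp (measurable_fst.prodMk (measurable_fst.add measurable_snd))
      fun_prop
    have hs : MeasurableSet {p : ℝ × ℝ | p.1 + p.2 ∈ Ioc 0 T} :=
      measurableSet_Ioc.preimage (measurable_fst.add measurable_snd)
    have hi : Integrable (fun p : ℝ × ℝ => C * |r p.2|) ((volume.restrict (Ioc 0 T)).prod volume) :=
      (integrable_const C).mul_prod hr.abs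
    refine hi.mono' (f := Function.uncurry fun v x => ((fun v => v + x) ⁻¹' Ioc 0 T).indicator
      (fun v => (r x : ℂ) * B v (v + x)) v) (hm.indicator hs).aestronglyMeasurable ?_
    have h0 : ∀ᵐ v ∂(volume.restrict (Ioc 0 T)), 0 ≤ v :=
      (ae_restrict_mem measurableSet_Ioc).mono fun v hv => hv.1.le
    filter_upwards [Measure.quasiMeasurePreserving_fst.ae h0] with p hp
    have hC0 : 0 ≤ C := (norm_nonneg _).trans (hC 0 0 le_rfl le_rfl)
    simp only [Function.uncurry]
    by_cases hv : p.1 + p.2 ∈ Ioc 0 T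
    · rw [indicator_of_mem (show p.1 ∈ (fun v => v + p.2) ⁻¹' Ioc 0 T from hv), norm_mul,
        Complex.norm_real, norm_eq_abs, mul_comm]
      exact mul_le_mul_of_nonneg_right (hC _ _ hp hv.1.le) (abs_nonneg _)
    · rw [indicator_of_notMem (show p.1 ∉ (fun v => v + p.2) ⁻¹' Ioc 0 T from hv), norm_zero]
      positivity

/-- The time integral of `g (Y u)` over `(0, T]` in the central limit scaling. -/
noncomputable def scaledIntegral {Ω : Type*} (Y : ℝ → Ω → ℝ) (g : ℝ → ℝ) (T : ℝ) (ω : Ω) : ℝ :=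
  (√T)⁻¹ * ∫ u in Ioc 0 T, g (Y u ω)

/-- The expectation of `steinSolution g (Y v) * g' (Y (v + x))`, which does not depend on `v`. -/
noncomputable def steinCov {Ω : Type*} [MeasurableSpace Ω] (P : Measure Ω) (Y : ℝ → Ω → ℝ)
    (g g' : ℝ → ℝ) (x : ℝ) : ℝ :=
  ∫ ω, steinSolution g (Y (max (-x) 0) ω) * g' (Y (max x 0) ω) ∂P

namespace IsStationaryGaussian

variable {Ω : Type*} [MeasurableSpace Ω] {P : Measure Ω} [IsProbabilityMeasure P]
  {Y : ℝ → Ω → ℝ} {r g g' : ℝ → ℝ}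

lemma measurable_scaledIntegral (h : IsStationaryGaussian P Y r) (hg : Measurable g) (T : ℝ) :
    Measurable (scaledIntegral Y g T) := by
  have : Measurable fun p : Ω × ℝ => g (Y p.2 p.1) :=
    hg.comp (h.measurable_comp measurable_snd measurable_fst)
  exact (this.stronglyMeasurable.integral_prod_right'
    (ν := volume.restrict (Ioc 0 T))).measurable.const_mul _

lemma integrable_comp_prod_Ioc (h : IsStationaryGaussian P Y r) (hg : IsAdmissible g g') (T : ℝ) :
    Integrable (fun p : Ω × ℝ => g (Y p.2 p.1)) (P.prod (volume.restrict (Ioc 0 T))) :=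
  h.integrable_comp_prod hg ((ae_restrict_mem measurableSet_Ioc).mono fun _ hv => hv.1.le)

lemma integrable_scaledIntegral (h : IsStationaryGaussian P Y r) (hg : IsAdmissible g g') (T : ℝ) :
    Integrable (scaledIntegral Y g T) P :=
  (h.integrable_comp_prod_Ioc hg T).integral_prod_left.const_mul _

/-- The covariance identity for the scaled time integral. -/
lemma integral_scaledIntegral_mul_cexp (h : IsStationaryGaussian P Y r) (hg : IsAdmissible g g')
    {T : ℝ} (hT : 0 < T) (s : ℝ) :
    ∫ ω, (scaledIntegral Y g T ω : ℂ) * Complex.I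
        * Complex.exp (((s * scaledIntegral Y g T ω : ℝ) : ℂ) * Complex.I) ∂P
      = -s * ((T : ℂ)⁻¹ * ∫ v in Ioc 0 T, ∫ u in Ioc 0 T, (r (u - v) : ℂ) *
          ∫ ω, ((steinSolution g (Y v ω) * g' (Y u ω) : ℝ) : ℂ)
            * Complex.exp (((s * scaledIntegral Y g T ω : ℝ) : ℂ) * Complex.I) ∂P) := by
  set e : Ω → ℂ := fun ω => Complex.exp (((s * scaledIntegral Y g T ω : ℝ) : ℂ) * Complex.I) with he
  have hSm := h.measurable_scaledIntegral hg.continuous.measurable T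
  have em : Measurable e := by fun_prop
  have e1 : ∀ ω, ‖e ω‖ = 1 := fun ω => Complex.norm_exp_ofReal_mul_I _
  obtain ⟨ν, hν⟩ : ∃ ν : Measure ℝ, ν = (ENNReal.ofReal T)⁻¹ • volume.restrict (Ioc 0 T) := ⟨_, rfl⟩
  have hνP : IsProbabilityMeasure ν := ⟨by
    rw [hν, Measure.smul_apply, Measure.restrict_apply_univ, Real.volume_Ioc, sub_zero, smul_eq_mul]
    exact ENNReal.inv_mul_cancel (by simpa using hT) (by simp)⟩
  have hνi : ∀ {E : Type} [NormedAddCommGroup E] [NormedSpace ℝ E] (f : ℝ → E),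
      ∫ u, f u ∂ν = T⁻¹ • ∫ u in Ioc 0 T, f u := fun f => by
    rw [hν, integral_smul_measure, ENNReal.toReal_inv, ENNReal.toReal_ofReal hT.le]
  have hν0 : ∀ᵐ u ∂ν, 0 ≤ u := by
    rw [hν]
    exact Measure.ae_smul_measure ((ae_restrict_mem measurableSet_Ioc).mono fun _ hv => hv.1.le) _
  have hsq : √T * √T = T := mul_self_sqrt hT.le
  have hs0 : √T ≠ 0 := (sqrt_pos.2 hT).ne'
  have hS : ∀ ω, s * √T * ∫ u, g (Y u ω) ∂ν = s * scaledIntegral Y g T ω := fun ω => by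
    rw [hνi, scaledIntegral, smul_eq_mul]
    rw [show T⁻¹ = (√T)⁻¹ * (√T)⁻¹ by rw [← mul_inv, hsq]]
    field_simp
  have key : ∀ v, 0 ≤ v → ∫ ω, (g (Y v ω) : ℂ) * e ω ∂P
      = ((s * √T : ℝ) : ℂ) * Complex.I * ((T : ℂ)⁻¹ * ∫ u in Ioc 0 T, (r (u - v) : ℂ) *
          ∫ ω, ((steinSolution g (Y v ω) * g' (Y u ω) : ℝ) : ℂ) * e ω ∂P) := by
    intro v hv
    have := h.integral_mul_cexp_integral hg hν0 hv (s * √T)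
    simp only [hS] at this
    rw [hνi] at this
    rw [this]
    congr 1
    rw [Complex.real_smul, Complex.ofReal_inv]
    congr 1
    refine integral_congr_ae (Eventually.of_forall fun u => ?_)
    simp only [he]
    rw [← integral_const_mul]
    refine integral_congr_ae (Eventually.of_forall fun ω => ?_)
    simp only [Complex.ofReal_mul]
    ring
  have i1 := h.integrable_comp_prod_Ioc hg T
  have i1e : Integrable (fun p : Ω × ℝ => (g (Y p.2 p.1) : ℂ) * e p.1)
      (P.prod (volume.restrict (Ioc 0 T))) := by
    refine i1.norm.mono' ((Complex.measurable_ofReal.comp (hg.continuous.measurable.comp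
      (h.measurable_comp measurable_snd measurable_fst))).mul
      (em.comp measurable_fst)).aestronglyMeasurable (Eventually.of_forall fun p => ?_)
    rw [norm_mul, Complex.norm_real, e1, mul_one]
  calc ∫ ω, (scaledIntegral Y g T ω : ℂ) * Complex.I * e ω ∂P
      = ∫ ω, (((√T)⁻¹ : ℝ) * Complex.I * ∫ v in Ioc 0 T, (g (Y v ω) : ℂ) * e ω) ∂P := by
        refine integral_congr_ae (Eventually.of_forall fun ω => ?_)
        simp only
        rw [integral_mul_const, integral_complex_ofReal, scaledIntegral]
        push_cast
        ring
    _ = ((√T)⁻¹ : ℝ) * Complex.I * ∫ v in Ioc 0 T, ∫ ω, (g (Y v ω) : ℂ) * e ω ∂P := by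
        rw [integral_const_mul, ← integral_prod_symm _ i1e, integral_prod _ i1e]
    _ = ((√T)⁻¹ : ℝ) * Complex.I * ∫ v in Ioc 0 T,
          ((s * √T : ℝ) : ℂ) * Complex.I * ((T : ℂ)⁻¹ * ∫ u in Ioc 0 T, (r (u - v) : ℂ) *
          ∫ ω, ((steinSolution g (Y v ω) * g' (Y u ω) : ℝ) : ℂ) * e ω ∂P) := by
        congr 1
        exact setIntegral_congr_fun measurableSet_Ioc fun v hv => key v hv.1.le
    _ = _ := by
        rw [integral_const_mul, integral_const_mul]
        have : (((√T)⁻¹ : ℝ) : ℂ) * Complex.I * (((s * √T : ℝ) : ℂ) * Complex.I) = -s := by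
          rw [show (((√T)⁻¹ : ℝ) : ℂ) * Complex.I * (((s * √T : ℝ) : ℂ) * Complex.I)
            = (((√T)⁻¹ * (s * √T) : ℝ) : ℂ) * (Complex.I * Complex.I) by push_cast; ring,
            Complex.I_mul_I]
          rw [show (√T)⁻¹ * (s * √T) = s by field_simp]
          ring
        rw [← mul_assoc, this]

end IsStationaryGaussian

lemma hasDerivAt_integral_cexp {Ω : Type*} [MeasurableSpace Ω] {P : Measure Ω}
    [IsProbabilityMeasure P] {S : Ω → ℝ} (hS : Measurable S) (hi : Integrable S P) (s : ℝ) :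
    HasDerivAt (fun s : ℝ => ∫ ω, Complex.exp (((s * S ω : ℝ) : ℂ) * Complex.I) ∂P)
      (∫ ω, (S ω : ℂ) * Complex.I * Complex.exp (((s * S ω : ℝ) : ℂ) * Complex.I) ∂P) s := by
  refine (hasDerivAt_integral_of_dominated_loc_of_deriv_le (μ := P) (s := univ) (x₀ := s)
    (bound := fun ω => |S ω|)
    (F := fun (s : ℝ) ω => Complex.exp (((s * S ω : ℝ) : ℂ) * Complex.I))
    (F' := fun (s : ℝ) ω => (S ω : ℂ) * Complex.I * Complex.exp (((s * S ω : ℝ) : ℂ) * Complex.I))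
    univ_mem (Eventually.of_forall fun s => ?_) ?_ ?_ ?_ hi.abs ?_).2
  · exact Measurable.aestronglyMeasurable (by fun_prop)
  · refine (integrable_const (1 : ℝ)).mono' (Measurable.aestronglyMeasurable (by fun_prop))
      (Eventually.of_forall fun ω => ?_)
    rw [Complex.norm_exp_ofReal_mul_I]
  · exact Measurable.aestronglyMeasurable (by fun_prop)
  · refine Eventually.of_forall fun ω s _ => ?_
    rw [norm_mul, norm_mul, Complex.norm_exp_ofReal_mul_I, Complex.norm_I, Complex.norm_real]
    simp
  · refine Eventually.of_forall fun ω s _ => ?_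
    have h1 : HasDerivAt (fun s : ℝ => ((s * S ω : ℝ) : ℂ) * Complex.I)
        ((S ω : ℂ) * Complex.I) s := by
      have := ((hasDerivAt_id s).mul_const (S ω)).ofReal_comp.mul_const Complex.I
      simpa using this
    simpa [mul_comm] using h1.cexp

lemma continuous_integral_mul_cexp {Ω : Type*} [MeasurableSpace Ω] {P : Measure Ω}
    {S : Ω → ℝ} (hS : Measurable S) (hi : Integrable S P) :
    Continuous fun s : ℝ =>
      ∫ ω, (S ω : ℂ) * Complex.I * Complex.exp (((s * S ω : ℝ) : ℂ) * Complex.I) ∂P := by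
  refine continuous_of_dominated (bound := fun ω => |S ω|)
    (fun s => Measurable.aestronglyMeasurable (by fun_prop))
    (fun s => Eventually.of_forall fun ω => ?_) hi.abs (Eventually.of_forall fun ω => by fun_prop)
  rw [norm_mul, norm_mul, Complex.norm_exp_ofReal_mul_I, Complex.norm_I, Complex.norm_real]
  simp

namespace IsStationaryGaussian

variable {Ω : Type*} [MeasurableSpace Ω] {P : Measure Ω} [IsProbabilityMeasure P]
  {Y : ℝ → Ω → ℝ} {r g g' : ℝ → ℝ}

lemma exists_abs_steinCov_le (h : IsStationaryGaussian P Y r) (hg : IsAdmissible g g') :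
    ∃ K, 0 ≤ K ∧ ∀ u v, 0 ≤ u → 0 ≤ v →
      ∫ ω, |steinSolution g (Y v ω) * g' (Y u ω)| ∂P ≤ K := by
  obtain ⟨M, hM0, hM⟩ := h.integral_comp_mul_sq_le hg
  refine ⟨max M 1, hM0.trans (le_max_left _ _), fun u v hu hv => ?_⟩
  have := integral_abs_mul_le_of_integral_sq_le (M := max M 1) (hM u v hu hv).1
    (memLp_const (μ := P) (1 : ℝ)) ((hM u v hu hv).2.trans (le_max_left _ _)) (by simp)
  simpa using this

lemma measurable_steinCov (h : IsStationaryGaussian P Y r) (hg : IsAdmissible g g') :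
    Measurable (steinCov P Y g g') := by
  have : Measurable fun p : ℝ × Ω =>
      steinSolution g (Y (max (-p.1) 0) p.2) * g' (Y (max p.1 0) p.2) :=
    (hg.continuous_steinSolution.measurable.comp
      (h.measurable_comp (f := fun p : ℝ × Ω => max (-p.1) 0) (by fun_prop) measurable_snd)).mul
    (hg.measurable_deriv.comp
      (h.measurable_comp (f := fun p : ℝ × Ω => max p.1 0) (by fun_prop) measurable_snd))
  exact this.stronglyMeasurable.integral_prod_right'.measurable

/-- The averaged stochastic factor at lag `x` tends to its mean. -/
lemma tendsto_average_overlap (h : IsStationaryGaussian P Y r) (hg : IsAdmissible g g')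
    (x s : ℝ) :
    Tendsto (fun T : ℝ => (T : ℂ)⁻¹ * (∫ v in overlap T x,
        ∫ ω, ((steinSolution g (Y v ω) * g' (Y (v + x) ω) : ℝ) : ℂ)
          * Complex.exp (((s * scaledIntegral Y g T ω : ℝ) : ℂ) * Complex.I) ∂P)
      - steinCov P Y g g' x
        * ∫ ω, Complex.exp (((s * scaledIntegral Y g T ω : ℝ) : ℂ) * Complex.I) ∂P)
      atTop (nhds 0) := by
  obtain ⟨M, hM0, hM⟩ := h.integral_comp_mul_sq_le hg
  set f : ℝ × ℝ → ℝ := fun p => steinSolution g p.1 * g' p.2 with hf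
  have fm : Measurable f := (hg.continuous_steinSolution.measurable.comp measurable_fst).mul
    (hg.measurable_deriv.comp measurable_snd)
  set ρ := steinCov P Y g g' x with hρ
  set e : ℝ → Ω → ℂ := fun T ω =>
    Complex.exp (((s * scaledIntegral Y g T ω : ℝ) : ℂ) * Complex.I) with he
  have hSm := h.measurable_scaledIntegral hg.continuous.measurable
  have em : ∀ T, Measurable (e T) := fun T => by
    have := hSm T
    fun_prop
  have e1 : ∀ T ω, ‖e T ω‖ = 1 := fun T ω => Complex.norm_exp_ofReal_mul_I _
  have ei : ∀ T, Integrable (e T) P := fun T => (integrable_const (1 : ℝ)).mono'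
    (em T).aestronglyMeasurable (Eventually.of_forall fun ω => (e1 T ω).le)
  have en : ∀ T, ‖∫ ω, e T ω ∂P‖ ≤ 1 := fun T => by
    have := norm_integral_le_of_norm_le_const (μ := P) (Eventually.of_forall fun ω => (e1 T ω).le)
    simpa using this
  -- split off the fluctuation
  have h1 : Tendsto (fun T : ℝ => (T : ℂ)⁻¹ * ∫ v in overlap T x,
      ∫ ω, ((f (Y v ω, Y (v + x) ω) - ρ : ℝ) : ℂ) * e T ω ∂P) atTop (nhds 0) := by
    rw [Metric.tendsto_atTop]
    intro ε hε
    obtain ⟨T₀, hT0, H⟩ := h.exists_norm_integral_overlap_le fm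
      (fun s t hs ht => hM t s ht hs) x (half_pos hε)
    refine ⟨T₀, fun T hT => ?_⟩
    have hTp : 0 < T := hT0.trans_le hT
    rw [dist_zero_right, norm_mul, norm_inv, Complex.norm_real, norm_eq_abs, abs_of_pos hTp,
      inv_mul_lt_iff₀ hTp]
    refine (H T hT (e T) (em T) fun ω => (e1 T ω).le).trans_lt ?_
    rw [mul_comm]
    gcongr
    linarith
  have h2 : Tendsto (fun T : ℝ => ((volume.real (overlap T x) / T - 1 : ℝ) : ℂ)
      * (ρ * ∫ ω, e T ω ∂P)) atTop (nhds 0) := by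
    have h3 : Tendsto (fun T : ℝ => |volume.real (overlap T x) / T - 1| * |ρ|) atTop (nhds 0) := by
      have := (((tendsto_volume_overlap_div x).sub_const 1).abs).mul_const |ρ|
      simpa using this
    refine squeeze_zero_norm (fun T => ?_) h3
    rw [norm_mul, norm_mul, Complex.norm_real, Complex.norm_real, norm_eq_abs, norm_eq_abs]
    exact mul_le_mul_of_nonneg_left (mul_le_of_le_one_right (abs_nonneg _) (en T)) (abs_nonneg _)
  have h12 := h1.add h2
  rw [add_zero] at h12
  refine h12.congr' ((eventually_gt_atTop 0).mono fun T hT => ?_)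
  have hvol : volume (overlap T x) ≠ ⊤ :=
    (measure_mono inter_subset_left).trans_lt (by simp : volume (Ioc 0 T) < ⊤) |>.ne
  have hνf : IsFiniteMeasure (volume.restrict (overlap T x)) := isFiniteMeasure_restrict.2 hvol
  have hpt : ∀ v ∈ overlap T x, ∫ ω, ((f (Y v ω, Y (v + x) ω) - ρ : ℝ) : ℂ) * e T ω ∂P
      = (∫ ω, ((f (Y v ω, Y (v + x) ω) : ℝ) : ℂ) * e T ω ∂P) - ρ * ∫ ω, e T ω ∂P := by
    intro v hv
    have i1 := (hM (v + x) v hv.2.1.le hv.1.1.le).1.integrable (by norm_num)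
    have i2 : Integrable (fun ω => ((f (Y v ω, Y (v + x) ω) : ℝ) : ℂ) * e T ω) P := by
      refine (i1.ofReal (𝕜 := ℂ)).mul_bdd (c := 1) (em T).aestronglyMeasurable
        (Eventually.of_forall fun ω => (e1 T ω).le)
    rw [← integral_const_mul, ← integral_sub i2 ((ei T).const_mul _)]
    refine integral_congr_ae (Eventually.of_forall fun ω => ?_)
    simp only
    push_cast
    ring
  have hint : Integrable (fun v => ∫ ω, ((f (Y v ω, Y (v + x) ω) : ℝ) : ℂ) * e T ω ∂P)
      (volume.restrict (overlap T x)) := by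
    have hm : Measurable fun p : ℝ × Ω => ((f (Y p.1 p.2, Y (p.1 + x) p.2) : ℝ) : ℂ) * e T p.2 := by
      have m1 : Measurable fun p : ℝ × Ω => f (Y p.1 p.2, Y (p.1 + x) p.2) :=
        fm.comp ((h.measurable_comp measurable_fst measurable_snd).prodMk
          (h.measurable_comp (measurable_fst.add_const x) measurable_snd))
      exact (Complex.measurable_ofReal.comp m1).mul ((em T).comp measurable_snd)
    obtain ⟨K, hK0, hK⟩ := h.exists_abs_steinCov_le hg
    refine (integrable_const K).mono'
      (hm.stronglyMeasurable.integral_prod_right' (ν := P)).aestronglyMeasurable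
      ((ae_restrict_mem (measurableSet_overlap T x)).mono fun v hv => ?_)
    refine (norm_integral_le_integral_norm _).trans ((le_of_eq ?_).trans
      (hK (v + x) v hv.2.1.le hv.1.1.le))
    refine integral_congr_ae (Eventually.of_forall fun ω => ?_)
    simp only [norm_mul, e1, mul_one, Complex.norm_real, norm_eq_abs, hf, abs_mul]
  rw [setIntegral_congr_fun (measurableSet_overlap T x) hpt, integral_sub hint (integrable_const _),
    integral_const]
  have hTc : (T : ℂ) ≠ 0 := by exact_mod_cast hT.ne'
  change _ = (T : ℂ)⁻¹ * (∫ v in overlap T x, ∫ ω, ((f (Y v ω, Y (v + x) ω) : ℝ) : ℂ) * e T ω ∂P)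
    - ρ * ∫ ω, e T ω ∂P
  generalize (∫ v in overlap T x, ∫ ω, ((f (Y v ω, Y (v + x) ω) : ℝ) : ℂ) * e T ω ∂P) = A
  simp only [measureReal_restrict_apply_univ, Complex.real_smul]
  push_cast
  field_simp
  ring

end IsStationaryGaussian

lemma measurable_integral_overlap {B : ℝ → ℝ → ℂ} (hB : Measurable (Function.uncurry B)) (T : ℝ) :
    Measurable fun x => ∫ v in overlap T x, B v (v + x) := by
  have h1 : ∀ x, ∫ v in overlap T x, B v (v + x)
      = ∫ v, (overlap T x).indicator (fun v => B v (v + x)) v := fun x =>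
    (integral_indicator (measurableSet_overlap T x)).symm
  simp_rw [h1]
  have hs : MeasurableSet {p : ℝ × ℝ | p.2 ∈ overlap T p.1} :=
    (measurableSet_Ioc.preimage measurable_snd).inter
      (measurableSet_Ioc.preimage (measurable_snd.add measurable_fst))
  have hm : Measurable fun p : ℝ × ℝ => B p.2 (p.2 + p.1) :=
    hB.comp (measurable_snd.prodMk (measurable_snd.add measurable_fst))
  exact ((hm.indicator hs).stronglyMeasurable.integral_prod_right' (ν := volume)).measurable

namespace IsStationaryGaussian

variable {Ω : Type*} [MeasurableSpace Ω] {P : Measure Ω} [IsProbabilityMeasure P]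
  {Y : ℝ → Ω → ℝ} {r g g' : ℝ → ℝ}

lemma exists_abs_steinCov_le' (h : IsStationaryGaussian P Y r) (hg : IsAdmissible g g') :
    ∃ K, 0 ≤ K ∧ ∀ x, |steinCov P Y g g' x| ≤ K := by
  obtain ⟨K, hK0, hK⟩ := h.exists_abs_steinCov_le hg
  exact ⟨K, hK0, fun x => (abs_integral_le_integral_abs).trans
    (hK _ _ (le_max_right _ _) (le_max_right _ _))⟩

lemma integrable_mul_steinCov (h : IsStationaryGaussian P Y r) (hg : IsAdmissible g g') :
    Integrable fun x => r x * steinCov P Y g g' x := by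
  obtain ⟨K, hK0, hK⟩ := h.exists_abs_steinCov_le' hg
  exact h.integrable.mul_bdd (c := K) (h.measurable_steinCov hg).aestronglyMeasurable
    (Eventually.of_forall hK)

/-- Up to an error that vanishes in the limit and is uniformly bounded for bounded arguments, the
characteristic function of the scaled integral solves the differential equation of a Gaussian
characteristic function. -/
lemma exists_bound_tendsto_cexp_scaledIntegral (h : IsStationaryGaussian P Y r)
    (hg : IsAdmissible g g') :
    ∃ C, 0 ≤ C ∧ ∀ s : ℝ,
      (∀ T, 0 < T → ‖(∫ ω, (scaledIntegral Y g T ω : ℂ) * Complex.I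
          * Complex.exp (((s * scaledIntegral Y g T ω : ℝ) : ℂ) * Complex.I) ∂P)
        + s * (∫ x, r x * steinCov P Y g g' x : ℝ)
          * ∫ ω, Complex.exp (((s * scaledIntegral Y g T ω : ℝ) : ℂ) * Complex.I) ∂P‖ ≤ |s| * C) ∧
      Tendsto (fun T => (∫ ω, (scaledIntegral Y g T ω : ℂ) * Complex.I
          * Complex.exp (((s * scaledIntegral Y g T ω : ℝ) : ℂ) * Complex.I) ∂P)
        + s * (∫ x, r x * steinCov P Y g g' x : ℝ)
          * ∫ ω, Complex.exp (((s * scaledIntegral Y g T ω : ℝ) : ℂ) * Complex.I) ∂P)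
        atTop (nhds 0) := by
  obtain ⟨K, hK0, hK⟩ := h.exists_abs_steinCov_le hg
  have hL0 : 0 ≤ ∫ x, |r x| := integral_nonneg fun _ => abs_nonneg _
  refine ⟨2 * K * ∫ x, |r x|, by positivity, fun s => ?_⟩
  set ρ := steinCov P Y g g' with hρ
  have hρK : ∀ x, |ρ x| ≤ K := fun x => (abs_integral_le_integral_abs).trans
    (hK _ _ (le_max_right _ _) (le_max_right _ _))
  set e : ℝ → Ω → ℂ := fun T ω =>
    Complex.exp (((s * scaledIntegral Y g T ω : ℝ) : ℂ) * Complex.I) with he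
  have hSm := h.measurable_scaledIntegral hg.continuous.measurable
  have em : ∀ T, Measurable (e T) := fun T => by
    have := hSm T
    fun_prop
  have e1 : ∀ T ω, ‖e T ω‖ = 1 := fun T ω => Complex.norm_exp_ofReal_mul_I _
  have en : ∀ T, ‖∫ ω, e T ω ∂P‖ ≤ 1 := fun T => by
    have := norm_integral_le_of_norm_le_const (μ := P) (Eventually.of_forall fun ω => (e1 T ω).le)
    simpa using this
  set B : ℝ → ℝ → ℝ → ℂ := fun T v u =>
    ∫ ω, ((steinSolution g (Y v ω) * g' (Y u ω) : ℝ) : ℂ) * e T ω ∂P with hB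
  have hBm : ∀ T, Measurable (Function.uncurry (B T)) := fun T => by
    have m1 : Measurable fun p : (ℝ × ℝ) × Ω =>
        steinSolution g (Y p.1.1 p.2) * g' (Y p.1.2 p.2) :=
      (hg.continuous_steinSolution.measurable.comp (h.measurable_comp
        (measurable_fst.comp measurable_fst) measurable_snd)).mul
      (hg.measurable_deriv.comp (h.measurable_comp
        (measurable_snd.comp measurable_fst) measurable_snd))
    exact ((Complex.measurable_ofReal.comp m1).mul
      ((em T).comp measurable_snd)).stronglyMeasurable.integral_prod_right'.measurable
  have hBK : ∀ T v u, 0 ≤ v → 0 ≤ u → ‖B T v u‖ ≤ K := fun T v u hv hu => by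
    refine (norm_integral_le_integral_norm _).trans ((le_of_eq ?_).trans (hK u v hu hv))
    refine integral_congr_ae (Eventually.of_forall fun ω => ?_)
    simp only [norm_mul, e1, mul_one, Complex.norm_real, norm_eq_abs]
    rw [abs_mul]
  set D : ℝ → ℝ → ℂ := fun T x => (T : ℂ)⁻¹ * (∫ v in overlap T x, B T v (v + x))
    - ρ x * ∫ ω, e T ω ∂P with hD
  have hJ : ∀ T : ℝ, 0 < T → ∀ x, ‖(T : ℂ)⁻¹ * ∫ v in overlap T x, B T v (v + x)‖ ≤ K := by
    intro T hT x
    have hvol : volume (overlap T x) < ⊤ :=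
      (measure_mono inter_subset_left).trans_lt (by simp : volume (Ioc 0 T) < ⊤)
    have := norm_setIntegral_le_of_norm_le_const (C := K) hvol (f := fun v => B T v (v + x))
      fun v hv => hBK T v (v + x) hv.1.1.le hv.2.1.le
    rw [norm_mul, norm_inv, Complex.norm_real, norm_eq_abs, abs_of_pos hT, inv_mul_le_iff₀ hT,
      mul_comm]
    exact this.trans (mul_le_mul_of_nonneg_left (volume_overlap_le hT.le x) hK0)
  have hρφ : ∀ T x, ‖(ρ x : ℂ) * ∫ ω, e T ω ∂P‖ ≤ K := fun T x => by
    rw [norm_mul, Complex.norm_real]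
    exact (mul_le_of_le_one_right (norm_nonneg _) (en T)).trans (hρK x)
  have hDK : ∀ T, 0 < T → ∀ x, ‖D T x‖ ≤ 2 * K := fun T hT x => by
    have := norm_sub_le_of_le (hJ T hT x) (hρφ T x)
    rwa [← two_mul] at this
  have rm : Measurable fun x => (r x : ℂ) := Complex.measurable_ofReal.comp h.measurable_cov
  have Jm : ∀ T : ℝ, Measurable fun x => (T : ℂ)⁻¹ * ∫ v in overlap T x, B T v (v + x) := fun T =>
    (measurable_integral_overlap (hBm T) T).const_mul _
  have ρm : Measurable fun x => (ρ x : ℂ) :=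
    Complex.measurable_ofReal.comp (h.measurable_steinCov hg)
  have Dm : ∀ T, Measurable (D T) := fun T => (Jm T).sub (ρm.mul_const _)
  have rC : Integrable fun x => (r x : ℂ) := h.integrable.ofReal
  have key : ∀ T : ℝ, 0 < T → (∫ ω, (scaledIntegral Y g T ω : ℂ) * Complex.I * e T ω ∂P)
        + s * (∫ x, r x * ρ x : ℝ) * ∫ ω, e T ω ∂P = -s * ∫ x, (r x : ℂ) * D T x := by
    intro T hT
    have i1 : Integrable fun x => (r x : ℂ) * ((T : ℂ)⁻¹ * ∫ v in overlap T x, B T v (v + x)) :=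
      rC.mul_bdd (c := K) (Jm T).aestronglyMeasurable (Eventually.of_forall (hJ T hT))
    have i2 : Integrable fun x => (r x : ℂ) * (ρ x * ∫ ω, e T ω ∂P) :=
      rC.mul_bdd (c := K) (ρm.mul_const _).aestronglyMeasurable (Eventually.of_forall (hρφ T))
    have e2 : ∫ x, (r x : ℂ) * (ρ x * ∫ ω, e T ω ∂P)
        = (∫ x, r x * ρ x : ℝ) * ∫ ω, e T ω ∂P := by
      rw [← integral_complex_ofReal, ← integral_mul_const]
      refine integral_congr_ae (Eventually.of_forall fun x => ?_)
      simp only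
      push_cast
      ring
    have e3 : ∫ x, (r x : ℂ) * ((T : ℂ)⁻¹ * ∫ v in overlap T x, B T v (v + x))
        = (T : ℂ)⁻¹ * ∫ x, (r x : ℂ) * ∫ v in overlap T x, B T v (v + x) := by
      rw [← integral_const_mul]
      refine integral_congr_ae (Eventually.of_forall fun x => ?_)
      simp only
      ring
    rw [h.integral_scaledIntegral_mul_cexp hg hT s,
      integral_integral_lag h.integrable h.measurable_cov (hBm T) (hBK T) T]
    simp only [hD, mul_sub]
    rw [integral_sub i1 i2, e2, e3]
    ring
  refine ⟨fun T hT => ?_, ?_⟩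
  · rw [key T hT, norm_mul, norm_neg, Complex.norm_real, norm_eq_abs]
    refine mul_le_mul_of_nonneg_left ?_ (abs_nonneg s)
    rw [← integral_const_mul]
    refine norm_integral_le_of_norm_le (h.integrable.abs.const_mul _)
      (Eventually.of_forall fun x => ?_)
    rw [norm_mul, Complex.norm_real, norm_eq_abs, mul_comm]
    exact mul_le_mul_of_nonneg_right (hDK T hT x) (abs_nonneg _)
  · have h0 : Tendsto (fun T => ∫ x, (r x : ℂ) * D T x) atTop (nhds (∫ x : ℝ, (0 : ℂ))) := by
      refine tendsto_integral_filter_of_dominated_convergence (fun x => 2 * K * |r x|)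
        (Eventually.of_forall fun T => (rm.mul (Dm T)).aestronglyMeasurable)
        ((eventually_gt_atTop 0).mono fun T hT => Eventually.of_forall fun x => ?_)
        (h.integrable.abs.const_mul _) (Eventually.of_forall fun x => ?_)
      · rw [norm_mul, Complex.norm_real, norm_eq_abs, mul_comm]
        exact mul_le_mul_of_nonneg_right (hDK T hT x) (abs_nonneg _)
      · have := (h.tendsto_average_overlap hg x s).const_mul (r x : ℂ)
        rwa [mul_zero] at this
    rw [integral_zero] at h0
    have h1 := h0.const_mul (-(s : ℂ))
    rw [mul_zero] at h1
    exact h1.congr' ((eventually_gt_atTop 0).mono fun T hT => (key T hT).symm)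

/-- The central limit theorem for scaled time integrals, in terms of characteristic functions. -/
lemma tendsto_integral_cexp_scaledIntegral (h : IsStationaryGaussian P Y r)
    (hg : IsAdmissible g g') :
    Tendsto (fun T => ∫ ω, Complex.exp ((scaledIntegral Y g T ω : ℂ) * Complex.I) ∂P) atTop
      (nhds (Complex.exp (((-(∫ x, r x * steinCov P Y g g' x) / 2 : ℝ) : ℂ)))) := by
  obtain ⟨C, hC0, hC⟩ := h.exists_bound_tendsto_cexp_scaledIntegral hg
  set σ := ∫ x, r x * steinCov P Y g g' x with hσ
  set φ : ℝ → ℝ → ℂ := fun T s =>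
    ∫ ω, Complex.exp (((s * scaledIntegral Y g T ω : ℝ) : ℂ) * Complex.I) ∂P with hφ
  set φ' : ℝ → ℝ → ℂ := fun T s => ∫ ω, (scaledIntegral Y g T ω : ℂ) * Complex.I
    * Complex.exp (((s * scaledIntegral Y g T ω : ℝ) : ℂ) * Complex.I) ∂P with hφ'
  have hSm := h.measurable_scaledIntegral hg.continuous.measurable
  have hSi := h.integrable_scaledIntegral hg
  have d1 : ∀ T s, HasDerivAt (φ T) (φ' T s) s := fun T s => hasDerivAt_integral_cexp (hSm T) (hSi T) s
  have c1 : ∀ T, Continuous (φ' T) := fun T => continuous_integral_mul_cexp (hSm T) (hSi T)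
  have c0 : ∀ T, Continuous (φ T) := fun T =>
    continuous_iff_continuousAt.2 fun s => (d1 T s).continuousAt
  set w : ℝ → ℂ := fun s => Complex.exp ((σ * s ^ 2 / 2 : ℝ) : ℂ) with hw
  have dw : ∀ s, HasDerivAt w (w s * ((σ * s : ℝ) : ℂ)) s := fun s => by
    have : HasDerivAt (fun s : ℝ => σ * s ^ 2 / 2) (σ * s) s := by
      have := (((hasDerivAt_id s).pow 2).const_mul σ).div_const 2
      refine this.congr_deriv ?_
      simp; ring
    exact this.ofReal_comp.cexp
  have cw : Continuous w := by fun_prop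
  have ftc : ∀ T, ∫ s in (0 : ℝ)..1, w s * (φ' T s + s * σ * φ T s) = w 1 * φ T 1 - w 0 * φ T 0 := by
    intro T
    refine intervalIntegral.integral_eq_sub_of_hasDerivAt (f := fun s => w s * φ T s)
      (fun s _ => ?_) ?_
    · refine ((dw s).mul (d1 T s)).congr_deriv ?_
      push_cast
      ring
    · have := c0 T
      have := c1 T
      exact Continuous.intervalIntegrable (by fun_prop) _ _
  have hw0 : w 0 = 1 := by simp [hw]
  have hφ0 : ∀ T, φ T 0 = 1 := fun T => by simp [hφ]
  have lim : Tendsto (fun T => ∫ s in (0 : ℝ)..1, w s * (φ' T s + s * σ * φ T s)) atTop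
      (nhds (∫ s in (0 : ℝ)..1, (0 : ℂ))) := by
    refine intervalIntegral.tendsto_integral_filter_of_dominated_convergence
      (fun s => ‖w s‖ * (|s| * C)) (Eventually.of_forall fun T => ?_)
      ((eventually_gt_atTop 0).mono fun T hT => Eventually.of_forall fun s _ => ?_) ?_
      (Eventually.of_forall fun s _ => ?_)
    · have := c0 T
      have := c1 T
      exact Continuous.aestronglyMeasurable (by fun_prop)
    · rw [norm_mul]
      exact mul_le_mul_of_nonneg_left ((hC s).1 T hT) (norm_nonneg _)
    · exact Continuous.intervalIntegrable (by fun_prop) _ _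
    · have := (hC s).2.const_mul (w s)
      rwa [mul_zero] at this
  simp only [ftc, hw0, hφ0, intervalIntegral.integral_zero, mul_one] at lim
  have l2 := (lim.add_const 1).const_mul (w 1)⁻¹
  have hw1 : w 1 ≠ 0 := Complex.exp_ne_zero _
  have e1 : (w 1)⁻¹ * (0 + 1) = Complex.exp (((-σ / 2 : ℝ) : ℂ)) := by
    simp only [hw, zero_add, mul_one]
    rw [← Complex.exp_neg]
    congr 1
    push_cast
    ring
  rw [e1] at l2
  refine l2.congr fun T => ?_
  rw [sub_add_cancel, inv_mul_cancel_left₀ hw1]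
  simp [hφ]

/-- The asymptotic variance is nonnegative. -/
lemma integral_mul_steinCov_nonneg (h : IsStationaryGaussian P Y r) (hg : IsAdmissible g g') :
    0 ≤ ∫ x, r x * steinCov P Y g g' x := by
  have h1 := (h.tendsto_integral_cexp_scaledIntegral hg).norm
  have h2 := le_of_tendsto' h1 (b := 1) fun T => by
    have := norm_integral_le_of_norm_le_const (μ := P) (C := 1) (Eventually.of_forall fun ω =>
      (Complex.norm_exp_ofReal_mul_I (scaledIntegral Y g T ω)).le)
    simpa using this
  rw [Complex.norm_exp_ofReal, exp_le_one_iff] at h2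
  linarith

end IsStationaryGaussian

lemma steinSolution_linear_comb {g₁ g₁' g₂ g₂' : ℝ → ℝ} (h₁ : IsAdmissible g₁ g₁')
    (h₂ : IsAdmissible g₂ g₂') (c d x : ℝ) :
    steinSolution (fun y => c * g₁ y + d * g₂ y) x
      = c * steinSolution g₁ x + d * steinSolution g₂ x := by
  have e : ∀ y, (c * g₁ y + d * g₂ y) * rexp (-y ^ 2 / 2)
      = c * (g₁ y * rexp (-y ^ 2 / 2)) + d * (g₂ y * rexp (-y ^ 2 / 2)) := fun y => by ring
  simp only [steinSolution, e]
  rw [integral_add (h₁.integrable_mul_exp.integrableOn.const_mul c)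
    (h₂.integrable_mul_exp.integrableOn.const_mul d), integral_const_mul, integral_const_mul]
  ring

namespace IsAdmissible

lemma memLp {g g' : ℝ → ℝ} (h : IsAdmissible g g') : MemLp g 4 (gaussianReal 0 1) := by
  obtain ⟨C, -, hb⟩ := h.bound
  exact memLp_gaussianReal_of_bound h.continuous.measurable fun x => (hb x).1

lemma memLp_deriv {g g' : ℝ → ℝ} (h : IsAdmissible g g') : MemLp g' 4 (gaussianReal 0 1) := by
  obtain ⟨C, -, hb⟩ := h.bound
  exact memLp_gaussianReal_of_bound h.measurable_deriv fun x => (hb x).2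

lemma memLp_steinSolution {g g' : ℝ → ℝ} (h : IsAdmissible g g') :
    MemLp (steinSolution g) 4 (gaussianReal 0 1) := by
  obtain ⟨C, -, hb⟩ := h.steinSolution_bound
  exact memLp_gaussianReal_of_bound h.continuous_steinSolution.measurable hb

lemma linear_comb {g₁ g₁' g₂ g₂' : ℝ → ℝ} (h₁ : IsAdmissible g₁ g₁')
    (h₂ : IsAdmissible g₂ g₂') (c d : ℝ) :
    IsAdmissible (fun x => c * g₁ x + d * g₂ x) (fun x => c * g₁' x + d * g₂' x) where
  continuous := (h₁.continuous.const_mul c).add (h₂.continuous.const_mul d)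
  hasDerivAt x hx := ((h₁.hasDerivAt x hx).const_mul c).add ((h₂.hasDerivAt x hx).const_mul d)
  measurable_deriv := (h₁.measurable_deriv.const_mul c).add (h₂.measurable_deriv.const_mul d)
  bound := by
    obtain ⟨C, hC, hb⟩ := h₁.bound
    obtain ⟨D, hD, hb'⟩ := h₂.bound
    have key : ∀ {a b M : ℝ}, |a| ≤ C * M → |b| ≤ D * M →
        |c * a + d * b| ≤ (|c| * C + |d| * D) * M := fun {a b M} ha hb => by
      calc |c * a + d * b| ≤ |c * a| + |d * b| := abs_add_le _ _
        _ = |c| * |a| + |d| * |b| := by rw [abs_mul, abs_mul]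
        _ ≤ |c| * (C * M) + |d| * (D * M) := by gcongr
        _ = _ := by ring
    exact ⟨|c| * C + |d| * D, by positivity, fun x =>
      ⟨key (hb x).1 (hb' x).1, key (hb x).2 (hb' x).2⟩⟩
  integral_eq_zero := by
    rw [integral_add ((h₁.memLp.integrable (by norm_num)).const_mul c)
      ((h₂.memLp.integrable (by norm_num)).const_mul d), integral_const_mul, integral_const_mul,
      h₁.integral_eq_zero, h₂.integral_eq_zero]
    simp

end IsAdmissible

namespace IsStationaryGaussian

variable {Ω : Type*} [MeasurableSpace Ω] {P : Measure Ω} [IsProbabilityMeasure P]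
  {Y : ℝ → Ω → ℝ} {r : ℝ → ℝ} {g₁ g₁' g₂ g₂' : ℝ → ℝ}

/-- The asymptotic covariance as a quadratic form in the coefficients. -/
lemma exists_quadratic_form (h : IsStationaryGaussian P Y r) (h₁ : IsAdmissible g₁ g₁')
    (h₂ : IsAdmissible g₂ g₂') :
    ∃ a b e : ℝ, ∀ c d : ℝ,
      ∫ x, r x * steinCov P Y (fun y => c * g₁ y + d * g₂ y) (fun y => c * g₁' y + d * g₂' y) x
        = c ^ 2 * a + 2 * c * d * b + d ^ 2 * e := by
  have hst : ∀ x c d, steinCov P Y (fun y => c * g₁ y + d * g₂ y)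
      (fun y => c * g₁' y + d * g₂' y) x
        = c ^ 2 * steinCov P Y g₁ g₁' x
          + c * d * ((∫ ω, steinSolution g₁ (Y (max (-x) 0) ω) * g₂' (Y (max x 0) ω) ∂P)
            + ∫ ω, steinSolution g₂ (Y (max (-x) 0) ω) * g₁' (Y (max x 0) ω) ∂P)
          + d ^ 2 * steinCov P Y g₂ g₂' x := by
    intro x c d
    have i : ∀ {A B : ℝ → ℝ}, MemLp A 4 (gaussianReal 0 1) → MemLp B 4 (gaussianReal 0 1) →
        Integrable (fun ω => A (Y (max (-x) 0) ω) * B (Y (max x 0) ω)) P := fun hA hB =>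
      h.integrable_mul_comp (le_max_right _ _) (le_max_right _ _) hA hB
    have i11 := i h₁.memLp_steinSolution h₁.memLp_deriv
    have i12 := i h₁.memLp_steinSolution h₂.memLp_deriv
    have i21 := i h₂.memLp_steinSolution h₁.memLp_deriv
    have i22 := i h₂.memLp_steinSolution h₂.memLp_deriv
    simp only [steinCov, steinSolution_linear_comb h₁ h₂]
    rw [← integral_add i12 i21, ← integral_const_mul, ← integral_const_mul, ← integral_const_mul,
      ← integral_add (i11.const_mul _) (Integrable.const_mul (i12.fun_add i21) _),
      ← integral_add (Integrable.fun_add (i11.const_mul _) (Integrable.const_mul (i12.fun_add i21) _))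
        (i22.const_mul _)]
    refine integral_congr_ae (Eventually.of_forall fun ω => ?_)
    ring
  set cr : ℝ → ℝ := fun x => (∫ ω, steinSolution g₁ (Y (max (-x) 0) ω) * g₂' (Y (max x 0) ω) ∂P)
    + ∫ ω, steinSolution g₂ (Y (max (-x) 0) ω) * g₁' (Y (max x 0) ω) ∂P with hcr
  have j1 := h.integrable_mul_steinCov h₁
  have j2 := h.integrable_mul_steinCov h₂
  have jc : Integrable fun x => r x * cr x := by
    refine (((h.integrable_mul_steinCov (h₁.linear_comb h₂ 1 1)).sub j1).sub j2).congr
      (Eventually.of_forall fun x => ?_)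
    simp only [Pi.sub_apply, hst x 1 1, hcr]
    ring
  refine ⟨∫ x, r x * steinCov P Y g₁ g₁' x, (∫ x, r x * cr x) / 2,
    ∫ x, r x * steinCov P Y g₂ g₂' x, fun c d => ?_⟩
  rw [show c ^ 2 * (∫ x, r x * steinCov P Y g₁ g₁' x) + 2 * c * d * ((∫ x, r x * cr x) / 2)
      = c ^ 2 * (∫ x, r x * steinCov P Y g₁ g₁' x) + c * d * (∫ x, r x * cr x) by ring,
    ← integral_const_mul, ← integral_const_mul, ← integral_const_mul,
    ← integral_add (j1.const_mul _) (jc.const_mul _),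
    ← integral_add (Integrable.fun_add (j1.const_mul _) (jc.const_mul _)) (j2.const_mul _)]
  refine integral_congr_ae (Eventually.of_forall fun x => ?_)
  simp only [hst x c d, hcr]
  ring

end IsStationaryGaussian

lemma integral_gaussianReal_comp_neg (f : ℝ → ℝ) :
    ∫ x, f (-x) ∂(gaussianReal 0 1) = ∫ x, f x ∂(gaussianReal 0 1) := by
  rw [integral_gaussianReal_zero_one, integral_gaussianReal_zero_one,
    ← integral_neg_eq_self (fun x => rexp (-x ^ 2 / 2) • f x)]
  simp

lemma integral_max_gaussianReal : ∫ x, max x 0 ∂(gaussianReal 0 1) = (√(2 * π))⁻¹ := by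
  rw [integral_gaussianReal_zero_one]
  have h1 : ∀ x : ℝ, rexp (-x ^ 2 / 2) • max x 0
      = (Ioi (0 : ℝ)).indicator (fun x => x * rexp (-x ^ 2 / 2)) x := by
    intro x
    by_cases hx : 0 < x
    · rw [indicator_of_mem (mem_Ioi.2 hx), max_eq_left hx.le, smul_eq_mul, mul_comm]
    · rw [indicator_of_notMem (by simpa using hx), max_eq_right (not_lt.1 hx), smul_zero]
  simp only [h1]
  rw [integral_indicator measurableSet_Ioi]
  have h2 : Integrable fun x : ℝ => x * rexp (-x ^ 2 / 2) := by
    have := integrable_mul_exp_neg_mul_sq (b := 1 / 2) (by norm_num)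
    refine this.congr (Eventually.of_forall fun x => ?_)
    ring_nf
  have h3 : ∀ x ∈ Ici (0 : ℝ), HasDerivAt (fun x : ℝ => -rexp (-x ^ 2 / 2))
      (x * rexp (-x ^ 2 / 2)) x := by
    intro x _
    have := (((hasDerivAt_pow 2 x).neg.div_const 2).exp).neg
    refine this.congr_deriv ?_
    simp only [Pi.neg_apply, Nat.cast_ofNat]
    ring
  have h4 : Tendsto (fun x : ℝ => -rexp (-x ^ 2 / 2)) atTop (nhds 0) := by
    have : Tendsto (fun x : ℝ => -x ^ 2 / 2) atTop atBot := by
      have := (tendsto_pow_atTop (α := ℝ) (two_ne_zero)).atTop_div_const (zero_lt_two' ℝ)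
      refine (tendsto_neg_atTop_atBot.comp this).congr fun x => ?_
      simp only [Function.comp]
      ring
    simpa using (tendsto_exp_atBot.comp this).neg
  rw [integral_Ioi_of_hasDerivAt_of_tendsto' h3 h2.integrableOn h4]
  simp

lemma abs_max_zero_le (x : ℝ) : |max x 0| ≤ |x| := by
  rw [abs_of_nonneg (le_max_right _ _)]
  exact max_le (le_abs_self x) (abs_nonneg x)

lemma abs_min_zero_le (x : ℝ) : |min x 0| ≤ |x| := by
  rw [abs_of_nonpos (min_le_right _ _), neg_le]
  exact le_min (neg_abs_le x) (neg_nonpos.2 (abs_nonneg x))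

lemma integrable_gaussianReal_of_bound {A : ℝ → ℝ} (hA : Measurable A) {C : ℝ}
    (hb : ∀ x, |A x| ≤ C * (1 + x ^ 2)) : Integrable A (gaussianReal 0 1) :=
  (memLp_gaussianReal_of_bound hA hb).integrable (by norm_num)

lemma abs_le_one_add_sq (x : ℝ) : |x| ≤ 1 + x ^ 2 := by
  nlinarith [sq_abs x, sq_nonneg (|x| - 1)]

lemma integral_min_gaussianReal : ∫ x, min x 0 ∂(gaussianReal 0 1) = -(√(2 * π))⁻¹ := by
  rw [← integral_gaussianReal_comp_neg, ← integral_max_gaussianReal, ← integral_neg]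
  refine integral_congr_ae (Eventually.of_forall fun x => ?_)
  simpa using min_neg_neg x 0

lemma integrable_max_sq : Integrable (fun x : ℝ => (max x 0) ^ 2) (gaussianReal 0 1) :=
  integrable_gaussianReal_of_bound (C := 1) (by fun_prop) fun x => by
    rw [abs_of_nonneg (sq_nonneg _)]
    nlinarith [sq_le_sq.2 (abs_max_zero_le x)]

lemma integrable_min_sq : Integrable (fun x : ℝ => (min x 0) ^ 2) (gaussianReal 0 1) :=
  integrable_gaussianReal_of_bound (C := 1) (by fun_prop) fun x => by
    rw [abs_of_nonneg (sq_nonneg _)]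
    nlinarith [sq_le_sq.2 (abs_min_zero_le x)]

lemma integral_min_sq_eq :
    ∫ x, (min x 0) ^ 2 ∂(gaussianReal 0 1) = ∫ x, (max x 0) ^ 2 ∂(gaussianReal 0 1) := by
  rw [← integral_gaussianReal_comp_neg]
  refine integral_congr_ae (Eventually.of_forall fun x => ?_)
  have := min_neg_neg x 0
  rw [neg_zero] at this
  simp only [this]
  ring

lemma integral_max_sq : ∫ x, (max x 0) ^ 2 ∂(gaussianReal 0 1) = 1 / 2 := by
  have h1 : (∫ x, (max x 0) ^ 2 ∂(gaussianReal 0 1)) + ∫ x, (min x 0) ^ 2 ∂(gaussianReal 0 1)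
      = 1 := by
    rw [← integral_add integrable_max_sq integrable_min_sq]
    have h2 := IsStationaryGaussian.integral_sq_gaussianReal 1
    rw [NNReal.coe_one] at h2
    rw [← h2]
    refine integral_congr_ae (Eventually.of_forall fun x => ?_)
    rcases le_total x 0 with hx | hx <;> simp [hx]
  rw [integral_min_sq_eq] at h1
  linarith

/-- The centred oscillating function is admissible. -/
lemma isAdmissible_oscillating (a b : ℝ) :
    IsAdmissible (fun x => a * max x 0 + b * min x 0 - (a - b) * (√(2 * π))⁻¹)
      (fun x => if 0 < x then a else b) where
  continuous := by fun_prop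
  hasDerivAt x hx := by
    rcases lt_or_gt_of_ne hx with hx | hx
    · rw [if_neg hx.not_gt]
      have : HasDerivAt (fun x : ℝ => b * x - (a - b) * (√(2 * π))⁻¹) b x := by
        simpa using ((hasDerivAt_id x).const_mul b).sub_const ((a - b) * (√(2 * π))⁻¹)
      refine this.congr_of_eventuallyEq ?_
      filter_upwards [Iio_mem_nhds hx] with y hy
      have hy : y < 0 := hy
      simp [hy.le]
    · rw [if_pos hx]
      have : HasDerivAt (fun x : ℝ => a * x - (a - b) * (√(2 * π))⁻¹) a x := by
        simpa using ((hasDerivAt_id x).const_mul a).sub_const ((a - b) * (√(2 * π))⁻¹)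
      refine this.congr_of_eventuallyEq ?_
      filter_upwards [Ioi_mem_nhds hx] with y hy
      have hy : 0 < y := hy
      simp [hy.le]
  measurable_deriv := by
    have : MeasurableSet {x : ℝ | 0 < x} := measurableSet_Ioi
    exact Measurable.ite this measurable_const measurable_const
  bound := by
    refine ⟨|a| + |b| + |(a - b) * (√(2 * π))⁻¹|, by positivity, fun x => ⟨?_, ?_⟩⟩
    · have h1 := (abs_max_zero_le x).trans (abs_le_one_add_sq x)
      have h2 := (abs_min_zero_le x).trans (abs_le_one_add_sq x)
      calc |a * max x 0 + b * min x 0 - (a - b) * (√(2 * π))⁻¹|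
          ≤ |a * max x 0| + |b * min x 0| + |(a - b) * (√(2 * π))⁻¹| :=
            (abs_sub _ _).trans (add_le_add_left (abs_add_le _ _) _)
        _ ≤ |a| * (1 + x ^ 2) + |b| * (1 + x ^ 2) + |(a - b) * (√(2 * π))⁻¹| * (1 + x ^ 2) := by
            rw [abs_mul a, abs_mul b]
            gcongr
            exact le_mul_of_one_le_right (abs_nonneg _) (by nlinarith [sq_nonneg x])
        _ = _ := by ring
    · have h1 : |if 0 < x then a else b| ≤ |a| + |b| + |(a - b) * (√(2 * π))⁻¹| := by
        split_ifs <;> linarith [abs_nonneg a, abs_nonneg b, abs_nonneg ((a - b) * (√(2 * π))⁻¹)]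
      exact h1.trans (le_mul_of_one_le_right (by positivity) (by nlinarith [sq_nonneg x]))
  integral_eq_zero := by
    have h1 : Integrable (fun x : ℝ => max x 0) (gaussianReal 0 1) :=
      integrable_gaussianReal_of_bound (C := 1) (by fun_prop) fun x => by
        rw [one_mul]; exact (abs_max_zero_le x).trans (abs_le_one_add_sq x)
    have h2 : Integrable (fun x : ℝ => min x 0) (gaussianReal 0 1) :=
      integrable_gaussianReal_of_bound (C := 1) (by fun_prop) fun x => by
        rw [one_mul]; exact (abs_min_zero_le x).trans (abs_le_one_add_sq x)
    rw [integral_sub (Integrable.fun_add (h1.const_mul a) (h2.const_mul b)) (integrable_const _),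
      integral_add (h1.const_mul a) (h2.const_mul b), integral_const_mul, integral_const_mul,
      integral_max_gaussianReal, integral_min_gaussianReal]
    simp
    ring

/-- The centred square of the oscillating function is admissible. -/
lemma isAdmissible_oscillating_sq (a b : ℝ) :
    IsAdmissible (fun x => a * (max x 0) ^ 2 + b * (min x 0) ^ 2 - (a + b) / 2)
      (fun x => 2 * a * max x 0 + 2 * b * min x 0) where
  continuous := by fun_prop
  hasDerivAt x hx := by
    rcases lt_or_gt_of_ne hx with hx | hx
    · have : HasDerivAt (fun x : ℝ => b * x ^ 2 - (a + b) / 2)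
          (2 * a * max x 0 + 2 * b * min x 0) x := by
        refine (((hasDerivAt_pow 2 x).const_mul b).sub_const ((a + b) / 2)).congr_deriv ?_
        simp only [max_eq_right hx.le, min_eq_left hx.le]
        push_cast
        ring
      refine this.congr_of_eventuallyEq ?_
      filter_upwards [Iio_mem_nhds hx] with y hy
      have hy : y < 0 := hy
      simp [hy.le]
    · have : HasDerivAt (fun x : ℝ => a * x ^ 2 - (a + b) / 2)
          (2 * a * max x 0 + 2 * b * min x 0) x := by
        refine (((hasDerivAt_pow 2 x).const_mul a).sub_const ((a + b) / 2)).congr_deriv ?_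
        simp only [max_eq_left hx.le, min_eq_right hx.le]
        push_cast
        ring
      refine this.congr_of_eventuallyEq ?_
      filter_upwards [Ioi_mem_nhds hx] with y hy
      have hy : 0 < y := hy
      simp [hy.le]
  measurable_deriv := by fun_prop
  bound := by
    refine ⟨2 * |a| + 2 * |b| + |(a + b) / 2|, by positivity, fun x => ?_⟩
    have h1 := (abs_max_zero_le x).trans (abs_le_one_add_sq x)
    have h2 := (abs_min_zero_le x).trans (abs_le_one_add_sq x)
    have h3 : (max x 0) ^ 2 ≤ 2 * (1 + x ^ 2) := by
      nlinarith [sq_le_sq.2 (abs_max_zero_le x), sq_nonneg x]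
    have h4 : (min x 0) ^ 2 ≤ 2 * (1 + x ^ 2) := by
      nlinarith [sq_le_sq.2 (abs_min_zero_le x), sq_nonneg x]
    constructor
    · calc |a * (max x 0) ^ 2 + b * (min x 0) ^ 2 - (a + b) / 2|
          ≤ |a * (max x 0) ^ 2| + |b * (min x 0) ^ 2| + |(a + b) / 2| :=
            (abs_sub _ _).trans (add_le_add_left (abs_add_le _ _) _)
        _ ≤ |a| * (2 * (1 + x ^ 2)) + |b| * (2 * (1 + x ^ 2)) + |(a + b) / 2| * (1 + x ^ 2) := by
            rw [abs_mul a, abs_mul b, abs_of_nonneg (sq_nonneg (max x 0)),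
              abs_of_nonneg (sq_nonneg (min x 0))]
            gcongr
            exact le_mul_of_one_le_right (abs_nonneg _) (by nlinarith [sq_nonneg x])
        _ = _ := by ring
    · calc |2 * a * max x 0 + 2 * b * min x 0|
          ≤ |2 * a * max x 0| + |2 * b * min x 0| := abs_add_le _ _
        _ ≤ 2 * |a| * (1 + x ^ 2) + 2 * |b| * (1 + x ^ 2) + |(a + b) / 2| * (1 + x ^ 2) := by
            rw [abs_mul (2 * a), abs_mul (2 * b), abs_mul 2 a, abs_mul 2 b, abs_two]
            refine le_add_of_le_of_nonneg ?_ (by positivity)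
            gcongr
        _ = _ := by ring
  integral_eq_zero := by
    rw [integral_sub (Integrable.fun_add (integrable_max_sq.const_mul a)
        (integrable_min_sq.const_mul b)) (integrable_const _),
      integral_add (integrable_max_sq.const_mul a) (integrable_min_sq.const_mul b),
      integral_const_mul, integral_const_mul, integral_min_sq_eq, integral_max_sq]
    simp
    ring

lemma posSemidef_of_quadratic_form {a b e : ℝ}
    (hQ : ∀ c d : ℝ, 0 ≤ c ^ 2 * a + 2 * c * d * b + d ^ 2 * e) :
    (!![a, b; b, e] : Matrix (Fin 2) (Fin 2) ℝ).PosSemidef := by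
  refine Matrix.PosSemidef.of_dotProduct_mulVec_nonneg ?_ fun x => ?_
  · ext i j
    fin_cases i <;> fin_cases j <;> simp
  · refine (hQ (x 0) (x 1)).trans_eq ?_
    simp [Matrix.mulVec, dotProduct, Fin.sum_univ_two]
    ring

/-- A centred Gaussian law on the plane with prescribed covariance. -/
lemma exists_gaussian_of_quadratic_form {a b e : ℝ}
    (hQ : ∀ c d : ℝ, 0 ≤ c ^ 2 * a + 2 * c * d * b + d ^ 2 * e) :
    ∃ μ : Measure (ℝ × ℝ), IsProbabilityMeasure μ ∧ ∀ c d : ℝ,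
      ∫ z, Complex.exp (((c * z.1 + d * z.2 : ℝ) : ℂ) * Complex.I) ∂μ
        = Complex.exp ((-(c ^ 2 * a + 2 * c * d * b + d ^ 2 * e) / 2 : ℝ) : ℂ) := by
  have hS := posSemidef_of_quadratic_form hQ
  have hm : Measurable fun x : EuclideanSpace ℝ (Fin 2) => (x 0, x 1) := by fun_prop
  refine ⟨(multivariateGaussian 0 !![a, b; b, e]).map fun x => (x 0, x 1),
    Measure.isProbabilityMeasure_map hm.aemeasurable, fun c d => ?_⟩
  rw [integral_map hm.aemeasurable (by fun_prop)]
  have h1 := charFun_multivariateGaussian (μ := 0) hS (!₂[c, d] : EuclideanSpace ℝ (Fin 2))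
  rw [charFun_apply] at h1
  have h2 : ∀ x : EuclideanSpace ℝ (Fin 2),
      inner ℝ x (!₂[c, d] : EuclideanSpace ℝ (Fin 2)) = c * x 0 + d * x 1 := fun x => by
    simp [PiLp.inner_apply, Fin.sum_univ_two]
  simp only [h2] at h1
  rw [h1]
  congr 1
  simp [Matrix.mulVec, dotProduct, Fin.sum_univ_two]
  ring

/-- Joint convergence in law of a random pair and a deterministic null sequence. -/
lemma tendsto_integral_of_tendsto_integral_cexp_pair {Ω : Type*} [MeasurableSpace Ω]
    {P : Measure Ω} [IsProbabilityMeasure P] {Z₁ Z₂ : ℕ → Ω → ℝ} {τ : ℕ → ℝ}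
    (h₁ : ∀ n, Measurable (Z₁ n)) (h₂ : ∀ n, Measurable (Z₂ n)) (hτ : Tendsto τ atTop (nhds 0))
    {μ : Measure (ℝ × ℝ)} [IsProbabilityMeasure μ]
    (h : ∀ c d : ℝ, Tendsto
      (fun n => ∫ ω, Complex.exp (((c * Z₁ n ω + d * Z₂ n ω : ℝ) : ℂ) * Complex.I) ∂P) atTop
      (nhds (∫ z, Complex.exp (((c * z.1 + d * z.2 : ℝ) : ℂ) * Complex.I) ∂μ)))
    {F : ℝ → ℝ → ℝ → ℝ} (hF : Continuous fun p : ℝ × ℝ × ℝ => F p.1 p.2.1 p.2.2) {M : ℝ}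
    (hM : ∀ x y t, |F x y t| ≤ M) :
    Tendsto (fun n => ∫ ω, F (Z₁ n ω) (Z₂ n ω) (τ n) ∂P) atTop
      (nhds (∫ z, F z.1 z.2 0 ∂μ)) := by
  have m1 : ∀ n, Measurable fun ω => (![Z₁ n ω, Z₂ n ω, τ n] : Fin 3 → ℝ) := fun n => by
    refine measurable_pi_iff.2 fun i => ?_
    fin_cases i
    · exact h₁ n
    · exact h₂ n
    · exact measurable_const
  have m2 : Measurable fun z : ℝ × ℝ => (![z.1, z.2, 0] : Fin 3 → ℝ) := by
    refine measurable_pi_iff.2 fun i => ?_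
    fin_cases i
    · exact measurable_fst
    · exact measurable_snd
    · exact measurable_const
  have hF' : Continuous fun x : Fin 3 → ℝ => F (x 0) (x 1) (x 2) :=
    hF.comp (by fun_prop : Continuous fun x : Fin 3 → ℝ => (x 0, x 1, x 2))
  have p1 : ∀ n, IsProbabilityMeasure (P.map fun ω => (![Z₁ n ω, Z₂ n ω, τ n] : Fin 3 → ℝ)) :=
    fun n => Measure.isProbabilityMeasure_map (m1 n).aemeasurable
  have p2 : IsProbabilityMeasure (μ.map fun z : ℝ × ℝ => (![z.1, z.2, 0] : Fin 3 → ℝ)) :=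
    Measure.isProbabilityMeasure_map m2.aemeasurable
  have key := tendsto_integral_of_tendsto_integral_cexp_sum
    (μ := fun n => P.map fun ω => (![Z₁ n ω, Z₂ n ω, τ n] : Fin 3 → ℝ))
    (μ₀ := μ.map fun z : ℝ × ℝ => (![z.1, z.2, 0] : Fin 3 → ℝ)) (fun c => ?_) hF'
    (M := M) fun x => hM _ _ _
  · rw [integral_map m2.aemeasurable hF'.aestronglyMeasurable] at key
    refine key.congr fun n => ?_
    rw [integral_map (m1 n).aemeasurable hF'.aestronglyMeasurable]
    rfl
  · rw [integral_map m2.aemeasurable (measurable_cexp_sum c).aestronglyMeasurable]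
    have e : ∀ n, Complex.exp (((c 2 * τ n : ℝ) : ℂ) * Complex.I)
        * ∫ ω, Complex.exp (((c 0 * Z₁ n ω + c 1 * Z₂ n ω : ℝ) : ℂ) * Complex.I) ∂P
        = ∫ x, Complex.exp (((∑ i, c i * x i : ℝ) : ℂ) * Complex.I)
          ∂(P.map fun ω => (![Z₁ n ω, Z₂ n ω, τ n] : Fin 3 → ℝ)) := by
      intro n
      rw [integral_map (m1 n).aemeasurable (measurable_cexp_sum c).aestronglyMeasurable,
        ← integral_const_mul]
      refine integral_congr_ae (Eventually.of_forall fun ω => ?_)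
      simp only [← Complex.exp_add, Fin.sum_univ_three]
      congr 1
      simp
      ring
    refine Tendsto.congr e ?_
    have l1 : Tendsto (fun n => Complex.exp (((c 2 * τ n : ℝ) : ℂ) * Complex.I)) atTop
        (nhds 1) := by
      have : Continuous fun t : ℝ => Complex.exp (((c 2 * t : ℝ) : ℂ) * Complex.I) := by fun_prop
      have := (this.tendsto 0).comp hτ
      simpa [Function.comp_def] using this
    have l2 := l1.mul (h (c 0) (c 1))
    rw [one_mul] at l2
    convert l2 using 5 with z
    simp [Fin.sum_univ_three]

/-- A centred Gaussian law on the plane is determined along each linear functional. -/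
lemma map_linear_eq_gaussianReal {μ : Measure (ℝ × ℝ)} [IsProbabilityMeasure μ]
    {L : ℝ × ℝ → ℝ} (hL : Measurable L) {q : ℝ} (hq : 0 ≤ q)
    (h : ∀ t : ℝ, ∫ z, Complex.exp (((t * L z : ℝ) : ℂ) * Complex.I) ∂μ
      = Complex.exp ((-(t ^ 2 * q) / 2 : ℝ) : ℂ)) :
    μ.map L = gaussianReal 0 q.toNNReal := by
  have := Measure.isProbabilityMeasure_map (μ := μ) hL.aemeasurable
  refine Measure.ext_of_charFun (funext fun t => ?_)
  rw [charFun_gaussianReal, charFun_apply_real, integral_map hL.aemeasurable (by fun_prop)]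
  have := h t
  push_cast at this
  rw [this, coe_toNNReal _ hq]
  congr 1
  push_cast
  ring

lemma differentiableAt_sqrt_abs {a : ℝ} (ha : 0 < a) :
    DifferentiableAt ℝ (fun y : ℝ => √|y|) a :=
  (differentiableAt_abs ha.ne').sqrt (abs_pos.2 ha.ne').ne'

lemma continuous_dslope_sqrt_abs {a : ℝ} (ha : 0 < a) :
    Continuous (dslope (fun y : ℝ => √|y|) a) := by
  refine continuous_iff_continuousAt.2 fun y => ?_
  rcases eq_or_ne y a with rfl | hy
  · exact continuousAt_dslope_same.2 (differentiableAt_sqrt_abs ha)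
  · exact (continuousAt_dslope_of_ne hy).2 (by fun_prop)

/-- The rescaled fluctuation of `√|4 m₂ - 2 π m₁ ^ 2|` when `m₁`, `m₂` fluctuate by `t * x`,
`t * y` around their limits. -/
noncomputable def sqrtFluctuation (a m x y t : ℝ) : ℝ :=
  (4 * y - 4 * π * m * x - 2 * π * t * x ^ 2)
    * dslope (fun y : ℝ => √|y|) a (a + t * (4 * y - 4 * π * m * x - 2 * π * t * x ^ 2))

lemma mul_sqrtFluctuation {a m n : ℝ} (ha : 4 * n - 2 * π * m ^ 2 = a) (x y t : ℝ) :
    t * sqrtFluctuation a m x y t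
      = √|4 * (n + t * y) - 2 * π * (m + t * x) ^ 2| - √|a| := by
  set N := 4 * y - 4 * π * m * x - 2 * π * t * x ^ 2 with hN
  have e : 4 * (n + t * y) - 2 * π * (m + t * x) ^ 2 = a + t * N := by
    rw [← ha, hN]
    ring
  have := sub_smul_dslope (fun y : ℝ => √|y|) a (a + t * N)
  rw [e, ← this, sqrtFluctuation, ← hN, add_sub_cancel_left, smul_eq_mul]
  ring

namespace IsStationaryGaussian

variable {Ω : Type*} [MeasurableSpace Ω] {P : Measure Ω} [IsProbabilityMeasure P]
  {Y : ℝ → Ω → ℝ} {r : ℝ → ℝ} {g₁ g₁' g₂ g₂' : ℝ → ℝ}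

lemma ae_average_eq (h : IsStationaryGaussian P Y r) {A g' : ℝ → ℝ} {m : ℝ}
    (hg : IsAdmissible (fun x => A x - m) g') {T : ℝ} (hT : 0 < T) :
    ∀ᵐ ω ∂P, (1 / T) * ∫ u in Ioc 0 T, A (Y u ω)
      = m + (√T)⁻¹ * scaledIntegral Y (fun x => A x - m) T ω := by
  filter_upwards [(h.integrable_comp_prod_Ioc hg T).prod_right_ae] with ω hω
  have e : ∫ u in Ioc 0 T, A (Y u ω) = (∫ u in Ioc 0 T, (A (Y u ω) - m)) + T * m := by
    have := integral_add hω (integrable_const m)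
    simp only [sub_add_cancel, integral_const, smul_eq_mul] at this
    rw [this]
    simp [hT.le]
  have e2 : (√T)⁻¹ * (√T)⁻¹ = 1 / T := by
    rw [← mul_inv, mul_self_sqrt hT.le, one_div]
  rw [e, scaledIntegral, ← mul_assoc, e2]
  field_simp
  ring

lemma ae_scaledIntegral_linear_comb (h : IsStationaryGaussian P Y r) (h₁ : IsAdmissible g₁ g₁')
    (h₂ : IsAdmissible g₂ g₂') (c d T : ℝ) :
    ∀ᵐ ω ∂P, scaledIntegral Y (fun x => c * g₁ x + d * g₂ x) T ω
      = c * scaledIntegral Y g₁ T ω + d * scaledIntegral Y g₂ T ω := by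
  filter_upwards [(h.integrable_comp_prod_Ioc h₁ T).prod_right_ae,
    (h.integrable_comp_prod_Ioc h₂ T).prod_right_ae] with ω i₁ i₂
  rw [scaledIntegral, integral_add (i₁.const_mul c) (i₂.const_mul d), integral_const_mul,
    integral_const_mul, scaledIntegral, scaledIntegral]
  ring

/-- The bivariate central limit theorem for scaled time integrals, tested on continuous functions
that may also depend on the rate `(√T)⁻¹`. -/
lemma exists_tendsto_integral_scaledIntegral_pair (h : IsStationaryGaussian P Y r)
    (h₁ : IsAdmissible g₁ g₁') (h₂ : IsAdmissible g₂ g₂') :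
    ∃ a b e : ℝ, (∀ c d : ℝ, 0 ≤ c ^ 2 * a + 2 * c * d * b + d ^ 2 * e) ∧
      ∃ μ : Measure (ℝ × ℝ), IsProbabilityMeasure μ ∧
        (∀ c d : ℝ, ∫ z, Complex.exp (((c * z.1 + d * z.2 : ℝ) : ℂ) * Complex.I) ∂μ
          = Complex.exp ((-(c ^ 2 * a + 2 * c * d * b + d ^ 2 * e) / 2 : ℝ) : ℂ)) ∧
        ∀ (F : ℝ → ℝ → ℝ → ℝ) (M : ℝ), (Continuous fun p : ℝ × ℝ × ℝ => F p.1 p.2.1 p.2.2) →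
          (∀ x y t, |F x y t| ≤ M) →
          Tendsto (fun T : ℝ => ∫ ω, F (scaledIntegral Y g₁ T ω) (scaledIntegral Y g₂ T ω) (√T)⁻¹
            ∂P) atTop (nhds (∫ z, F z.1 z.2 0 ∂μ)) := by
  obtain ⟨a, b, e, hQ⟩ := h.exists_quadratic_form h₁ h₂
  have hQ0 : ∀ c d : ℝ, 0 ≤ c ^ 2 * a + 2 * c * d * b + d ^ 2 * e := fun c d =>
    (h.integral_mul_steinCov_nonneg (h₁.linear_comb h₂ c d)).trans_eq (hQ c d)
  obtain ⟨μ, hμ, hμc⟩ := exists_gaussian_of_quadratic_form hQ0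
  refine ⟨a, b, e, hQ0, μ, hμ, hμc, fun F M hF hM => ?_⟩
  refine tendsto_of_seq_tendsto fun T hT => ?_
  refine tendsto_integral_of_tendsto_integral_cexp_pair
    (fun n => h.measurable_scaledIntegral h₁.continuous.measurable _)
    (fun n => h.measurable_scaledIntegral h₂.continuous.measurable _) ?_ (fun c d => ?_) hF hM
  · exact tendsto_inv_atTop_zero.comp (tendsto_sqrt_atTop.comp hT)
  · have := (h.tendsto_integral_cexp_scaledIntegral (h₁.linear_comb h₂ c d)).comp hT
    rw [hQ c d, ← hμc c d] at this
    refine this.congr fun n => ?_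
    refine integral_congr_ae ?_
    filter_upwards [h.ae_scaledIntegral_linear_comb h₁ h₂ c d (T n)] with ω hω
    rw [hω]

end IsStationaryGaussian

/-- Theorem 3.4, case (1): asymptotic normality of the parameter estimators
`α̂₊(T)`, `α̂₋(T)` under short-range dependence (`r ∈ L¹(ℝ)`). Convergence in
distribution is expressed via bounded continuous test functions, and the limiting
centered bivariate Gaussian law is characterised by the Gaussianity of all its
linear functionals. -/
theorem parameter_estimator_clt_short_range
    {Ω : Type*} [MeasurableSpace Ω] (P : Measure Ω) [IsProbabilityMeasure P]
    (Y : ℝ → Ω → ℝ) (hYmeas : Measurable (Function.uncurry Y))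
    (r : ℝ → ℝ) (hreven : ∀ t, r (-t) = r t) (hr0 : r 0 = 1)
    (hGauss : ∀ (k : ℕ) (t c : Fin k → ℝ), (∀ i, 0 ≤ t i) →
      P.map (fun ω => ∑ i, c i * Y (t i) ω)
        = gaussianReal 0 (Real.toNNReal (∑ i, ∑ j, c i * c j * r (t i - t j))))
    (hrL1 : Integrable r)
    (αp αm : ℝ) (hαp : 0 < αp) (hαm : 0 < αm) (hne : αp ≠ αm)
    (X : ℝ → Ω → ℝ)
    (hX : ∀ t ω, X t ω = αp * Y t ω * (if 0 < Y t ω then (1 : ℝ) else 0)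
            + αm * Y t ω * (if Y t ω < 0 then (1 : ℝ) else 0))
    (m1 m2 : ℝ → Ω → ℝ)
    (hm1 : ∀ T ω, m1 T ω = (1 / T) * ∫ u in Set.Ioc (0 : ℝ) T, X u ω)
    (hm2 : ∀ T ω, m2 T ω = (1 / T) * ∫ u in Set.Ioc (0 : ℝ) T, (X u ω) ^ 2)
    (aPlus aMinus : ℝ → Ω → ℝ)
    (haPlus : ∀ T ω, aPlus T ω
      = Real.sqrt (π / 2) * m1 T ω
        + (1 / 2) * Real.sqrt |4 * m2 T ω - 2 * π * (m1 T ω) ^ 2|)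
    (haMinus : ∀ T ω, aMinus T ω
      = -Real.sqrt (π / 2) * m1 T ω
        + (1 / 2) * Real.sqrt |4 * m2 T ω - 2 * π * (m1 T ω) ^ 2|) :
    ∃ S : Matrix (Fin 2) (Fin 2) ℝ, S.PosSemidef ∧
      ∃ μ : Measure (ℝ × ℝ), IsProbabilityMeasure μ ∧
        (∀ c d : ℝ, μ.map (fun x => c * x.1 + d * x.2)
          = gaussianReal 0
              (Real.toNNReal (c ^ 2 * S 0 0 + 2 * c * d * S 0 1 + d ^ 2 * S 1 1)))
        ∧ ∀ f : BoundedContinuousFunction (ℝ × ℝ) ℝ,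
            Tendsto (fun T : ℝ =>
                ∫ ω, f (Real.sqrt T * (aPlus T ω - αp),
                        Real.sqrt T * (aMinus T ω - αm)) ∂P)
              atTop (nhds (∫ x, f x ∂μ)) := by
  have h : IsStationaryGaussian P Y r := ⟨hYmeas, hreven, hr0, hGauss, hrL1⟩
  have hX1 : ∀ t ω, X t ω = αp * max (Y t ω) 0 + αm * min (Y t ω) 0 := fun t ω => by
    rw [hX]
    rcases lt_trichotomy (Y t ω) 0 with hy | hy | hy
    · simp [hy, hy.le, hy.not_gt]
    · simp [hy]
    · simp [hy, hy.le, hy.not_gt]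
  have hX2 : ∀ t ω, X t ω ^ 2 = αp ^ 2 * max (Y t ω) 0 ^ 2 + αm ^ 2 * min (Y t ω) 0 ^ 2 :=
    fun t ω => by
      rw [hX1]
      rcases le_total (Y t ω) 0 with hy | hy <;> simp [hy] <;> ring
  have h₁ := isAdmissible_oscillating αp αm
  have h₂ := isAdmissible_oscillating_sq (αp ^ 2) (αm ^ 2)
  obtain ⟨a, b, e, hQ, μ, hμ, hμc, hlim⟩ :=
    h.exists_tendsto_integral_scaledIntegral_pair h₁ h₂
  set μ₁ := (αp - αm) * (√(2 * π))⁻¹ with hμ₁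
  set μ₂ := (αp ^ 2 + αm ^ 2) / 2 with hμ₂
  set q := √(π / 2) with hq
  set D := (αp + αm) ^ 2 with hD
  have hDpos : 0 < D := by positivity
  have hs : (√(2 * π))⁻¹ ^ 2 * (2 * π) = 1 := by
    rw [inv_pow, sq_sqrt (by positivity), inv_mul_cancel₀ (by positivity)]
  have hDμ : 4 * μ₂ - 2 * π * μ₁ ^ 2 = D := by
    rw [hμ₁, hμ₂, hD, mul_pow]
    linear_combination (-(αp - αm) ^ 2) * hs
  have hqμ : q * μ₁ = (αp - αm) / 2 := by
    have : √(2 * π) = 2 * q := by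
      rw [hq, show 2 * π = 2 ^ 2 * (π / 2) by ring, sqrt_mul (by positivity),
        sqrt_sq (by norm_num)]
    have hq0 : q ≠ 0 := (sqrt_pos.2 (by positivity)).ne'
    rw [hμ₁, this]
    field_simp
  have hsD : √|D| = αp + αm := by
    rw [abs_of_pos hDpos, hD, sqrt_sq (by positivity)]
  set κ := dslope (fun y : ℝ => √|y|) D D with hκ
  set u := q - 2 * π * κ * μ₁ with hu
  set v := -q - 2 * π * κ * μ₁ with hv
  set w := 2 * κ with hw
  let S : Matrix (Fin 2) (Fin 2) ℝ :=
    !![u ^ 2 * a + 2 * u * w * b + w ^ 2 * e, u * v * a + (u + v) * w * b + w ^ 2 * e;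
      u * v * a + (u + v) * w * b + w ^ 2 * e, v ^ 2 * a + 2 * v * w * b + w ^ 2 * e]
  have hS : ∀ c d : ℝ, c ^ 2 * (u ^ 2 * a + 2 * u * w * b + w ^ 2 * e)
      + 2 * c * d * (u * v * a + (u + v) * w * b + w ^ 2 * e)
      + d ^ 2 * (v ^ 2 * a + 2 * v * w * b + w ^ 2 * e)
      = (c * u + d * v) ^ 2 * a + 2 * (c * u + d * v) * ((c + d) * w) * b
        + ((c + d) * w) ^ 2 * e := fun c d => by ring
  have hSQ := fun c d : ℝ => (hQ (c * u + d * v) ((c + d) * w)).trans_eq (hS c d).symm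
  have mG : Measurable fun z : ℝ × ℝ => (u * z.1 + w * z.2, v * z.1 + w * z.2) := by fun_prop
  refine ⟨S, posSemidef_of_quadratic_form hSQ,
    μ.map fun z => (u * z.1 + w * z.2, v * z.1 + w * z.2),
    Measure.isProbabilityMeasure_map mG.aemeasurable, fun c d => ?_, fun f => ?_⟩
  · rw [Measure.map_map (by fun_prop) mG]
    refine map_linear_eq_gaussianReal (by fun_prop) (hSQ c d) fun t => ?_
    refine Eq.trans ?_ (congrArg (fun s : ℝ => Complex.exp ((-(t ^ 2 * s) / 2 : ℝ) : ℂ))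
      (hS c d).symm)
    have := hμc (t * (c * u + d * v)) (t * ((c + d) * w))
    rw [show -(t ^ 2 * ((c * u + d * v) ^ 2 * a + 2 * (c * u + d * v) * ((c + d) * w) * b
        + ((c + d) * w) ^ 2 * e)) / 2 = -((t * (c * u + d * v)) ^ 2 * a
        + 2 * (t * (c * u + d * v)) * (t * ((c + d) * w)) * b
        + (t * ((c + d) * w)) ^ 2 * e) / 2 by ring, ← this]
    refine integral_congr_ae (Eventually.of_forall fun z => ?_)
    simp only [Function.comp]
    congr 3
    ring
  · rw [integral_map mG.aemeasurable f.continuous.aestronglyMeasurable]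
    let F : ℝ → ℝ → ℝ → ℝ := fun x y t =>
      f (q * x + 1 / 2 * sqrtFluctuation D μ₁ x y t, -q * x + 1 / 2 * sqrtFluctuation D μ₁ x y t)
    have hcs : Continuous fun p : ℝ × ℝ × ℝ => sqrtFluctuation D μ₁ p.1 p.2.1 p.2.2 := by
      have := continuous_dslope_sqrt_abs hDpos
      unfold sqrtFluctuation
      fun_prop
    have hF : Continuous fun p : ℝ × ℝ × ℝ => F p.1 p.2.1 p.2.2 :=
      f.continuous.comp (by fun_prop)
    have l := hlim F ‖f‖ hF fun x y t => f.norm_coe_le_norm _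
    have e1 : ∫ z, f (u * z.1 + w * z.2, v * z.1 + w * z.2) ∂μ = ∫ z, F z.1 z.2 0 ∂μ := by
      refine integral_congr_ae (Eventually.of_forall fun z => ?_)
      have : sqrtFluctuation D μ₁ z.1 z.2 0 = (4 * z.2 - 4 * π * μ₁ * z.1) * κ := by
        simp [sqrtFluctuation, hκ]
      simp only [F, this, hu, hv, hw]
      congr 2 <;> ring
    rw [e1]
    refine l.congr' ?_
    filter_upwards [eventually_gt_atTop 0] with T hT
    refine integral_congr_ae ?_
    filter_upwards [h.ae_average_eq h₁ hT, h.ae_average_eq h₂ hT] with ω e₁ e₂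
    have hsT : √T * (√T)⁻¹ = 1 := mul_inv_cancel₀ (sqrt_pos.2 hT).ne'
    set x := scaledIntegral Y (fun x => αp * max x 0 + αm * min x 0 - μ₁) T ω
    set y := scaledIntegral Y (fun x => αp ^ 2 * max x 0 ^ 2 + αm ^ 2 * min x 0 ^ 2 - μ₂) T ω
    have f₁ : m1 T ω = μ₁ + (√T)⁻¹ * x := by
      rw [hm1, ← e₁]
      simp only [hX1]
    have f₂ : m2 T ω = μ₂ + (√T)⁻¹ * y := by
      rw [hm2, ← e₂]
      simp only [hX2]
    have k := mul_sqrtFluctuation hDμ x y (√T)⁻¹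
    rw [← f₁, ← f₂, hsD] at k
    simp only [F]
    congr 2
    · rw [haPlus]
      linear_combination
        (-(q * x + 1 / 2 * sqrtFluctuation D μ₁ x y (√T)⁻¹)) * hsT - √T * hqμ
          - √T * q * f₁ + 1 / 2 * √T * k
    · rw [haMinus]
      linear_combination
        (-(-q * x + 1 / 2 * sqrtFluctuation D μ₁ x y (√T)⁻¹)) * hsT + √T * hqμ
          + √T * q * f₁ + 1 / 2 * √T * k
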